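/- Suppose Assumptions (A1) and (A2) hold and let d ≥ 2. Then there exist constants C > 0 and α' ∈ (0,1), depending only on g, V and d (not on ε or on the solution), such that for every ε > 0 and every classical solution (u, m) of the discounted MFG system one has ‖Du‖_{C^{1,α'}(T^d)} ≤ C, i.e. sup_{T^d}|Du| + sup_{T^d}|D²u| + sup_{x≠y} |D²u(x) − D²u(y)|/|x−y|^{α'} ≤ C. -/

import Mathlib

open MeasureTheory Set

noncomputable def pd (d : ℕ) (i : Fin d) (f : (Fin d → ℝ) → ℝ) : (Fin d → ℝ) → ℝ :=
  fun x => fderiv ℝ f x (Pi.single i 1)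

noncomputable def gradSq (d : ℕ) (u : (Fin d → ℝ) → ℝ) (x : Fin d → ℝ) : ℝ :=
  ∑ i, pd d i u x ^ 2

noncomputable def divUp (d : ℕ) (m u : (Fin d → ℝ) → ℝ) (x : Fin d → ℝ) : ℝ :=
  ∑ i, pd d i (fun y => m y * pd d i u y) x

/-- `f` is `ℤ^d`-periodic, i.e. a function on the flat torus `T^d`. -/
def ZPer (d : ℕ) (f : (Fin d → ℝ) → ℝ) : Prop :=
  ∀ (x : Fin d → ℝ) (k : Fin d → ℤ), f (x + fun i => (k i : ℝ)) = f x

/-- `f` has finite `α`-Hölder seminorm. -/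
def HolderSemi (α : ℝ) {E : Type*} [PseudoMetricSpace E] (f : E → ℝ) : Prop :=
  ∃ C : ℝ, 0 ≤ C ∧ ∀ x y, |f x - f y| ≤ C * dist x y ^ α

/-- `f` is of class `C^{1,α}`. -/
def C1Hold (d : ℕ) (α : ℝ) (f : (Fin d → ℝ) → ℝ) : Prop :=
  ContDiff ℝ 1 f ∧ ∀ i, HolderSemi α (pd d i f)

/-- `f` is of class `C^{2,α}`. -/
def C2Hold (d : ℕ) (α : ℝ) (f : (Fin d → ℝ) → ℝ) : Prop :=
  ContDiff ℝ 2 f ∧ ∀ i j, HolderSemi α (pd d i (pd d j f))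

/-- `f` is locally `α`-Hölder on `s`. -/
def LocHolderOn (α : ℝ) (f : ℝ → ℝ) (s : Set ℝ) : Prop :=
  ∀ K : Set ℝ, IsCompact K → K ⊆ s →
    ∃ C : ℝ, 0 ≤ C ∧ ∀ x ∈ K, ∀ y ∈ K, |f x - f y| ≤ C * dist x y ^ α

/-- Standing hypotheses on `g`: strictly increasing and continuous on `[0,∞)`,
of class `C^{1,α}` on `(0,∞)`. -/
def Ghyp (α : ℝ) (g : ℝ → ℝ) : Prop :=
  StrictMonoOn g (Ici 0) ∧ ContinuousOn g (Ici 0) ∧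
    DifferentiableOn ℝ g (Ioi 0) ∧ LocHolderOn α (deriv g) (Ioi 0)

/-- Standing hypotheses on `V`: a `C^{1,α}` function on the torus. -/
def Vhyp (d : ℕ) (α : ℝ) (V : (Fin d → ℝ) → ℝ) : Prop :=
  ZPer d V ∧ C1Hold d α V

/-- The oscillation of `V` over the torus. -/
noncomputable def oscV (d : ℕ) (V : (Fin d → ℝ) → ℝ) : ℝ :=
  sSup (V '' Icc (0 : Fin d → ℝ) 1) - sInf (V '' Icc (0 : Fin d → ℝ) 1)

/-- Assumption (A1): `g⁻¹(g(1) − osc V) > 0`, i.e. `g(1) − osc V` is attained by `g` on `(0,∞)`. -/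
def A1 (d : ℕ) (g : ℝ → ℝ) (V : (Fin d → ℝ) → ℝ) : Prop :=
  g 1 - oscV d V ∈ g '' Ioi (0 : ℝ)

/-- Assumption (A2). -/
def A2 (g : ℝ → ℝ) : Prop :=
  ∃ C₁ C₂ β : ℝ, 0 < C₁ ∧ 0 < C₂ ∧
    (∀ z : ℝ, 0 < z → C₁ * z ^ β ≤ deriv g z) ∧
    (∀ z : ℝ, 0 ≤ z → g z ≤ C₂ + z * g z)

/-- A classical solution `(u, m)` of the discounted MFG system
`ε u + |Du|²/2 + V = g(m)`, `ε m − div(m Du) = ε` on `T^d`. -/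
structure DiscSol (d : ℕ) (α : ℝ) (g : ℝ → ℝ) (V : (Fin d → ℝ) → ℝ) (ε : ℝ)
    (u m : (Fin d → ℝ) → ℝ) : Prop where
  per_u : ZPer d u
  per_m : ZPer d m
  reg_u : C2Hold d α u
  reg_m : C1Hold d α m
  m_nonneg : ∀ x, 0 ≤ m x
  hj : ∀ x, ε * u x + (1 / 2) * gradSq d u x + V x = g (m x)
  fp : ∀ x, ε * m x - divUp d m u x = ε

/-- A classical solution `(u, m, H̄)` of the ergodic MFG system
`|Du|²/2 + V = g(m) + H̄`, `−div(m Du) = 0`, `m ≥ 0`, `∫ m = 1` on `T^d`. -/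
structure ErgSol (d : ℕ) (α : ℝ) (g : ℝ → ℝ) (V : (Fin d → ℝ) → ℝ)
    (u m : (Fin d → ℝ) → ℝ) (H : ℝ) : Prop where
  per_u : ZPer d u
  per_m : ZPer d m
  reg_u : C2Hold d α u
  reg_m : C1Hold d α m
  m_nonneg : ∀ x, 0 ≤ m x
  m_mass : (∫ x in Icc (0 : Fin d → ℝ) 1, m x) = 1
  hj : ∀ x, (1 / 2) * gradSq d u x + V x = g (m x) + H
  fp : ∀ x, divUp d m u x = 0

open MeasureTheory Set Filter Topology

/-! ### Basic calculus facts -/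

/-- Second derivative of `u` at `x` in direction `v`. -/
noncomputable def qf {d : ℕ} (u : (Fin d → ℝ) → ℝ) (x v : Fin d → ℝ) : ℝ :=
  ∑ i, ∑ j, v i * v j * pd d i (pd d j u) x

lemma fderiv_eq_sum_pd {d : ℕ} (f : (Fin d → ℝ) → ℝ) (x v : Fin d → ℝ) :
    fderiv ℝ f x v = ∑ i, v i * pd d i f x := by
  have : v = ∑ i, v i • (Pi.single i (1:ℝ) : Fin d → ℝ) := by
    ext j
    simp [Finset.sum_apply, Pi.single_apply]
  conv_lhs => rw [this]
  simp [map_sum, pd]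

lemma hasDerivAt_line {d : ℕ} {f : (Fin d → ℝ) → ℝ} (x v : Fin d → ℝ) (t : ℝ)
    (hf : DifferentiableAt ℝ f (x + t • v)) :
    HasDerivAt (fun t : ℝ => f (x + t • v)) (∑ i, v i * pd d i f (x + t • v)) t := by
  have h1 : HasDerivAt (fun t : ℝ => x + t • v) v t := by
    have := ((hasDerivAt_id t).smul_const v).const_add x
    simpa using this
  have h2 := hf.hasFDerivAt.comp_hasDerivAt t h1
  rw [fderiv_eq_sum_pd] at h2
  exact h2

lemma contDiff_pd {d : ℕ} {u : (Fin d → ℝ) → ℝ} (hu : ContDiff ℝ 2 u) (i : Fin d) :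
    ContDiff ℝ 1 (pd d i u) := by
  have : ContDiff ℝ 1 (fderiv ℝ u) := hu.fderiv_right (by norm_num)
  exact this.clm_apply contDiff_const

lemma continuous_pd {d : ℕ} {u : (Fin d → ℝ) → ℝ} (hu : ContDiff ℝ 1 u) (i : Fin d) :
    Continuous (pd d i u) := by
  have : Continuous (fderiv ℝ u) := hu.continuous_fderiv (by norm_num)
  exact this.clm_apply continuous_const

lemma hasDerivAt_line2 {d : ℕ} {u : (Fin d → ℝ) → ℝ} (hu : ContDiff ℝ 2 u) (x v : Fin d → ℝ)
    (t : ℝ) :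
    HasDerivAt (fun t : ℝ => ∑ i, v i * pd d i u (x + t • v)) (qf u (x + t • v) v) t := by
  have h : ∀ i ∈ (Finset.univ : Finset (Fin d)), HasDerivAt (fun t : ℝ => v i * pd d i u (x + t • v))
      (v i * ∑ j, v j * pd d j (pd d i u) (x + t • v)) t := by
    intro i _
    exact (hasDerivAt_line x v t ((contDiff_pd hu i).differentiable (by norm_num) _)).const_mul _
  have := HasDerivAt.fun_sum h
  refine this.congr_deriv ?_
  symm
  unfold qf
  rw [Finset.sum_comm]
  refine Finset.sum_congr rfl fun i _ => ?_
  rw [Finset.mul_sum]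
  refine Finset.sum_congr rfl fun j _ => ?_
  ring

lemma pd_comm {d : ℕ} {u : (Fin d → ℝ) → ℝ} (hu : ContDiff ℝ 2 u) (i j : Fin d) (x : Fin d → ℝ) :
    pd d i (pd d j u) x = pd d j (pd d i u) x := by
  have hd : Differentiable ℝ (fderiv ℝ u) :=
    (hu.fderiv_right (m := 1) (by norm_num)).differentiable (by norm_num)
  have key : ∀ a b : Fin d, pd d a (pd d b u) x
      = fderiv ℝ (fderiv ℝ u) x (Pi.single a 1) (Pi.single b 1) := by
    intro a b
    unfold pd
    rw [fderiv_clm_apply (hd x) (differentiableAt_const _)]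
    simp
  rw [key, key]
  have : IsSymmSndFDerivAt ℝ u x := hu.contDiffAt.isSymmSndFDerivAt (by simp)
  exact this _ _

/-- second derivative test -/
lemma snd_test {h h' : ℝ → ℝ} {h2 : ℝ} (hmax : IsLocalMax h 0)
    (hd : ∀ᶠ t in 𝓝 0, HasDerivAt h (h' t) t) (hd2 : HasDerivAt h' h2 0) :
    h' 0 = 0 ∧ h2 ≤ 0 := by
  have h0 : h' 0 = 0 := hmax.hasDerivAt_eq_zero hd.self_of_nhds
  refine ⟨h0, ?_⟩
  by_contra hpos
  push Not at hpos
  have hev : ∀ᶠ t in 𝓝[>] (0:ℝ), 0 < h' t := by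
    have := hasDerivAt_iff_tendsto_slope.1 hd2
    have h3 : ∀ᶠ t in 𝓝[≠] (0:ℝ), 0 < slope h' 0 t := this.eventually (lt_mem_nhds hpos)
    have h4 : ∀ᶠ t in 𝓝[>] (0:ℝ), 0 < slope h' 0 t :=
      h3.filter_mono (nhdsWithin_mono _ (fun x hx => ne_of_gt hx))
    filter_upwards [h4, self_mem_nhdsWithin] with t ht ht0
    rw [slope_def_field, h0] at ht
    have ht0' : 0 < t := ht0
    simp only [sub_zero] at ht
    exact (div_pos_iff_of_pos_right ht0').1 ht
  rw [eventually_nhdsWithin_iff] at hev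
  obtain ⟨δ, hδ, hall⟩ := Metric.eventually_nhds_iff.1 (hev.and (hd.and hmax))
  have hin : ∀ t, 0 ≤ t → t ≤ δ/2 → dist t 0 < δ := by
    intro t h1 h2
    rw [Real.dist_eq, sub_zero, abs_of_nonneg h1]; linarith
  have hmono : StrictMonoOn h (Icc 0 (δ/2)) := by
    apply strictMonoOn_of_deriv_pos (convex_Icc _ _)
    · intro t ht
      exact (hall (hin t ht.1 ht.2)).2.1.continuousAt.continuousWithinAt
    · intro t ht
      rw [interior_Icc] at ht
      have := hall (hin t ht.1.le ht.2.le)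
      rw [this.2.1.deriv]
      exact this.1 ht.1
  have h5 := hmono (left_mem_Icc.2 (by linarith)) (right_mem_Icc.2 (by linarith)) (by linarith : (0:ℝ) < δ/2)
  have h6 := (hall (hin (δ/2) (by linarith) le_rfl)).2.2
  linarith

lemma exists_shift_unit {d : ℕ} (x : Fin d → ℝ) :
    ∃ k : Fin d → ℤ, (x + fun i => (k i : ℝ)) ∈ Icc (0 : Fin d → ℝ) 1 := by
  refine ⟨fun i => -⌊x i⌋, ?_, ?_⟩
  · intro i
    have := Int.floor_le (x i)
    simp; linarith
  · intro i
    have := Int.lt_floor_add_one (x i)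
    simp; linarith

lemma exists_max_of_per {d : ℕ} {f : (Fin d → ℝ) → ℝ} (hf : Continuous f) (hp : ZPer d f) :
    ∃ x ∈ Icc (0 : Fin d → ℝ) 1, ∀ y, f y ≤ f x := by
  obtain ⟨x, hx, hmax⟩ := (isCompact_Icc : IsCompact (Icc (0 : Fin d → ℝ) 1)).exists_isMaxOn
    ⟨0, by simp⟩ hf.continuousOn
  refine ⟨x, hx, fun y => ?_⟩
  obtain ⟨k, hk⟩ := exists_shift_unit y
  rw [← hp y k]
  exact hmax hk

lemma exists_min_of_per {d : ℕ} {f : (Fin d → ℝ) → ℝ} (hf : Continuous f) (hp : ZPer d f) :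
    ∃ x ∈ Icc (0 : Fin d → ℝ) 1, ∀ y, f x ≤ f y := by
  obtain ⟨x, hx, h⟩ := exists_max_of_per hf.neg (fun x k => by simp [hp x k])
  exact ⟨x, hx, fun y => by simpa using h y⟩

lemma pd_per {d : ℕ} {f : (Fin d → ℝ) → ℝ} (hp : ZPer d f) (i : Fin d) : ZPer d (pd d i f) := by
  intro x k
  unfold pd
  have : f = fun y => f (y + fun i => (k i : ℝ)) := by ext y; rw [hp]
  conv_rhs => rw [this]
  rw [fderiv_comp_add_right]

lemma pd_mul {d : ℕ} {f h : (Fin d → ℝ) → ℝ} {x : Fin d → ℝ} (hf : DifferentiableAt ℝ f x)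
    (hh : DifferentiableAt ℝ h x) (i : Fin d) :
    pd d i (fun y => f y * h y) x = f x * pd d i h x + pd d i f x * h x := by
  unfold pd
  rw [fderiv_fun_mul hf hh]
  simp; ring

lemma qf_single {d : ℕ} (u : (Fin d → ℝ) → ℝ) (x : Fin d → ℝ) (i : Fin d) :
    qf u x (Pi.single i 1) = pd d i (pd d i u) x := by
  unfold qf
  rw [Finset.sum_eq_single i]
  · rw [Finset.sum_eq_single i]
    · simp
    · intro j _ hj; simp [Pi.single_apply, hj]
    · simp
  · intro j _ hj; simp [Pi.single_apply, hj]
  · simp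

/-- At a local max all first derivatives vanish and second directional derivatives are `≤ 0`. -/
lemma max_test {d : ℕ} {u : (Fin d → ℝ) → ℝ} (hu : ContDiff ℝ 2 u) {x : Fin d → ℝ}
    (hx : IsLocalMax u x) : (∀ i, pd d i u x = 0) ∧ ∀ v, qf u x v ≤ 0 := by
  have key : ∀ v : Fin d → ℝ, (∑ i, v i * pd d i u x) = 0 ∧ qf u x v ≤ 0 := by
    intro v
    have hc : ContinuousAt (fun t : ℝ => x + t • v) 0 := by fun_prop
    have hm : IsLocalMax (fun t : ℝ => u (x + t • v)) 0 := by
      have : Tendsto (fun t : ℝ => x + t • v) (𝓝 0) (𝓝 x) := by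
        have := hc.tendsto; simpa using this
      have h2 := this.eventually hx
      simpa [IsLocalMax, IsMaxFilter] using h2
    have := snd_test hm (Eventually.of_forall fun t => hasDerivAt_line x v t
      (hu.differentiable (by norm_num) _)) (hasDerivAt_line2 hu x v 0)
    simpa using this
  refine ⟨fun i => ?_, fun v => (key v).2⟩
  have := (key (Pi.single i 1)).1
  simpa [Pi.single_apply] using this

open MeasureTheory Set Filter Topology

/-! ### First facts about solutions -/

/-- Laplacian. -/
noncomputable def lap {d : ℕ} (u : (Fin d → ℝ) → ℝ) (x : Fin d → ℝ) : ℝ :=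
  ∑ i, pd d i (pd d i u) x

section sol
variable {d : ℕ} {α ε : ℝ} {g : ℝ → ℝ} {V u m : (Fin d → ℝ) → ℝ}

lemma sol_nondiv (h : DiscSol d α g V ε u m) (x : Fin d → ℝ) :
    m x * lap u x + ∑ i, pd d i m x * pd d i u x = ε * (m x - 1) := by
  have h1 := h.fp x
  have h2 : divUp d m u x = m x * lap u x + ∑ i, pd d i m x * pd d i u x := by
    unfold divUp lap
    rw [Finset.mul_sum, ← Finset.sum_add_distrib]
    refine Finset.sum_congr rfl fun i _ => ?_
    rw [pd_mul (h.reg_m.1.differentiable (by norm_num) x)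
      ((contDiff_pd h.reg_u.1 i).differentiable (by norm_num) x)]
  linarith

lemma gradSq_zero (h : ∀ i, pd d i u = fun _ => 0) : True := trivial

lemma gradSq_nonneg (x : Fin d → ℝ) : 0 ≤ gradSq d u x :=
  Finset.sum_nonneg fun i _ => sq_nonneg _

lemma V_le_sSup (hV : Vhyp d α V) (x : Fin d → ℝ) : V x ≤ sSup (V '' Icc (0 : Fin d → ℝ) 1) := by
  obtain ⟨k, hk⟩ := exists_shift_unit x
  rw [← hV.1 x k]
  exact le_csSup (isCompact_Icc.bddAbove_image hV.2.1.continuous.continuousOn) ⟨_, hk, rfl⟩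

lemma sInf_le_V (hV : Vhyp d α V) (x : Fin d → ℝ) : sInf (V '' Icc (0 : Fin d → ℝ) 1) ≤ V x := by
  obtain ⟨k, hk⟩ := exists_shift_unit x
  rw [← hV.1 x k]
  exact csInf_le (isCompact_Icc.bddBelow_image hV.2.1.continuous.continuousOn) ⟨_, hk, rfl⟩

lemma oscV_nonneg (hV : Vhyp d α V) : 0 ≤ oscV d V := by
  have h1 := V_le_sSup hV 0
  have h2 := sInf_le_V hV 0
  unfold oscV; linarith

lemma eps_u_le (hε : 0 < ε) (hg : Ghyp α g) (hV : Vhyp d α V) (h : DiscSol d α g V ε u m)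
    (y : Fin d → ℝ) : ε * u y ≤ g 1 - sInf (V '' Icc (0 : Fin d → ℝ) 1) := by
  obtain ⟨x, -, hx⟩ := exists_max_of_per h.reg_u.1.continuous h.per_u
  have ht := max_test h.reg_u.1 (x := x) (Eventually.of_forall hx)
  have hl : lap u x ≤ 0 := Finset.sum_nonpos fun i _ => by
    rw [← qf_single]; exact ht.2 _
  have hn := sol_nondiv h x
  have hs : ∑ i, pd d i m x * pd d i u x = 0 := Finset.sum_eq_zero fun i _ => by simp [ht.1 i]
  have hm : m x ≤ 1 := by
    have : m x * lap u x ≤ 0 := mul_nonpos_of_nonneg_of_nonpos (h.m_nonneg x) hl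
    nlinarith
  have hG : gradSq d u x = 0 := Finset.sum_eq_zero fun i _ => by simp [ht.1 i]
  have hh := h.hj x
  have hgm : g (m x) ≤ g 1 := hg.1.monotoneOn (h.m_nonneg x) (by simp) hm
  have := mul_le_mul_of_nonneg_left (hx y) hε.le
  have := sInf_le_V hV x
  rw [hG] at hh
  linarith

lemma le_eps_u (hε : 0 < ε) (hg : Ghyp α g) (hV : Vhyp d α V) (h : DiscSol d α g V ε u m)
    (y : Fin d → ℝ) : g 1 - sSup (V '' Icc (0 : Fin d → ℝ) 1) ≤ ε * u y := by
  obtain ⟨x, -, hx⟩ := exists_max_of_per h.reg_u.1.continuous.neg (fun x k => by simp [h.per_u x k])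
  have hx' : ∀ y, u x ≤ u y := fun y => by simpa using hx y
  have hmin : IsLocalMin u x := Eventually.of_forall hx'
  have hd0 : ∀ i, pd d i u x = 0 := fun i => by
    unfold pd; rw [hmin.fderiv_eq_zero]; simp
  have ht := max_test (u := fun x => - u x) h.reg_u.1.neg (x := x) (Eventually.of_forall hx)
  have hneg : ∀ f : (Fin d → ℝ) → ℝ, ∀ i, pd d i (fun y => - f y) = fun y => - pd d i f y := by
    intro f i; ext y; unfold pd; rw [fderiv_fun_neg]; simp
  have hl : 0 ≤ lap u x := Finset.sum_nonneg fun i _ => by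
    have := ht.2 (Pi.single i 1)
    rw [qf_single, hneg, hneg] at this
    linarith
  have hn := sol_nondiv h x
  have hs : ∑ i, pd d i m x * pd d i u x = 0 := Finset.sum_eq_zero fun i _ => by simp [hd0 i]
  have hm : 1 ≤ m x := by
    have : 0 ≤ m x * lap u x := mul_nonneg (h.m_nonneg x) hl
    nlinarith
  have hG : gradSq d u x = 0 := Finset.sum_eq_zero fun i _ => by simp [hd0 i]
  have hh := h.hj x
  have hgm : g 1 ≤ g (m x) := hg.1.monotoneOn (by simp) (h.m_nonneg x) hm
  have := mul_le_mul_of_nonneg_left (hx' y) hε.le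
  have := V_le_sSup hV x
  rw [hG] at hh
  linarith

lemma eps_osc (hε : 0 < ε) (hg : Ghyp α g) (hV : Vhyp d α V) (h : DiscSol d α g V ε u m)
    (x y : Fin d → ℝ) : ε * (u x - u y) ≤ oscV d V := by
  have h1 := eps_u_le hε hg hV h x
  have h2 := le_eps_u hε hg hV h y
  unfold oscV; linarith

lemma exists_m0 (hg : Ghyp α g) (hV : Vhyp d α V) (hA1 : A1 d g V) :
    ∃ m0 : ℝ, 0 < m0 ∧ m0 ≤ 1 ∧ ∀ ε : ℝ, 0 < ε → ∀ u m : (Fin d → ℝ) → ℝ, DiscSol d α g V ε u m →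
      ∀ x, m0 ≤ m x := by
  obtain ⟨m0, hm0, hgm0⟩ := hA1
  have hm0' : 0 < m0 := hm0
  refine ⟨m0, hm0, ?_, ?_⟩
  · by_contra hlt
    push Not at hlt
    have := hg.1 (by simp : (1:ℝ) ∈ Ici 0) (hm0'.le : m0 ∈ Ici 0) hlt
    have := oscV_nonneg hV
    linarith
  · intro ε hε u m h x
    by_contra hlt
    push Not at hlt
    have h1 := hg.1 (h.m_nonneg x : m x ∈ Ici 0) (hm0'.le : m0 ∈ Ici 0) hlt
    have h2 := h.hj x
    have h3 := le_eps_u hε hg hV h x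
    have h4 := sInf_le_V hV x
    have h5 := gradSq_nonneg (u := u) x
    unfold oscV at hgm0
    linarith

lemma pd_hj (h : DiscSol d α g V ε u m) (hg : Ghyp α g) (hV : Vhyp d α V) (k : Fin d)
    (x : Fin d → ℝ) (hm : 0 < m x) :
    deriv g (m x) * pd d k m x
      = (∑ j, pd d j u x * pd d k (pd d j u) x) + ε * pd d k u x + pd d k V x := by
  have hgd : HasDerivAt g (deriv g (m x)) (m x) :=
    (hg.2.2.1.differentiableAt (Ioi_mem_nhds hm)).hasDerivAt
  have hmd := (h.reg_m.1.differentiable (by norm_num) x).hasFDerivAt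
  have h1 := hgd.comp_hasFDerivAt x hmd
  have hfe : (g ∘ m) = fun x => ε * u x + (1 / 2) * gradSq d u x + V x := by
    ext y; exact (h.hj y).symm
  have hu1 := (h.reg_u.1.differentiable (by norm_num) x).hasFDerivAt
  have hV1 := (hV.2.1.differentiable (by norm_num) x).hasFDerivAt
  have hp : ∀ j ∈ (Finset.univ : Finset (Fin d)), HasFDerivAt (fun y => pd d j u y ^ 2)
      ((2 * pd d j u x) • fderiv ℝ (pd d j u) x) x := by
    intro j _
    have := ((contDiff_pd h.reg_u.1 j).differentiable (by norm_num) x).hasFDerivAt.pow 2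
    simpa using this
  have h2 := ((hu1.const_mul ε).add ((HasFDerivAt.fun_sum hp).const_mul (1/2))).add hV1
  have h3 := (hfe ▸ h1).unique h2
  have h4 := congrArg (fun L => L (Pi.single k (1:ℝ))) h3
  simp only [ContinuousLinearMap.smul_apply, ContinuousLinearMap.add_apply,
    ContinuousLinearMap.sum_apply, smul_eq_mul] at h4
  unfold pd
  rw [h4]
  rw [Finset.mul_sum]
  have : ∀ j, (1/2:ℝ) * (2 * pd d j u x * fderiv ℝ (pd d j u) x (Pi.single k 1))
     = pd d j u x * fderiv ℝ (pd d j u) x (Pi.single k 1) := fun j => by ring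
  simp only [this]
  unfold pd
  ring

lemma qf_grad (x : Fin d → ℝ) : qf u x (fun i => pd d i u x)
    = ∑ i, (∑ j, pd d j u x * pd d i (pd d j u) x) * pd d i u x := by
  unfold qf
  refine Finset.sum_congr rfl fun i _ => ?_
  rw [Finset.sum_mul]
  refine Finset.sum_congr rfl fun j _ => ?_
  ring

/-- The equation in nondivergence form. -/
lemma sol_nondiv' (h : DiscSol d α g V ε u m) (hg : Ghyp α g) (hV : Vhyp d α V)
    (x : Fin d → ℝ) (hm : 0 < m x) (hgp : 0 < deriv g (m x)) :
    m x * lap u x + (qf u x (fun i => pd d i u x) + ε * gradSq d u x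
      + ∑ i, pd d i V x * pd d i u x) / deriv g (m x) = ε * (m x - 1) := by
  rw [← sol_nondiv h x]
  congr 1
  rw [div_eq_iff hgp.ne', qf_grad, gradSq, Finset.mul_sum, ← Finset.sum_add_distrib,
    ← Finset.sum_add_distrib, Finset.sum_mul]
  refine Finset.sum_congr rfl fun i _ => ?_
  have := pd_hj h hg hV i x hm
  linear_combination -(pd d i u x) * this

lemma deriv_g_pos (hA2 : A2 g) {z : ℝ} (hz : 0 < z) : 0 < deriv g z := by
  obtain ⟨C₁, C₂, β, h1, h2, h3, h4⟩ := hA2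
  have := h3 z hz
  have := Real.rpow_pos_of_pos hz β
  nlinarith [mul_pos h1 this]

/-- `V` is Lipschitz: the gradient is bounded. -/
lemma exists_DV (hV : Vhyp d α V) : ∃ L : ℝ, 1 ≤ L ∧ ∀ x, ∑ i, pd d i V x ^ 2 ≤ L ^ 2 := by
  have hc : Continuous fun x => ∑ i, pd d i V x ^ 2 :=
    continuous_finsetSum _ fun i _ => (continuous_pd hV.2.1 i).pow 2
  obtain ⟨x, -, hx⟩ := exists_max_of_per hc (fun x k => by simp [pd_per hV.1 _ x k])
  refine ⟨1 + ∑ i, pd d i V x ^ 2, ?_, fun y => (hx y).trans ?_⟩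
  · have : 0 ≤ ∑ i, pd d i V x ^ 2 := Finset.sum_nonneg fun i _ => sq_nonneg _
    linarith
  · have : 0 ≤ ∑ i, pd d i V x ^ 2 := Finset.sum_nonneg fun i _ => sq_nonneg _
    nlinarith

end sol

open MeasureTheory Set Filter Topology

/-! ### The two-point maximum principle -/

/-- Euclidean norm. -/
noncomputable def nE {d : ℕ} (x : Fin d → ℝ) : ℝ := Real.sqrt (∑ i, x i ^ 2)

lemma nE_nonneg {d : ℕ} (x : Fin d → ℝ) : 0 ≤ nE x := Real.sqrt_nonneg _

lemma nE_sq {d : ℕ} (x : Fin d → ℝ) : nE x ^ 2 = ∑ i, x i ^ 2 :=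
  Real.sq_sqrt (Finset.sum_nonneg fun _ _ => sq_nonneg _)

lemma continuous_nE {d : ℕ} : Continuous (nE : (Fin d → ℝ) → ℝ) := by
  unfold nE; fun_prop

lemma nE_smul {d : ℕ} (c : ℝ) (x : Fin d → ℝ) : nE (c • x) = |c| * nE x := by
  unfold nE
  rw [← Real.sqrt_sq_eq_abs, ← Real.sqrt_mul (sq_nonneg _), Finset.mul_sum]
  congr 1
  refine Finset.sum_congr rfl fun i _ => ?_
  simp; ring

lemma abs_le_nE {d : ℕ} (x : Fin d → ℝ) (i : Fin d) : |x i| ≤ nE x := by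
  unfold nE
  apply Real.abs_le_sqrt
  exact Finset.single_le_sum (f := fun i => x i ^ 2) (fun _ _ => sq_nonneg _) (Finset.mem_univ i)

lemma norm_le_nE {d : ℕ} (x : Fin d → ℝ) : ‖x‖ ≤ nE x :=
  (pi_norm_le_iff_of_nonneg (nE_nonneg x)).2 fun i => abs_le_nE x i

lemma nE_le_norm {d : ℕ} (x : Fin d → ℝ) : nE x ≤ Real.sqrt d * ‖x‖ := by
  unfold nE
  rw [← Real.sqrt_sq (norm_nonneg x), ← Real.sqrt_mul (by positivity)]
  apply Real.sqrt_le_sqrt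
  calc ∑ i, x i ^ 2 ≤ ∑ i : Fin d, ‖x‖ ^ 2 := Finset.sum_le_sum fun i _ => by
        rw [← sq_abs]; exact pow_le_pow_left₀ (abs_nonneg _) (norm_le_pi_norm x i) 2
    _ = d * ‖x‖ ^ 2 := by simp

lemma nE_eq_zero {d : ℕ} {x : Fin d → ℝ} (h : nE x = 0) : x = 0 := by
  have := norm_le_nE x
  rw [h] at this
  exact norm_le_zero_iff.1 this

lemma isCompact_nE_le {d : ℕ} (r : ℝ) : IsCompact {z : Fin d → ℝ | nE z ≤ r} := by
  apply Metric.isCompact_of_isClosed_isBounded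
  · exact isClosed_le continuous_nE continuous_const
  · refine (Metric.isBounded_closedBall (x := (0 : Fin d → ℝ)) (r := r)).subset ?_
    intro z hz
    simp only [mem_setOf_eq] at hz
    simp only [Metric.mem_closedBall, dist_zero_right]
    exact (norm_le_nE z).trans hz

lemma qf_smul {d : ℕ} (u : (Fin d → ℝ) → ℝ) (x v : Fin d → ℝ) (a : ℝ) :
    qf u x (a • v) = a ^ 2 * qf u x v := by
  unfold qf
  rw [Finset.mul_sum]
  refine Finset.sum_congr rfl fun i _ => ?_
  rw [Finset.mul_sum]
  refine Finset.sum_congr rfl fun j _ => ?_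
  simp; ring

lemma hasDerivAt_nE {d : ℕ} (z v : Fin d → ℝ) (hz : 0 < nE z) :
    HasDerivAt (fun t : ℝ => nE (z + t • v)) ((∑ i, z i * v i) / nE z) 0 := by
  have h1 : HasDerivAt (fun t : ℝ => ∑ i, (z + t • v) i ^ 2) (∑ i, 2 * (z i * v i)) 0 := by
    have : ∀ i ∈ (Finset.univ : Finset (Fin d)), HasDerivAt (fun t : ℝ => (z + t • v) i ^ 2)
        (2 * (z i * v i)) 0 := by
      intro i _
      have h := (((hasDerivAt_id (0:ℝ)).mul_const (v i)).const_add (z i)).pow 2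
      simp only [Pi.add_apply, Pi.smul_apply, smul_eq_mul]
      refine h.congr_deriv ?_
      simp; ring
    exact HasDerivAt.fun_sum this
  have hpos : 0 < ∑ i, z i ^ 2 := by
    rw [← nE_sq]; positivity
  have h2 := h1.sqrt (by simpa using hpos.ne')
  refine h2.congr_deriv ?_
  simp only [zero_smul, add_zero]
  rw [← Finset.mul_sum]
  change _ / (2 * nE z) = _
  field_simp

theorem twopt {d : ℕ} {u : (Fin d → ℝ) → ℝ} (hu : ContDiff ℝ 2 u) (hp : ZPer d u)
    {φ φ' φ'' : ℝ → ℝ} {r1 : ℝ} (hφ0 : φ 0 = 0) (hφc : ContinuousOn φ (Icc 0 r1))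
    (hφ1 : ∀ r ∈ Ioo 0 r1, HasDerivAt φ (φ' r) r)
    (hφ2 : ∀ r ∈ Ioo 0 r1, HasDerivAt φ' (φ'' r) r)
    (hb : ∀ x y, nE (x - y) = r1 → φ r1 < u x - u y → ∃ y', nE (x - y') ≤ r1 ∧
      u x - u y - φ r1 < u x - u y' - φ (nE (x - y'))) :
    (∀ x y, nE (x - y) ≤ r1 → u x - u y ≤ φ (nE (x - y))) ∨
    ∃ x y e : Fin d → ℝ, ∃ r : ℝ, 0 < r ∧ r < r1 ∧ x - y = r • e ∧ (∑ i, e i ^ 2) = 1 ∧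
      φ r < u x - u y ∧ (∀ i, pd d i u x = φ' r * e i) ∧ (∀ i, pd d i u y = φ' r * e i) ∧
      (∀ v, qf u x v ≤ qf u y v) ∧
      ∀ a b : ℝ, a ^ 2 * qf u x e - b ^ 2 * qf u y e ≤ (a + b) ^ 2 * φ'' r := by
  by_cases hcase : ∀ x y, nE (x - y) ≤ r1 → u x - u y ≤ φ (nE (x - y))
  · exact Or.inl hcase
  right
  push Not at hcase
  obtain ⟨x0, y0, hr0, h0⟩ := hcase
  have hK : IsCompact ((Icc (0 : Fin d → ℝ) 1) ×ˢ {z : Fin d → ℝ | nE z ≤ r1}) :=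
    isCompact_Icc.prod (isCompact_nE_le r1)
  have hcont : ContinuousOn (fun q : (Fin d → ℝ) × (Fin d → ℝ) => u q.1 - u (q.1 - q.2) - φ (nE q.2))
      ((Icc (0 : Fin d → ℝ) 1) ×ˢ {z : Fin d → ℝ | nE z ≤ r1}) := by
    have huc := hu.continuous
    refine ContinuousOn.sub (by fun_prop) ?_
    refine hφc.comp (continuous_nE.comp continuous_snd).continuousOn ?_
    intro q hq
    exact ⟨nE_nonneg _, hq.2⟩
  obtain ⟨⟨x, z⟩, ⟨hx, hz⟩, hmax⟩ := hK.exists_isMaxOn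
    ⟨((0 : Fin d → ℝ), x0 - y0), by simp, hr0⟩ hcont
  simp only [mem_setOf_eq] at hz
  set y := x - z with hy
  have hglob : ∀ x' y', nE (x' - y') ≤ r1 → u x' - u y' - φ (nE (x' - y')) ≤ u x - u y - φ (nE z) := by
    intro x' y' hxy
    obtain ⟨k, hk⟩ := exists_shift_unit x'
    have := hmax (show ((x' + fun i => (k i : ℝ)), x' - y') ∈ _ from ⟨hk, hxy⟩)
    simp only [mem_setOf_eq] at this
    rw [show (x' + fun i => (k i : ℝ)) - (x' - y') = y' + fun i => (k i : ℝ) by abel, hp, hp] at this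
    exact this
  have hpos : 0 < u x - u y - φ (nE z) := by
    have := hglob x0 y0 hr0; linarith
  have hxyz : x - y = z := by rw [hy]; abel
  have hr : 0 < nE z := by
    rcases (nE_nonneg z).eq_or_lt with h | h
    · exfalso
      have hz0 := nE_eq_zero h.symm
      rw [← h, hφ0] at hpos
      rw [hy, hz0] at hpos
      simp at hpos
    · exact h
  have hr1 : nE z < r1 := by
    rcases hz.eq_or_lt with h | h
    · exfalso
      obtain ⟨y', hy', hlt⟩ := hb x y (by rw [hxyz, h]) (by rw [← h]; linarith)
      have := hglob x y' hy'
      rw [h] at this; linarith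
    · exact h
  set r := nE z with hrdef
  have hmem : r ∈ Ioo 0 r1 := ⟨hr, hr1⟩
  have hdiff : Differentiable ℝ u := hu.differentiable (by norm_num)
  -- test (1)
  have key1 : ∀ v : Fin d → ℝ, ((∑ i, v i * pd d i u x) - (∑ i, v i * pd d i u y)) = 0 ∧
      qf u x v - qf u y v ≤ 0 := by
    intro v
    have hm : IsLocalMax (fun t : ℝ => u (x + t • v) - u (y + t • v)) 0 := by
      refine Eventually.of_forall fun t => ?_
      have := hglob (x + t • v) (y + t • v)
      rw [show x + t • v - (y + t • v) = z by rw [← hxyz]; abel] at this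
      have := this hz
      simp only [zero_smul, add_zero]
      linarith
    have := snd_test hm (Eventually.of_forall fun t => (hasDerivAt_line x v t (hdiff _)).sub
      (hasDerivAt_line y v t (hdiff _))) ((hasDerivAt_line2 hu x v 0).sub (hasDerivAt_line2 hu y v 0))
    simpa using this
  have hgeq : ∀ i, pd d i u x = pd d i u y := by
    intro i
    have := (key1 (Pi.single i 1)).1
    simp only [Pi.single_apply, ite_mul, one_mul, zero_mul, Finset.sum_ite_eq', Finset.mem_univ,
      if_true] at this
    linarith
  -- test (2)
  have key2 : ∀ i, pd d i u x = φ' r * (z i / r) := by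
    intro i
    set v : Fin d → ℝ := Pi.single i 1
    have hev : ∀ᶠ t in 𝓝 (0:ℝ), nE (z + t • v) ≤ r1 := by
      have : ContinuousAt (fun t : ℝ => nE (z + t • v)) 0 := by
        have := continuous_nE (d := d)
        fun_prop
      have h2 := this.eventually (Iio_mem_nhds (show nE (z + (0:ℝ) • v) < r1 by simpa using hr1))
      filter_upwards [h2] with t ht using le_of_lt ht
    have hm : IsLocalMax (fun t : ℝ => u (x + t • v) - φ (nE (z + t • v))) 0 := by
      filter_upwards [hev] with t ht
      have h3 : x + t • v - y = z + t • v := by rw [← hxyz]; abel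
      have := hglob (x + t • v) y (by rw [h3]; exact ht)
      rw [h3] at this
      simp only [zero_smul, add_zero]
      linarith
    have hd1 := hasDerivAt_line x v 0 (hdiff _)
    have hφr : HasDerivAt φ (φ' r) (nE (z + (0:ℝ) • v)) := by
      simpa using hφ1 r hmem
    have hd2 := hφr.comp (0:ℝ) (hasDerivAt_nE z v hr)
    have := hm.hasDerivAt_eq_zero (hd1.sub hd2)
    simp only [zero_smul, add_zero, v, Pi.single_apply, ite_mul, one_mul, zero_mul, mul_ite, mul_one,
      mul_zero, Finset.sum_ite_eq', Finset.mem_univ, if_true] at this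
    linarith
  refine ⟨x, y, fun i => z i / r, r, hr, hr1, ?_, ?_, by linarith, key2, ?_, ?_, ?_⟩
  · rw [hxyz]; ext i; simp; field_simp
  · simp only [div_pow]
    rw [← Finset.sum_div, ← nE_sq, ← hrdef]
    field_simp
  · intro i; rw [← hgeq]; exact key2 i
  · intro v; have := (key1 v).2; linarith
  · -- test (3)
    intro a b
    set e : Fin d → ℝ := fun i => z i / r with he
    have hze : z = r • e := by ext i; simp [he]; field_simp
    have hne : nE e = 1 := by
      have h1 : nE (r • e) = r := by rw [← hze]
      rw [nE_smul, abs_of_pos hr] at h1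
      field_simp at h1
      exact h1
    have hev : ∀ᶠ t in 𝓝 (0:ℝ), r + t * (a + b) ∈ Ioo 0 r1 := by
      have : ContinuousAt (fun t : ℝ => r + t * (a + b)) 0 := by fun_prop
      exact this.eventually (isOpen_Ioo.mem_nhds (by simpa using hmem))
    have hnorm : ∀ t, r + t * (a + b) ∈ Ioo 0 r1 → nE (z + (t * (a + b)) • e) = r + t * (a + b) := by
      intro t ht
      have : z + (t * (a + b)) • e = (r + t * (a + b)) • e := by
        conv_lhs => rw [hze]
        rw [add_smul]
      rw [this, nE_smul, hne, abs_of_pos ht.1, mul_one]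
    have hm : IsLocalMax (fun t : ℝ => u (x + t • (a • e)) - u (y + t • ((-b) • e))
        - φ (r + t * (a + b))) 0 := by
      filter_upwards [hev] with t ht
      have h3 : x + t • (a • e) - (y + t • ((-b) • e)) = z + (t * (a + b)) • e := by
        rw [← hxyz]; ext i; simp; ring
      have := hglob (x + t • (a • e)) (y + t • ((-b) • e)) (by rw [h3, hnorm t ht]; exact ht.2.le)
      rw [h3, hnorm t ht] at this
      simp only [zero_smul, add_zero, zero_mul]
      linarith
    have hl : ∀ t : ℝ, HasDerivAt (fun t : ℝ => r + t * (a + b)) (a + b) t := by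
      intro t
      simpa using ((hasDerivAt_id t).mul_const (a + b)).const_add r
    have hd : ∀ᶠ t in 𝓝 (0:ℝ), HasDerivAt (fun t : ℝ => u (x + t • (a • e)) - u (y + t • ((-b) • e))
        - φ (r + t * (a + b))) ((∑ i, (a • e) i * pd d i u (x + t • (a • e)))
        - (∑ i, ((-b) • e) i * pd d i u (y + t • ((-b) • e))) - φ' (r + t * (a + b)) * (a + b)) t := by
      filter_upwards [hev] with t ht
      exact ((hasDerivAt_line x _ t (hdiff _)).sub (hasDerivAt_line y _ t (hdiff _))).sub
        ((hφ1 _ ht).comp t (hl t))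
    have h2 : HasDerivAt φ' (φ'' r) (r + 0 * (a + b)) := by simpa using hφ2 r hmem
    have := (snd_test hm hd (((hasDerivAt_line2 hu x _ 0).sub (hasDerivAt_line2 hu y _ 0)).sub
      ((h2.comp (0:ℝ) (hl 0)).mul_const (a + b)))).2
    simp only [zero_smul, add_zero, qf_smul] at this
    nlinarith

open MeasureTheory Set Filter Topology

lemma trace_ge {d : ℕ} (B : Fin d → Fin d → ℝ) (hB : ∀ i j, B i j = B j i)
    (hp : ∀ v : Fin d → ℝ, 0 ≤ ∑ i, ∑ j, v i * v j * B i j) (e : Fin d → ℝ)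
    (he : ∑ i, e i ^ 2 = 1) : ∑ i, ∑ j, e i * e j * B i j ≤ ∑ i, B i i := by
  have h1 : 0 ≤ ∑ k, ∑ i, ∑ j, ((if i = k then (1:ℝ) else 0) - e k * e i) *
      ((if j = k then (1:ℝ) else 0) - e k * e j) * B i j :=
    Finset.sum_nonneg fun k _ => hp (fun i => (if i = k then (1:ℝ) else 0) - e k * e i)
  have h2 : ∀ k, ∑ i, ∑ j, ((if i = k then (1:ℝ) else 0) - e k * e i) *
      ((if j = k then (1:ℝ) else 0) - e k * e j) * B i j
      = B k k - 2 * (∑ j, e k * e j * B k j) + e k ^ 2 * ∑ i, ∑ j, e i * e j * B i j := by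
    intro k
    have : ∀ i j, ((if i = k then (1:ℝ) else 0) - e k * e i) *
      ((if j = k then (1:ℝ) else 0) - e k * e j) * B i j
      = (if i = k then (if j = k then B i j else 0) else 0)
        - (if i = k then e k * e j * B i j else 0)
        - (if j = k then e k * e i * B i j else 0) + e k ^ 2 * (e i * e j * B i j) := by
      intro i j
      split_ifs <;> ring
    simp only [this, Finset.sum_add_distrib, Finset.sum_sub_distrib, ← Finset.mul_sum]
    have h3 : ∑ i, ∑ j, (if i = k then (if j = k then B i j else 0) else 0) = B k k := by
      rw [Finset.sum_comm]; simp
    have h4 : ∑ i, ∑ j, (if i = k then e k * e j * B i j else 0) = ∑ j, e k * e j * B k j := by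
      rw [Finset.sum_comm]; simp
    have h5 : ∑ i, ∑ j, (if j = k then e k * e i * B i j else 0) = ∑ j, e k * e j * B k j := by
      simp [hB k]
    rw [h3, h4, h5]; ring
  simp only [h2, Finset.sum_add_distrib, Finset.sum_sub_distrib, ← Finset.sum_mul,
    ← Finset.mul_sum, he] at h1
  linarith

lemma lap_sub_le {d : ℕ} {u : (Fin d → ℝ) → ℝ} (hu : ContDiff ℝ 2 u) (x y e : Fin d → ℝ)
    (he : ∑ i, e i ^ 2 = 1) (h : ∀ v, qf u x v ≤ qf u y v) :
    lap u x - lap u y ≤ qf u x e - qf u y e := by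
  have := trace_ge (fun i j => pd d i (pd d j u) y - pd d i (pd d j u) x)
    (fun i j => by simp only [pd_comm hu i j]) (fun v => by
      have := h v
      simp only [mul_sub, Finset.sum_sub_distrib]
      unfold qf at this; linarith) e he
  simp only [mul_sub, Finset.sum_sub_distrib] at this
  unfold lap qf
  linarith

/-- key inequality at a contact point -/
lemma contact {d : ℕ} {α : ℝ} {g : ℝ → ℝ} {V : (Fin d → ℝ) → ℝ} {ε : ℝ}
    {u m : (Fin d → ℝ) → ℝ} (h : DiscSol d α g V ε u m) (hg : Ghyp α g) (hV : Vhyp d α V)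
    {x y e : Fin d → ℝ} {s p : ℝ} (hs : 0 < s) (he : ∑ i, e i ^ 2 = 1)
    (hmx : 0 < m x) (hmy : 0 < m y) (hgx : 0 < deriv g (m x)) (hgy : 0 < deriv g (m y))
    (hx : ∀ i, pd d i u x = s * e i) (hy : ∀ i, pd d i u y = s * e i)
    (hq : ∀ v, qf u x v ≤ qf u y v)
    (hab : ∀ a b, a^2*qf u x e - b^2*qf u y e ≤ (a+b)^2*p) (hp : p ≤ 0)
    {A B : ℝ} (hA : A = s ^ 2 / (m x * deriv g (m x))) (hB : B = s ^ 2 / (m y * deriv g (m y))) :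
    ε * (1 / m y - 1 / m x) - A * (ε + (∑ i, pd d i V x * e i) / s)
      + B * (ε + (∑ i, pd d i V y * e i) / s) ≤ (2 + A + B) * p := by
  have hA0 : 0 ≤ A := by rw [hA]; positivity
  have hB0 : 0 ≤ B := by rw [hB]; positivity
  have key : ∀ z, (∀ i, pd d i u z = s * e i) → 0 < m z → 0 < deriv g (m z) →
      lap u z + s ^ 2 / (m z * deriv g (m z)) * (qf u z e + (ε + (∑ i, pd d i V z * e i) / s))
        = ε * (1 - 1 / m z) := by
    intro z hz hm hgz
    have h1 := sol_nondiv' h hg hV z hm hgz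
    have h2 : (fun i => pd d i u z) = s • e := by ext i; simp [hz i]
    rw [h2, qf_smul] at h1
    have h3 : gradSq d u z = s ^ 2 := by
      simp only [gradSq, hz, mul_pow, ← Finset.mul_sum, he, mul_one]
    have h4 : ∑ i, pd d i V z * pd d i u z = s * ∑ i, pd d i V z * e i := by
      simp only [hz, Finset.mul_sum]; refine Finset.sum_congr rfl fun i _ => by ring
    rw [h3, h4] at h1
    field_simp at h1 ⊢
    linear_combination h1
  have kx := key x hx hmx hgx
  have ky := key y hy hmy hgy
  rw [← hA] at kx
  rw [← hB] at ky
  have h5 := lap_sub_le h.reg_u.1 x y e he hq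
  have h6 := hab (√(1 + A)) (√(1 + B))
  rw [Real.sq_sqrt (by linarith), Real.sq_sqrt (by linarith)] at h6
  have h7 : (√(1 + A) + √(1 + B)) ^ 2 * p ≤ (2 + A + B) * p := by
    apply mul_le_mul_of_nonpos_right _ hp
    have := Real.sq_sqrt (show 0 ≤ 1 + A by linarith)
    have := Real.sq_sqrt (show 0 ≤ 1 + B by linarith)
    nlinarith [Real.sqrt_nonneg (1 + A), Real.sqrt_nonneg (1 + B),
      mul_nonneg (Real.sqrt_nonneg (1 + A)) (Real.sqrt_nonneg (1 + B))]
  nlinarith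

lemma grad_of_lip {d : ℕ} {u : (Fin d → ℝ) → ℝ} (hu : ContDiff ℝ 2 u) {r1 a : ℝ} (hr : 0 < r1)
    (ha : 0 ≤ a) (h : ∀ x y, nE (x - y) ≤ r1 → u x - u y ≤ a * nE (x - y)) (x : Fin d → ℝ) :
    gradSq d u x ≤ a ^ 2 := by
  have key : ∀ v : Fin d → ℝ, ∑ i, v i * pd d i u x ≤ a * nE v := by
    intro v
    have hd := hasDerivAt_line (f := u) x v 0 ((hu.differentiable (by norm_num)) _)
    rw [zero_smul, add_zero] at hd
    have h1 := (hd.tendsto_slope_zero_right)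
    refine le_of_tendsto h1 ?_
    have hv : ∀ᶠ t : ℝ in 𝓝[>] 0, nE (t • v) ≤ r1 := by
      have : Tendsto (fun t : ℝ => nE (t • v)) (𝓝[>] 0) (𝓝 (nE ((0:ℝ) • v))) := by
        apply Tendsto.mono_left _ nhdsWithin_le_nhds
        exact (continuous_nE.comp (continuous_id.smul continuous_const)).tendsto 0
      refine (this.eventually_le_const ?_)
      rw [nE_smul]; simpa using hr
    filter_upwards [hv, self_mem_nhdsWithin] with t ht ht0
    have ht0 : 0 < t := ht0
    have := h (x + t • v) x (by simpa using ht)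
    rw [add_sub_cancel_left, nE_smul, abs_of_pos ht0] at this
    simp only [zero_add, zero_smul, add_zero, smul_eq_mul]
    rw [inv_mul_le_iff₀ ht0]
    linarith
  have h2 := key (fun i => pd d i u x)
  have h3 : nE (fun i => pd d i u x) ^ 2 = gradSq d u x := by rw [nE_sq]; rfl
  have h4 : ∑ i, pd d i u x * pd d i u x = gradSq d u x := by
    unfold gradSq; exact Finset.sum_congr rfl fun i _ => by ring
  rw [h4] at h2
  rw [← h3] at h2 ⊢
  have := nE_nonneg (fun i => pd d i u x)
  by_cases h0 : nE (fun i => pd d i u x) = 0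
  · rw [h0]; nlinarith
  · have : 0 < nE (fun i => pd d i u x) := lt_of_le_of_ne this (Ne.symm h0)
    have : nE (fun i => pd d i u x) ≤ a := by nlinarith
    nlinarith

open MeasureTheory Set Filter Topology

lemma Ve_le {d : ℕ} {V : (Fin d → ℝ) → ℝ} {L : ℝ} (hL : 0 ≤ L) (x e : Fin d → ℝ)
    (h : ∑ i, pd d i V x ^ 2 ≤ L ^ 2) (he : ∑ i, e i ^ 2 = 1) : |∑ i, pd d i V x * e i| ≤ L := by
  apply abs_le_of_sq_le_sq _ hL
  have := Finset.sum_mul_sq_le_sq_mul_sq Finset.univ (fun i => pd d i V x) e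
  rw [he, mul_one] at this
  linarith

lemma half_shift {d : ℕ} (x y : Fin d → ℝ) : ∃ k : Fin d → ℤ,
    nE (x - (y + fun i => (k i : ℝ))) ≤ √d / 2 := by
  refine ⟨fun i => round (x i - y i), ?_⟩
  refine (nE_le_norm _).trans ?_
  rw [div_eq_mul_one_div]
  apply mul_le_mul_of_nonneg_left _ (Real.sqrt_nonneg _)
  rw [pi_norm_le_iff_of_nonneg (by norm_num)]
  intro i
  have := abs_sub_round (x i - y i)
  simp only [Pi.sub_apply, Pi.add_apply, Real.norm_eq_abs]
  rw [← sub_sub]; exact this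

lemma der_quad (a b r : ℝ) : HasDerivAt (fun r : ℝ => a * r - b * r ^ 2 / 2) (a - b * r) r := by
  have h1 : HasDerivAt (fun r : ℝ => r) 1 r := hasDerivAt_id' r
  exact ((h1.const_mul a).sub (((h1.pow 2).const_mul b).div_const 2)).congr_deriv (by
    norm_num; ring)

lemma der_lin (a b r : ℝ) : HasDerivAt (fun r : ℝ => a - b * r) (-b) r := by
  have h1 : HasDerivAt (fun r : ℝ => r) 1 r := hasDerivAt_id' r
  exact ((h1.const_mul b).const_sub a).congr_deriv (by ring)

lemma der_log {C ε S r : ℝ} (hC : C ≠ 0) (hε : ε ≠ 0) (h : 1 + C * S * r ≠ 0) :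
    HasDerivAt (fun r : ℝ => Real.log (1 + C * S * r) / (C * ε)) (S / (ε * (1 + C * S * r))) r := by
  have h1 : HasDerivAt (fun r : ℝ => r) 1 r := hasDerivAt_id' r
  exact ((((h1.const_mul (C * S)).const_add 1).log h).div_const (C * ε)).congr_deriv (by
    field_simp)

lemma der_inv {C ε S r : ℝ} (hε : ε ≠ 0) (h : 1 + C * S * r ≠ 0) :
    HasDerivAt (fun r : ℝ => S / (ε * (1 + C * S * r)))
      (- (C * ε * (S / (ε * (1 + C * S * r))) ^ 2)) r := by
  have h1 : HasDerivAt (fun r : ℝ => r) 1 r := hasDerivAt_id' r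
  exact ((hasDerivAt_const r S).div (((h1.const_mul (C * S)).const_add 1).const_mul ε)
    (mul_ne_zero hε h)).congr_deriv (by field_simp; ring)

set_option maxHeartbeats 1000000 in
theorem pass1 {d : ℕ} (hd : 1 ≤ d) {α : ℝ} {g : ℝ → ℝ} {V : (Fin d → ℝ) → ℝ} (hg : Ghyp α g)
    (hV : Vhyp d α V) (hA1 : A1 d g V) (hA2 : A2 g) :
    ∃ K : ℝ, 1 ≤ K ∧ ∀ ε > 0, ∀ u m, DiscSol d α g V ε u m → ∀ x, gradSq d u x ≤ K ^ 2 := by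
  obtain ⟨m0, hm0, hm01, hm⟩ := exists_m0 hg hV hA1
  obtain ⟨L, hL1, hL⟩ := exists_DV hV
  have hosc := oscV_nonneg hV
  have hd0 : (0:ℝ) < √d := Real.sqrt_pos.2 (by exact_mod_cast hd)
  set B := 2 + 1 / m0 with hB
  have hB0 : 0 < B := by positivity
  have gen : ∀ ε > 0, ∀ u m, DiscSol d α g V ε u m → ∀ r1 > 0,
      (∀ x y, nE (x - y) = r1 → L * r1 + B * (1 + ε) * r1 ^ 2 / 2 < u x - u y →
        ∃ k : Fin d → ℤ, nE (x - (y + fun i => (k i : ℝ))) < r1) →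
      ∀ x, gradSq d u x ≤ (L + B * (1 + ε) * r1) ^ 2 := by
    intro ε hε u m h r1 hr1 hb
    set a := L + B * (1 + ε) * r1 with ha
    have hBε : 0 < B * (1 + ε) := by positivity
    rcases twopt h.reg_u.1 h.per_u (φ := fun r => a * r - B * (1 + ε) * r ^ 2 / 2)
      (φ' := fun r => a - B * (1 + ε) * r) (φ'' := fun r => - (B * (1 + ε))) (r1 := r1)
      (by simp) (by fun_prop)
      (fun r _ => der_quad a (B * (1 + ε)) r) (fun r _ => der_lin a (B * (1 + ε)) r)
      (by
        intro x y hxy hlt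
        obtain ⟨k, hk⟩ := hb x y hxy (by
          convert hlt using 1; rw [ha]; ring)
        refine ⟨_, hk.le, ?_⟩
        rw [h.per_u]
        set ρ := nE (x - (y + fun i => (k i : ℝ)))
        have hρ : 0 ≤ ρ := nE_nonneg _
        have : (a * r1 - B * (1 + ε) * r1 ^ 2 / 2) - (a * ρ - B * (1 + ε) * ρ ^ 2 / 2)
          = (r1 - ρ) * (L + B * (1 + ε) * ((r1 - ρ) / 2)) := by rw [ha]; ring
        have h2 : 0 < (r1 - ρ) * (L + B * (1 + ε) * ((r1 - ρ) / 2)) := by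
          have : 0 < r1 - ρ := by linarith
          positivity
        linarith) with hc | hc
    · refine grad_of_lip h.reg_u.1 hr1 (by positivity) ?_
      intro x y hxy
      have := hc x y hxy
      have h2 := nE_nonneg (x - y)
      nlinarith [sq_nonneg (nE (x - y))]
    · exfalso
      obtain ⟨x, y, e, r, hr0, hr, hxy, he, hlt, hx, hy, hq, hab⟩ := hc
      have hs : L ≤ a - B * (1 + ε) * r := by rw [ha]; nlinarith
      set s := a - B * (1 + ε) * r with hsd
      have hs0 : 0 < s := by linarith
      have hmx := hm ε hε u m h x
      have hmy := hm ε hε u m h y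
      have hmx0 : 0 < m x := by linarith
      have hmy0 : 0 < m y := by linarith
      have hgx := deriv_g_pos hA2 hmx0
      have hgy := deriv_g_pos hA2 hmy0
      have key := contact h hg hV hs0 he hmx0 hmy0 hgx hgy hx hy hq hab (by linarith) rfl rfl
      set A1 := s ^ 2 / (m x * deriv g (m x)) with hA1d
      set A2 := s ^ 2 / (m y * deriv g (m y)) with hA2d
      have hA10 : 0 ≤ A1 := by positivity
      have hA20 : 0 ≤ A2 := by positivity
      have v1 := abs_le.1 (Ve_le (by linarith) x e (hL x) he)
      have v2 := abs_le.1 (Ve_le (by linarith) y e (hL y) he)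
      have w1 : (∑ i, pd d i V x * e i) / s ≤ 1 := by rw [div_le_one hs0]; linarith
      have w2 : -1 ≤ (∑ i, pd d i V y * e i) / s := by rw [le_div_iff₀ hs0]; linarith
      have t1 : A1 * (ε + (∑ i, pd d i V x * e i) / s) ≤ A1 * (ε + 1) := by gcongr
      have t2 : A2 * (ε - 1) ≤ A2 * (ε + (∑ i, pd d i V y * e i) / s) := by
        apply mul_le_mul_of_nonneg_left _ hA20; linarith
      have i1 : 1 / m x ≤ 1 / m0 := one_div_le_one_div_of_le hm0 hmx
      have i2 : 0 < 1 / m y := by positivity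
      have i3 : - (ε * (1 / m0)) ≤ ε * (1 / m y - 1 / m x) := by nlinarith
      have i4 : 0 < 1 / m0 := by positivity
      have : (2 + A1 + A2) * - (B * (1 + ε)) = - (2 * (2 + 1 / m0) * (1 + ε)
        + (A1 + A2) * (1 + ε) * 2 + (A1 + A2) * (1 + ε) * (1 / m0)) := by rw [hB]; ring
      have p1 : 0 ≤ (A1 + A2) * (1 + ε) * (1 / m0) := by positivity
      have p2 : 0 ≤ A1 * ε := by positivity
      have p3 : 0 ≤ A2 * ε := by positivity
      have p4 : 0 ≤ 1 / m0 * ε := by positivity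
      linarith
  refine ⟨L + 2 * B * (√d + (oscV d V + 1)), by
    have : 0 ≤ 2 * B * (√d + (oscV d V + 1)) := by positivity
    linarith, ?_⟩
  intro ε hε u m h x
  rcases le_total ε 1 with h1 | h1
  · refine (gen ε hε u m h (√d) hd0 ?_ x).trans ?_
    · intro x y _ _
      obtain ⟨k, hk⟩ := half_shift x y
      exact ⟨k, by linarith⟩
    · apply pow_le_pow_left₀ (by positivity)
      have : B * (1 + ε) * √d ≤ B * 2 * √d := by gcongr; linarith
      have : 0 ≤ B * (oscV d V + 1) := by positivity
      linarith
  · refine (gen ε hε u m h ((oscV d V + 1) / ε) (by positivity) ?_ x).trans ?_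
    · intro x y _ hlt
      exfalso
      have h2 := eps_osc hε hg hV h x y
      have h3 : (oscV d V + 1) / ε ≤ L * ((oscV d V + 1) / ε) := by
        apply le_mul_of_one_le_left (by positivity) hL1
      have h4 : 0 ≤ B * (1 + ε) * ((oscV d V + 1) / ε) ^ 2 / 2 := by positivity
      have h5 : (oscV d V + 1) / ε < u x - u y := by linarith
      rw [div_lt_iff₀ hε] at h5
      nlinarith
    · apply pow_le_pow_left₀ (by positivity)
      have : B * (1 + ε) * ((oscV d V + 1) / ε) ≤ 2 * B * (oscV d V + 1) := by
        rw [mul_div_assoc', div_le_iff₀ hε]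
        have : 0 ≤ B * (oscV d V + 1) := by positivity
        nlinarith
      have : 0 ≤ B * √d := by positivity
      linarith

/-- `m * g' m` is bounded below on `[m0,∞)`, and `g` is unbounded above. -/
lemma g_facts {α : ℝ} {g : ℝ → ℝ} (hg : Ghyp α g) (hA2 : A2 g) :
    (∀ m0 > 0, ∃ c > 0, ∀ z ≥ m0, c ≤ z * deriv g z) ∧ ∀ R, ∃ M > 0, ∀ z ≥ 0, g z ≤ R → z ≤ M := by
  obtain ⟨C1, C2, β, hC1, hC2, h1, h2⟩ := hA2
  obtain ⟨gm, gc, gd, gl⟩ := hg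
  have hdg : ∀ z > 0, HasDerivAt g (deriv g z) z := fun z hz =>
    ((gd z hz).differentiableAt (Ioi_mem_nhds hz)).hasDerivAt
  have hmono : ∀ (S : Set ℝ), Convex ℝ S → S ⊆ Ioi 0 → (∀ z ∈ S, C1 / z ≤ deriv g z) →
      MonotoneOn (fun z => g z - C1 * Real.log z) S := by
    intro S hS hS0 hb
    have hder : ∀ z ∈ S, HasDerivAt (fun z => g z - C1 * Real.log z) (deriv g z - C1 * z⁻¹) z :=
      fun z hz => (hdg z (hS0 hz)).sub
        ((Real.hasDerivAt_log (ne_of_gt (hS0 hz))).const_mul C1)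
    refine monotoneOn_of_deriv_nonneg hS (fun z hz => (hder z hz).continuousAt.continuousWithinAt)
      (fun z hz => (hder z (interior_subset hz)).differentiableAt.differentiableWithinAt) ?_
    intro z hz
    rw [(hder z (interior_subset hz)).deriv]
    have := hb z (interior_subset hz)
    rw [div_eq_mul_inv] at this
    linarith
  have hβ : -1 < β := by
    by_contra hβ
    push Not at hβ
    have hM := hmono (Ioc 0 1) (convex_Ioc 0 1) (fun z hz => hz.1) (fun z hz => by
      refine le_trans ?_ (h1 z hz.1)
      rw [div_eq_mul_inv, ← Real.rpow_neg_one]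
      exact mul_le_mul_of_nonneg_left (Real.rpow_le_rpow_of_exponent_ge hz.1 hz.2 hβ) hC1.le)
    have h0 : ∀ z ∈ Ioc (0:ℝ) 1, -C1 * Real.log z ≤ g 1 - g 0 := by
      intro z hz
      have a := hM hz (by simp : (1:ℝ) ∈ Ioc (0:ℝ) 1) hz.2
      simp only [Real.log_one, mul_zero, sub_zero] at a
      have b := gm (show (0:ℝ) ∈ Ici 0 by simp) (show z ∈ Ici 0 from hz.1.le) hz.1
      linarith
    have h01 : 0 < g 1 - g 0 := by
      have := gm (show (0:ℝ) ∈ Ici 0 by simp) (show (1:ℝ) ∈ Ici 0 by simp) one_pos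
      linarith
    have := h0 (Real.exp (-((g 1 - g 0 + 1) / C1))) ⟨Real.exp_pos _, by
      rw [Real.exp_le_one_iff]
      have : 0 ≤ (g 1 - g 0 + 1) / C1 := by positivity
      linarith⟩
    rw [Real.log_exp] at this
    field_simp at this
    linarith
  refine ⟨fun m0 hm0 => ⟨C1 * m0 ^ (β + 1), by positivity, fun z hz => ?_⟩, ?_⟩
  · have hz0 : 0 < z := by linarith
    have a := h1 z hz0
    have b : m0 ^ (β + 1) ≤ z ^ (β + 1) := Real.rpow_le_rpow hm0.le hz (by linarith)
    have c : z ^ (β + 1) = z ^ β * z := by rw [Real.rpow_add hz0, Real.rpow_one]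
    calc C1 * m0 ^ (β + 1) ≤ C1 * z ^ (β + 1) := by gcongr
      _ = z * (C1 * z ^ β) := by rw [c]; ring
      _ ≤ z * deriv g z := by gcongr
  · have hM := hmono (Ici 1) (convex_Ici 1) (fun z hz => lt_of_lt_of_le one_pos (mem_Ici.1 hz)) (fun z hz => by
      have hz' : (1:ℝ) ≤ z := hz
      refine le_trans ?_ (h1 z (by linarith))
      rw [div_eq_mul_inv, ← Real.rpow_neg_one]
      gcongr)
    intro R
    refine ⟨max 1 (Real.exp ((R - g 1) / C1)), by positivity, ?_⟩
    intro z hz hgz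
    rcases le_total z 1 with h | h
    · exact le_max_of_le_left h
    · apply le_max_of_le_right
      have a := hM (show (1:ℝ) ∈ Ici 1 by simp) (show z ∈ Ici 1 from h) h
      simp only [Real.log_one, mul_zero, sub_zero] at a
      rw [← Real.log_le_iff_le_exp (by linarith), le_div_iff₀ hC1]
      linarith

set_option maxHeartbeats 1000000 in
theorem pass2 {d : ℕ} {α : ℝ} {g : ℝ → ℝ} {V : (Fin d → ℝ) → ℝ} (hg : Ghyp α g)
    (hV : Vhyp d α V) (hA1 : A1 d g V) (hA2 : A2 g) :
    ∃ K : ℝ, 1 ≤ K ∧ ∀ ε > 0, ∀ u m, DiscSol d α g V ε u m → ∀ x,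
      ε ^ 2 * gradSq d u x ≤ K ^ 2 := by
  obtain ⟨m0, hm0, hm01, hm⟩ := exists_m0 hg hV hA1
  obtain ⟨L, hL1, hL⟩ := exists_DV hV
  have hosc := oscV_nonneg hV
  obtain ⟨c, hc, hcz⟩ := (g_facts hg hA2).1 m0 hm0
  set C := 1 / c + 1 with hC
  have hC0 : 0 < C := by positivity
  set T := C * (oscV d V + 1) with hT
  have hT0 : 0 < T := by positivity
  set S0 := L * Real.exp T with hS0
  have hS00 : 0 < S0 := by positivity
  have hS01 : 1 ≤ S0 := by
    have := Real.one_le_exp hT0.le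
    rw [hS0]; nlinarith
  refine ⟨S0, hS01, ?_⟩
  intro ε hε u m h
  set r1 := (Real.exp T - 1) / (C * S0) with hr1
  have hexp : 0 < Real.exp T - 1 := by
    have := Real.add_one_lt_exp hT0.ne'
    linarith
  have hr10 : 0 < r1 := by positivity
  have hpos : ∀ r, 0 ≤ r → 0 < 1 + C * S0 * r := fun r hr => by positivity
  have h1r1 : 1 + C * S0 * r1 = Real.exp T := by rw [hr1]; field_simp; ring
  suffices hgo : ∀ x, gradSq d u x ≤ (S0 / ε) ^ 2 by
    intro x
    have := hgo x
    rw [div_pow, le_div_iff₀ (by positivity)] at this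
    linarith
  have hφ1 : ∀ r ≥ 0, HasDerivAt (fun r => Real.log (1 + C * S0 * r) / (C * ε))
      (S0 / (ε * (1 + C * S0 * r))) r := by
    intro r hr
    exact der_log hC0.ne' hε.ne' (hpos r hr).ne'
  have hφ2 : ∀ r ≥ 0, HasDerivAt (fun r => S0 / (ε * (1 + C * S0 * r)))
      (- (C * ε * (S0 / (ε * (1 + C * S0 * r))) ^ 2)) r := by
    intro r hr
    exact der_inv hε.ne' (hpos r hr).ne'
  rcases twopt h.reg_u.1 h.per_u (φ := fun r => Real.log (1 + C * S0 * r) / (C * ε))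
    (φ' := fun r => S0 / (ε * (1 + C * S0 * r)))
    (φ'' := fun r => - (C * ε * (S0 / (ε * (1 + C * S0 * r))) ^ 2)) (r1 := r1)
    (by simp) (fun r hr => (hφ1 r hr.1).continuousAt.continuousWithinAt)
    (fun r hr => hφ1 r hr.1.le) (fun r hr => hφ2 r hr.1.le)
    (by
      intro x y hxy hlt
      exfalso
      rw [h1r1, Real.log_exp, hT] at hlt
      have h2 := eps_osc hε hg hV h x y
      rw [div_lt_iff₀ (by positivity)] at hlt
      nlinarith) with hc1 | hc1
  · refine grad_of_lip h.reg_u.1 hr10 (by positivity) ?_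
    intro x y hxy
    refine (hc1 x y hxy).trans ?_
    have h2 := nE_nonneg (x - y)
    have := Real.log_le_sub_one_of_pos (hpos _ h2)
    rw [div_le_iff₀ (by positivity)]
    field_simp
    linarith
  · exfalso
    obtain ⟨x, y, e, r, hr0, hr, hxy, he, hlt, hx, hy, hq, hab⟩ := hc1
    have hden := hpos r hr0.le
    have hden2 : 1 + C * S0 * r ≤ Real.exp T := by rw [← h1r1]; gcongr
    have hs : L / ε ≤ S0 / (ε * (1 + C * S0 * r)) := by
      rw [div_le_div_iff₀ hε (by positivity), hS0]
      have : L * ε * (1 + C * S0 * r) ≤ L * ε * Real.exp T := by gcongr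
      linarith
    set s := S0 / (ε * (1 + C * S0 * r)) with hsd
    have hs0 : 0 < s := by positivity
    have hmx := hm ε hε u m h x
    have hmy := hm ε hε u m h y
    have hmx0 : 0 < m x := by linarith
    have hmy0 : 0 < m y := by linarith
    have hgx := deriv_g_pos hA2 hmx0
    have hgy := deriv_g_pos hA2 hmy0
    have key := contact h hg hV hs0 he hmx0 hmy0 hgx hgy hx hy hq hab
      (by have : 0 ≤ C * ε * s ^ 2 := by positivity
          linarith) rfl rfl
    set A1 := s ^ 2 / (m x * deriv g (m x)) with hA1d
    set A2 := s ^ 2 / (m y * deriv g (m y)) with hA2d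
    have hA10 : 0 ≤ A1 := by positivity
    have hA20 : 0 ≤ A2 := by positivity
    have v1 := abs_le.1 (Ve_le (by linarith) x e (hL x) he)
    have v2 := abs_le.1 (Ve_le (by linarith) y e (hL y) he)
    have hsL : L ≤ ε * s := by rw [div_le_iff₀ hε] at hs; linarith
    have w1 : (∑ i, pd d i V x * e i) / s ≤ ε := by rw [div_le_iff₀ hs0]; linarith
    have w2 : -ε ≤ (∑ i, pd d i V y * e i) / s := by rw [le_div_iff₀ hs0]; linarith
    have t1 : A1 * (ε + (∑ i, pd d i V x * e i) / s) ≤ A1 * (2 * ε) := by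
      gcongr; linarith
    have t2 : 0 ≤ A2 * (ε + (∑ i, pd d i V y * e i) / s) := by
      apply mul_nonneg hA20; linarith
    -- m y ≤ m x
    have hVxy : V y - V x ≤ L * r := by
      have hd : ∀ t ∈ Icc (0:ℝ) 1, HasDerivAt (fun t : ℝ => V (x + t • (y - x)))
          (∑ i, (y - x) i * pd d i V (x + t • (y - x))) t := fun t _ =>
        hasDerivAt_line x (y - x) t ((hV.2.1.differentiable (by norm_num)) _)
      obtain ⟨t, ht, hteq⟩ := exists_hasDerivAt_eq_slope (fun t : ℝ => V (x + t • (y - x)))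
        (fun t : ℝ => ∑ i, (y - x) i * pd d i V (x + t • (y - x))) (zero_lt_one' ℝ)
        (fun t ht => (hd t ht).continuousAt.continuousWithinAt)
        (fun t ht => hd t (Ioo_subset_Icc_self ht))
      simp only [one_smul, add_sub_cancel, zero_smul, add_zero, sub_zero, div_one] at hteq
      rw [← hteq]
      have hyx : ∀ i, (y - x) i = - r * e i := fun i => by
        have := congrFun hxy i
        simp only [Pi.sub_apply, Pi.smul_apply, smul_eq_mul] at this ⊢
        linarith
      have := abs_le.1 (Ve_le (by linarith) (x + t • (y - x)) e (hL _) he)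
      have h4 : ∑ i, (y - x) i * pd d i V (x + t • (y - x))
          = - r * ∑ i, pd d i V (x + t • (y - x)) * e i := by
        rw [Finset.mul_sum]
        refine Finset.sum_congr rfl fun i _ => ?_
        rw [hyx i]; ring
      rw [h4]; nlinarith
    have hφr : L * r ≤ ε * (u x - u y) := by
      have a := Real.one_sub_inv_le_log_of_pos hden
      have b : 1 - (1 + C * S0 * r)⁻¹ = C * r * (ε * s) := by rw [hsd]; field_simp; ring
      rw [div_lt_iff₀ (by positivity)] at hlt
      rw [b] at a
      have : C * r * L ≤ C * r * (ε * s) := by gcongr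
      have : C * (r * L) < C * (ε * (u x - u y)) := by linarith
      have := lt_of_mul_lt_mul_left this hC0.le
      linarith
    have hgr : gradSq d u x = gradSq d u y := by simp only [gradSq, hx, hy]
    have hgm : g (m y) ≤ g (m x) := by
      rw [← h.hj x, ← h.hj y, hgr]; linarith
    have hmm : m y ≤ m x := (hg.1.le_iff_le (h.m_nonneg y) (h.m_nonneg x)).1 hgm
    have i1 : 1 / m x ≤ 1 / m y := one_div_le_one_div_of_le hmy0 hmm
    have i2 : 0 ≤ ε * (1 / m y - 1 / m x) := mul_nonneg hε.le (by linarith)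
    have i3 : A1 ≤ s ^ 2 * (1 / c) := by
      rw [hA1d, div_eq_mul_one_div]
      gcongr
      exact hcz _ hmx
    have i4 : (2 + A1 + A2) * - (C * ε * s ^ 2) ≤ 2 * - (C * ε * s ^ 2) := by
      have : 0 ≤ (A1 + A2) * (C * ε * s ^ 2) := by positivity
      linarith
    have i5 : A1 * (2 * ε) ≤ s ^ 2 * (1 / c) * (2 * ε) := by gcongr
    have i6 : C * ε * s ^ 2 = s ^ 2 * (1 / c) * ε + s ^ 2 * ε := by rw [hC]; ring
    have i7 : 0 < s ^ 2 * ε := by positivity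
    linarith

open MeasureTheory Set Filter Topology

/-- All the a priori bounds of order one, with a single constant `Q`. -/
structure Good (d : ℕ) (α : ℝ) (g : ℝ → ℝ) (V : (Fin d → ℝ) → ℝ) (Q ε : ℝ)
    (u m : (Fin d → ℝ) → ℝ) : Prop where
  sol : DiscSol d α g V ε u m
  ghyp : Ghyp α g
  vhyp : Vhyp d α V
  epos : 0 < ε
  q1 : 1 ≤ Q
  gbd : ∃ a b : ℝ, 1 / Q ≤ a ∧ a ≤ 1 ∧ 1 ≤ b ∧ b ≤ Q ∧ (∀ x, m x ∈ Icc a b) ∧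
    (∀ z ∈ Icc a b, 1 / Q ≤ deriv g z) ∧ (∀ z ∈ Icc a b, deriv g z ≤ Q) ∧
    ∀ z ∈ Icc a b, ∀ w ∈ Icc a b, |deriv g z - deriv g w| ≤ Q * |z - w| ^ α
  du : ∀ x, gradSq d u x ≤ Q ^ 2
  edu : ∀ x, ε ^ 2 * gradSq d u x ≤ Q ^ 2
  dv : ∀ x, ∑ i, pd d i V x ^ 2 ≤ Q ^ 2
  v_hold : ∀ i x y, |pd d i V x - pd d i V y| ≤ Q * dist x y ^ α

theorem exists_good {d : ℕ} (hd : 1 ≤ d) {α : ℝ} (hα0 : 0 < α) {g : ℝ → ℝ} {V : (Fin d → ℝ) → ℝ}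
    (hg : Ghyp α g) (hV : Vhyp d α V) (hA1 : A1 d g V) (hA2 : A2 g) :
    ∃ Q : ℝ, 1 ≤ Q ∧ ∀ ε > 0, ∀ u m, DiscSol d α g V ε u m → Good d α g V Q ε u m := by
  obtain ⟨m0, hm0, hm01, hm⟩ := exists_m0 hg hV hA1
  obtain ⟨L, hL1, hL⟩ := exists_DV hV
  obtain ⟨K1, hK1, hK1'⟩ := pass1 hd hg hV hA1 hA2
  obtain ⟨K2, hK2, hK2'⟩ := pass2 hg hV hA1 hA2
  obtain ⟨M, hM0, hM⟩ := (g_facts hg hA2).2 (g 1 + oscV d V + K1 ^ 2 / 2)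
  set Q0 := max (1 / m0) (max M 1) with hQ0
  have hQ01 : 1 ≤ Q0 := (le_max_right _ _).trans (le_max_right _ _)
  have hQ0m : 1 / Q0 ≤ m0 := by
    rw [one_div_le (by linarith) hm0]; exact le_max_left _ _
  have hQ0M : M ≤ Q0 := (le_max_left _ _).trans (le_max_right _ _)
  have hmem : ∀ ε > 0, ∀ u m, DiscSol d α g V ε u m → ∀ x, m x ∈ Icc (1 / Q0) Q0 := by
    intro ε hε u m h x
    refine ⟨hQ0m.trans (hm ε hε u m h x), le_trans (hM _ (h.m_nonneg x) ?_) hQ0M⟩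
    rw [← h.hj x]
    have a := eps_u_le hε hg hV h x
    have b := hK1' ε hε u m h x
    have c := V_le_sSup hV x
    unfold oscV; linarith
  -- constants on the compact set `[1/Q0,Q0]`; we choose `Q` depending on it
  have hsub : Icc (1 / Q0) Q0 ⊆ Ioi (0:ℝ) := fun z hz => lt_of_lt_of_le (by positivity) hz.1
  obtain ⟨G, hG0, hG⟩ := hg.2.2.2 _ isCompact_Icc hsub
  -- continuity and positivity of deriv g
  have hcont : ContinuousOn (deriv g) (Icc (1 / Q0) Q0) := by
    intro z hz
    have h1 : Tendsto (fun w => G * dist w z ^ α) (𝓝[Icc (1 / Q0) Q0] z) (𝓝 0) := by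
      have : ContinuousAt (fun w => G * dist w z ^ α) z := by
        refine ContinuousAt.mul continuousAt_const ?_
        exact ContinuousAt.rpow_const (continuousAt_id.dist continuousAt_const) (Or.inr hα0.le)
      have h2 := this.tendsto
      simp only [dist_self, Real.zero_rpow hα0.ne', mul_zero] at h2
      exact h2.mono_left nhdsWithin_le_nhds
    rw [ContinuousWithinAt, tendsto_iff_dist_tendsto_zero]
    refine squeeze_zero' (Eventually.of_forall fun _ => dist_nonneg) ?_ h1
    filter_upwards [self_mem_nhdsWithin] with w hw
    rw [Real.dist_eq]; exact hG w hw z hz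
  have hne : (Icc (1 / Q0) Q0).Nonempty := ⟨1, by
    rw [div_le_one (by linarith)]; exact hQ01, hQ01⟩
  obtain ⟨z1, hz1, hmin⟩ := isCompact_Icc.exists_isMinOn hne hcont
  obtain ⟨z2, hz2, hmax⟩ := isCompact_Icc.exists_isMaxOn hne hcont
  have hz1p : 0 < deriv g z1 := deriv_g_pos hA2 (hsub hz1)
  have hz2p : 0 < deriv g z2 := deriv_g_pos hA2 (hsub hz2)
  choose Cv hCv0 hCv using hV.2.2
  set Q := Q0 + G + 1 / deriv g z1 + deriv g z2 + K1 + K2 + L + ∑ i, Cv i with hQ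
  have hsum : 0 ≤ ∑ i, Cv i := Finset.sum_nonneg fun i _ => hCv0 i
  have p1 : 0 < 1 / deriv g z1 := by positivity
  have hQ1 : 1 ≤ Q := by linarith
  refine ⟨Q, hQ1, fun ε hε u m h => ⟨h, hg, hV, hε, hQ1, ⟨1 / Q0, Q0, ?_, ?_, hQ01, by linarith,
    hmem ε hε u m h, ?_, ?_, ?_⟩, ?_, ?_, ?_, ?_⟩⟩
  · apply one_div_le_one_div_of_le <;> linarith
  · rw [div_le_one (by linarith)]; exact hQ01
  · intro z hz
    refine le_trans ?_ (hmin hz)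
    rw [one_div_le (by linarith) hz1p]; linarith
  · intro z hz
    exact (hmax hz).trans (by linarith)
  · intro z hz w hw
    refine (hG z hz w hw).trans ?_
    rw [Real.dist_eq]
    gcongr; linarith
  · intro x
    refine (hK1' ε hε u m h x).trans (pow_le_pow_left₀ (by linarith) (by linarith) 2)
  · intro x
    refine (hK2' ε hε u m h x).trans (pow_le_pow_left₀ (by linarith) (by linarith) 2)
  · intro x
    exact (hL x).trans (pow_le_pow_left₀ (by linarith) (by linarith) 2)
  · intro i x y
    refine (hCv i x y).trans ?_
    gcongr
    have := Finset.single_le_sum (f := Cv) (fun i _ => hCv0 i) (Finset.mem_univ i)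
    linarith

namespace Good
variable {d : ℕ} {α : ℝ} {g : ℝ → ℝ} {V : (Fin d → ℝ) → ℝ} {Q ε : ℝ}
  {u m : (Fin d → ℝ) → ℝ}

lemma qpos (G : Good d α g V Q ε u m) : 0 < Q := by linarith [G.q1]

lemma m_lo (G : Good d α g V Q ε u m) (x : Fin d → ℝ) : 1 / Q ≤ m x := by
  obtain ⟨a, b, h1, h2, h3, h4, h5, -⟩ := G.gbd
  exact h1.trans (h5 x).1

lemma m_hi (G : Good d α g V Q ε u m) (x : Fin d → ℝ) : m x ≤ Q := by
  obtain ⟨a, b, h1, h2, h3, h4, h5, -⟩ := G.gbd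
  exact (h5 x).2.trans h4

lemma m_pos (G : Good d α g V Q ε u m) (x : Fin d → ℝ) : 0 < m x := lt_of_lt_of_le (by have := G.qpos; positivity) (G.m_lo x)

lemma gp_lo (G : Good d α g V Q ε u m) (x : Fin d → ℝ) : 1 / Q ≤ deriv g (m x) := by
  obtain ⟨a, b, h1, h2, h3, h4, h5, h6, h7, h8⟩ := G.gbd
  exact h6 _ (h5 x)

lemma gp_hi (G : Good d α g V Q ε u m) (x : Fin d → ℝ) : deriv g (m x) ≤ Q := by
  obtain ⟨a, b, h1, h2, h3, h4, h5, h6, h7, h8⟩ := G.gbd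
  exact h7 _ (h5 x)

lemma gp_pos (G : Good d α g V Q ε u m) (x : Fin d → ℝ) : 0 < deriv g (m x) :=
  lt_of_lt_of_le (by have := G.qpos; positivity) (G.gp_lo x)

lemma gp_hold (G : Good d α g V Q ε u m) (x y : Fin d → ℝ) : |deriv g (m x) - deriv g (m y)| ≤ Q * |m x - m y| ^ α := by
  obtain ⟨a, b, h1, h2, h3, h4, h5, h6, h7, h8⟩ := G.gbd
  exact h8 _ (h5 x) _ (h5 y)

lemma g_lip (G : Good d α g V Q ε u m) : ∃ S : Set ℝ, 1 ∈ S ∧ (∀ x, m x ∈ S) ∧ (∀ z ∈ S, 0 < z) ∧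
    ∀ z ∈ S, ∀ w ∈ S, |g z - g w| ≤ Q * |z - w| ∧ |z - w| ≤ Q * |g z - g w| := by
  obtain ⟨a, b, h1, h2, h3, h4, h5, h6, h7, h8⟩ := G.gbd
  have hq := G.qpos
  have ha : 0 < a := lt_of_lt_of_le (by positivity) h1
  refine ⟨Icc a b, ⟨h2, h3⟩, h5, fun z hz => lt_of_lt_of_le ha hz.1, ?_⟩
  have hd : ∀ z ∈ Icc a b, HasDerivAt g (deriv g z) z := fun z hz =>
    ((G.ghyp.2.2.1 z (lt_of_lt_of_le ha hz.1)).differentiableAt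
      (Ioi_mem_nhds (lt_of_lt_of_le ha hz.1))).hasDerivAt
  have key : ∀ z ∈ Icc a b, ∀ w ∈ Icc a b, z < w →
      |g z - g w| ≤ Q * |z - w| ∧ |z - w| ≤ Q * |g z - g w| := by
    intro z hz w hw hzw
    have hsub : Icc z w ⊆ Icc a b := Icc_subset_Icc hz.1 hw.2
    obtain ⟨t, ht, hte⟩ := exists_hasDerivAt_eq_slope g (deriv g) hzw
      (fun t ht => (hd t (hsub ht)).continuousAt.continuousWithinAt)
      (fun t ht => hd t (hsub (Ioo_subset_Icc_self ht)))
    have htm := hsub (Ioo_subset_Icc_self ht)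
    rw [eq_div_iff (by linarith)] at hte
    have e1 := h6 t htm
    have e2 := h7 t htm
    have hwz : 0 < w - z := by linarith
    have hpos : 0 < deriv g t := lt_of_lt_of_le (by positivity) e1
    rw [abs_sub_comm z w, abs_of_pos hwz, abs_sub_comm (g z), ← hte, abs_mul, abs_of_pos hwz,
      abs_of_pos hpos]
    refine ⟨by gcongr, ?_⟩
    rw [div_le_iff₀ hq] at e1
    nlinarith
  intro z hz w hw
  rcases lt_trichotomy z w with h | h | h
  · exact key z hz w hw h
  · simp [h]
  · rw [abs_sub_comm z w, abs_sub_comm (g z)]; exact key w hw z hz h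

lemma pdu (G : Good d α g V Q ε u m) (i : Fin d) (x : Fin d → ℝ) : |pd d i u x| ≤ Q := by
  apply abs_le_of_sq_le_sq _ G.qpos.le
  exact (Finset.single_le_sum (f := fun i => pd d i u x ^ 2) (fun _ _ => sq_nonneg _)
    (Finset.mem_univ i)).trans (G.du x)

lemma epdu (G : Good d α g V Q ε u m) (i : Fin d) (x : Fin d → ℝ) : ε * |pd d i u x| ≤ Q := by
  rw [← abs_of_pos G.epos, ← abs_mul]
  apply abs_le_of_sq_le_sq _ G.qpos.le
  rw [mul_pow]
  refine le_trans ?_ (G.edu x)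
  have := (Finset.single_le_sum (f := fun i => pd d i u x ^ 2) (fun _ _ => sq_nonneg _)
    (Finset.mem_univ i))
  unfold gradSq
  gcongr

lemma pdv (G : Good d α g V Q ε u m) (i : Fin d) (x : Fin d → ℝ) : |pd d i V x| ≤ Q := by
  apply abs_le_of_sq_le_sq _ G.qpos.le
  exact (Finset.single_le_sum (f := fun i => pd d i V x ^ 2) (fun _ _ => sq_nonneg _)
    (Finset.mem_univ i)).trans (G.dv x)

lemma m_le_g (G : Good d α g V Q ε u m) (x y : Fin d → ℝ) : |m x - m y| ≤ Q * |g (m x) - g (m y)| := by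
  obtain ⟨S, h1, h2, h3, h4⟩ := G.g_lip
  exact (h4 _ (h2 x) _ (h2 y)).2

end Good

open MeasureTheory Set Filter Topology

lemma V_taylor {d : ℕ} {α : ℝ} (hα : 0 < α) {V : (Fin d → ℝ) → ℝ} (hV : ContDiff ℝ 1 V) {Q : ℝ}
    (hQ : 0 ≤ Q)
    (hh : ∀ i x y, |pd d i V x - pd d i V y| ≤ Q * dist x y ^ α) {ρ : ℝ}
    (x1 x : Fin d → ℝ) (hx : nE (x - x1) ≤ ρ) :
    |V x - V x1 - ∑ i, pd d i V x1 * (x - x1) i| ≤ d * Q * (ρ * ρ ^ α) := by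
  have hρ : 0 ≤ ρ := (nE_nonneg _).trans hx
  have hd : ∀ t ∈ Icc (0:ℝ) 1, HasDerivAt (fun t : ℝ => V (x1 + t • (x - x1)))
      (∑ i, (x - x1) i * pd d i V (x1 + t • (x - x1))) t := fun t _ =>
    hasDerivAt_line x1 (x - x1) t ((hV.differentiable (by norm_num)) _)
  obtain ⟨t, ht, hteq⟩ := exists_hasDerivAt_eq_slope (fun t : ℝ => V (x1 + t • (x - x1)))
    (fun t : ℝ => ∑ i, (x - x1) i * pd d i V (x1 + t • (x - x1))) (zero_lt_one' ℝ)
    (fun t ht => (hd t ht).continuousAt.continuousWithinAt)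
    (fun t ht => hd t (Ioo_subset_Icc_self ht))
  simp only [one_smul, add_sub_cancel, zero_smul, add_zero, sub_zero, div_one] at hteq
  rw [← hteq, ← Finset.sum_sub_distrib]
  refine (Finset.abs_sum_le_sum_abs _ _).trans ?_
  have : ∀ i ∈ (Finset.univ : Finset (Fin d)), |(x - x1) i * pd d i V (x1 + t • (x - x1))
      - pd d i V x1 * (x - x1) i| ≤ Q * (ρ * ρ ^ α) := by
    intro i _
    have e : (x - x1) i * pd d i V (x1 + t • (x - x1)) - pd d i V x1 * (x - x1) i
      = (x - x1) i * (pd d i V (x1 + t • (x - x1)) - pd d i V x1) := by ring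
    rw [e, abs_mul]
    have h1 : |(x - x1) i| ≤ ρ := (abs_le_nE _ i).trans hx
    have h2 : dist (x1 + t • (x - x1)) x1 ≤ ρ := by
      rw [dist_eq_norm, add_sub_cancel_left, norm_smul, Real.norm_eq_abs, abs_of_pos ht.1]
      have := (norm_le_nE (x - x1)).trans hx
      nlinarith [ht.1, ht.2, norm_nonneg (x - x1)]
    have h3 : dist (x1 + t • (x - x1)) x1 ^ α ≤ ρ ^ α := Real.rpow_le_rpow dist_nonneg h2 hα.le
    calc _ ≤ ρ * (Q * ρ ^ α) := by
          apply mul_le_mul h1 ((hh _ _ _).trans (by gcongr)) (abs_nonneg _) hρ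
      _ = _ := by ring
  refine (Finset.sum_le_sum this).trans ?_
  simp [mul_assoc]

lemma m3_arith (d : ℕ) {Q q ρ B : ℝ} (hq1 : 1 ≤ Q) (hq0 : 0 ≤ q) (hρ0 : 0 ≤ ρ) (hρ1 : ρ ≤ 1)
    (hB : B = d * Q * q) :
    Q * (2 * B * d) + (2 * B * Q ^ 2 + d * (Q * (Q * (q * ρ) + 2 * B * ρ))) * Q
      ≤ 10 * (d + 1) ^ 2 * Q ^ 4 * q := by
  have hQ4' : Q ^ 2 ≤ Q ^ 4 := pow_le_pow_right₀ hq1 (by norm_num)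
  have hq : 0 < Q := by linarith
  have hQ4 : Q ^ 3 ≤ Q ^ 4 := pow_le_pow_right₀ hq1 (by norm_num)
  have hdd : (d:ℝ) ≤ (d + 1) ^ 2 := by nlinarith [Nat.cast_nonneg (α := ℝ) d]
  have hdd2 : (d:ℝ) ^ 2 ≤ (d + 1) ^ 2 := by nlinarith [Nat.cast_nonneg (α := ℝ) d]
  have b1 : Q * (2 * B * d) ≤ 2 * ((d + 1) ^ 2 * Q ^ 4 * q) := by
    calc Q * (2 * B * d) = 2 * (d ^ 2 * Q ^ 2 * q) := by rw [hB]; ring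
      _ ≤ _ := by gcongr
  have b2 : 2 * B * Q ^ 2 * Q ≤ 2 * ((d + 1) ^ 2 * Q ^ 4 * q) := by
    calc 2 * B * Q ^ 2 * Q = 2 * (d * Q ^ 4 * q) := by rw [hB]; ring
      _ ≤ _ := by gcongr
  have b3 : d * (Q * (Q * (q * ρ))) * Q ≤ (d + 1) ^ 2 * Q ^ 4 * q := by
    calc d * (Q * (Q * (q * ρ))) * Q = d * Q ^ 3 * q * ρ := by ring
      _ ≤ (d + 1) ^ 2 * Q ^ 4 * q * 1 := by gcongr
      _ = _ := by ring
  have b4 : d * (Q * (2 * B * ρ)) * Q ≤ 2 * ((d + 1) ^ 2 * Q ^ 4 * q) := by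
    calc d * (Q * (2 * B * ρ)) * Q = 2 * (d ^ 2 * Q ^ 3 * q * ρ) := by rw [hB]; ring
      _ ≤ 2 * ((d + 1) ^ 2 * Q ^ 4 * q * 1) := by gcongr
      _ = _ := by ring
  have b5 : 0 ≤ (d + 1) ^ 2 * Q ^ 4 * q := by positivity
  linarith

set_option maxHeartbeats 1000000 in
theorem m3_core {d : ℕ} {α : ℝ} (hα0 : 0 < α) (hα1 : α < 1) {g : ℝ → ℝ} {V : (Fin d → ℝ) → ℝ}
    {Q ε : ℝ} {u m : (Fin d → ℝ) → ℝ} (G : Good d α g V Q ε u m) (hε : 1 ≤ ε) (σ : ℝ)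
    (hσ : σ = 1 ∨ σ = -1) : ∃ xs : Fin d → ℝ,
      σ * (m xs - 1) ≤ 10 * (d + 1) ^ 2 * Q ^ 4 * ε ^ (-1 - α) ∧
      ∀ x, σ * (ε * u x + V x) ≤ σ * (ε * u xs + V xs) + d * Q * ε ^ (-1 - α) := by
  have hq := G.qpos
  have hq1 := G.q1
  have hu := G.sol.reg_u.1
  have hσa : |σ| = 1 := by rcases hσ with h | h <;> simp [h]
  have hσ2 : σ * σ = 1 := by rcases hσ with h | h <;> simp [h]
  have hε0 := G.epos
  set ρ := ε⁻¹ with hρ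
  have hρ0 : 0 < ρ := by positivity
  have hρ1 : ρ ≤ 1 := inv_le_one_of_one_le₀ hε
  have hρε : ε * ρ = 1 := by rw [hρ]; field_simp
  set q := ρ ^ (α - 1) with hqd
  have hq0 : 0 < q := by positivity
  have hq1' : 1 ≤ q := Real.one_le_rpow_of_pos_of_le_one_of_nonpos hρ0 hρ1 (by linarith)
  have e1 : ρ ^ α = q * ρ := by
    rw [hqd, ← Real.rpow_add_one hρ0.ne']; congr 1; ring
  have e2 : ε ^ (-1 - α) = q * ρ ^ 2 := by
    have : ε = ρ⁻¹ := by rw [hρ, inv_inv]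
    rw [this, Real.inv_rpow hρ0.le, ← Real.rpow_neg hρ0.le, hqd, ← Real.rpow_natCast ρ 2,
      ← Real.rpow_add hρ0]
    congr 1; push_cast; ring
  rw [e2]
  have hVt := fun x1 x hx => V_taylor hα0 G.vhyp.2.1 hq.le G.v_hold (ρ := ρ) x1 x hx
  rw [e1] at hVt
  set B := d * Q * q with hB
  have hB0 : 0 ≤ B := by positivity
  -- maximum point of `σ (ε u + V)`
  have hc : Continuous fun x => σ * (ε * u x + V x) := by
    have := hu.continuous; have := G.vhyp.2.1.continuous; fun_prop
  obtain ⟨x1, -, hx1⟩ := exists_max_of_per hc (fun x k => by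
    simp only [G.sol.per_u x k, G.vhyp.1 x k])
  set ψ : (Fin d → ℝ) → ℝ := fun x => σ * (ε * u x) + σ * (∑ i, pd d i V x1 * (x - x1) i)
    - B * ∑ i, (x - x1) i ^ 2 with hψ
  have hψc : Continuous ψ := by
    have := hu.continuous; rw [hψ]; fun_prop
  have hψ1 : ψ x1 = σ * (ε * u x1) := by simp [hψ]
  have hbd : ∀ x, nE (x - x1) = ρ → ψ x ≤ ψ x1 := by
    intro x hx
    have a := hVt x1 x hx.le
    have b := hx1 x
    rw [hψ1]
    simp only [hψ]
    rw [← nE_sq, hx, hB]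
    have c : |σ * (V x - V x1 - ∑ i, pd d i V x1 * (x - x1) i)| ≤ d * Q * (ρ * (q * ρ)) := by
      rw [abs_mul, hσa, one_mul]; exact a
    have := (abs_le.1 c).1
    nlinarith
  have hcpt := isCompact_nE_le (d := d) ρ
  obtain ⟨z0, hz0, hz0max⟩ := hcpt.exists_isMaxOn ⟨0, by
    have : nE (0 : Fin d → ℝ) = 0 := by simp [nE]
    show nE (0 : Fin d → ℝ) ≤ ρ
    rw [this]; exact hρ0.le⟩ (f := fun z => ψ (x1 + z)) (by fun_prop)
  have hmaxz : ∀ x, nE (x - x1) ≤ ρ → ψ x ≤ ψ (x1 + z0) := by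
    intro x hx
    have := hz0max (show x - x1 ∈ {z | nE z ≤ ρ} from hx)
    simpa using this
  obtain ⟨xs, hxs, hmax⟩ : ∃ xs, nE (xs - x1) < ρ ∧ ∀ x, nE (x - x1) ≤ ρ → ψ x ≤ ψ xs := by
    have hz0' : nE z0 ≤ ρ := hz0
    rcases hz0'.lt_or_eq with h | h
    · exact ⟨x1 + z0, by simpa using h, hmaxz⟩
    · refine ⟨x1, by rw [sub_self]; simpa [nE] using hρ0, fun x hx => (hmaxz x hx).trans ?_⟩
      exact hbd _ (by simpa using h)
  refine ⟨xs, ?_, ?_⟩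
  swap
  · intro x
    refine (hx1 x).trans ?_
    have a := hVt x1 xs hxs.le
    have b := hmax x1 (by rw [sub_self]; simpa [nE] using hρ0.le)
    rw [hψ1] at b
    simp only [hψ] at b
    have c : |σ * (V xs - V x1 - ∑ i, pd d i V x1 * (xs - x1) i)| ≤ d * Q * (ρ * (q * ρ)) := by
      rw [abs_mul, hσa, one_mul]; exact a
    have := (abs_le.1 c).1
    have h3 : 0 ≤ B * ∑ i, (xs - x1) i ^ 2 :=
      mul_nonneg hB0 (Finset.sum_nonneg fun _ _ => sq_nonneg _)
    nlinarith
  -- tests along lines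
  have test : ∀ v : Fin d → ℝ,
      (∑ i, v i * (σ * ε * pd d i u xs + σ * pd d i V x1 - 2 * B * (xs - x1) i)) = 0 ∧
      σ * ε * qf u xs v - 2 * B * ∑ i, v i ^ 2 ≤ 0 := by
    intro v
    have hlm : IsLocalMax (fun t : ℝ => ψ (xs + t • v)) 0 := by
      have hcont : Tendsto (fun t : ℝ => nE (xs + t • v - x1)) (𝓝 0) (𝓝 (nE (xs + (0:ℝ) • v - x1))) := by
        apply Continuous.tendsto
        exact continuous_nE.comp (by fun_prop)
      have : ∀ᶠ t : ℝ in 𝓝 0, nE (xs + t • v - x1) < ρ := by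
        refine hcont.eventually_lt_const ?_
        simpa using hxs
      filter_upwards [this] with t ht
      have := hmax _ ht.le
      simpa using this
    have hd1 : ∀ t : ℝ, HasDerivAt (fun t : ℝ => ψ (xs + t • v))
        (σ * (ε * ∑ i, v i * pd d i u (xs + t • v)) + σ * (∑ i, pd d i V x1 * v i)
          - B * ∑ i, 2 * (xs + t • v - x1) i * v i) t := by
      intro t
      have hc : ∀ i, HasDerivAt (fun t : ℝ => (xs + t • v - x1) i) (v i) t := by
        intro i
        simp only [Pi.sub_apply, Pi.add_apply, Pi.smul_apply, smul_eq_mul]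
        have h1 : HasDerivAt (fun t : ℝ => t) 1 t := hasDerivAt_id' t
        exact (((h1.mul_const (v i)).const_add (xs i)).sub_const (x1 i)).congr_deriv (by ring)
      have h1 := hasDerivAt_line (f := u) xs v t ((hu.differentiable (by norm_num)) _)
      have h2 : HasDerivAt (fun t : ℝ => ∑ i, pd d i V x1 * (xs + t • v - x1) i)
          (∑ i, pd d i V x1 * v i) t := HasDerivAt.fun_sum fun i _ => (hc i).const_mul _
      have h3 : HasDerivAt (fun t : ℝ => ∑ i, (xs + t • v - x1) i ^ 2)
          (∑ i, 2 * (xs + t • v - x1) i * v i) t := HasDerivAt.fun_sum fun i _ =>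
            ((hc i).pow 2).congr_deriv (by norm_num)
      exact (((h1.const_mul ε).const_mul σ).add (h2.const_mul σ)).sub (h3.const_mul B)
    have hd2 : HasDerivAt (fun t : ℝ => (σ * (ε * ∑ i, v i * pd d i u (xs + t • v))
        + σ * (∑ i, pd d i V x1 * v i) - B * ∑ i, 2 * (xs + t • v - x1) i * v i))
        (σ * (ε * qf u xs v) - B * ∑ i, 2 * v i * v i) 0 := by
      have hc : ∀ i, HasDerivAt (fun t : ℝ => (xs + t • v - x1) i) (v i) 0 := by
        intro i
        simp only [Pi.sub_apply, Pi.add_apply, Pi.smul_apply, smul_eq_mul]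
        have h1 : HasDerivAt (fun t : ℝ => t) 1 0 := hasDerivAt_id' 0
        exact (((h1.mul_const (v i)).const_add (xs i)).sub_const (x1 i)).congr_deriv (by ring)
      have h1 := hasDerivAt_line2 hu xs v 0
      rw [zero_smul, add_zero] at h1
      have h3 : HasDerivAt (fun t : ℝ => ∑ i, 2 * (xs + t • v - x1) i * v i)
          (∑ i, 2 * v i * v i) 0 := HasDerivAt.fun_sum fun i _ => ((hc i).const_mul 2).mul_const _
      exact (((h1.const_mul ε).const_mul σ).add_const _).sub (h3.const_mul B)
    obtain ⟨r1, r2⟩ := snd_test hlm (Eventually.of_forall hd1) hd2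
    constructor
    · simp only [zero_smul, add_zero] at r1
      rw [← r1]
      simp only [Finset.mul_sum, ← Finset.sum_add_distrib, ← Finset.sum_sub_distrib]
      refine Finset.sum_congr rfl fun i _ => by ring
    · refine le_trans (le_of_eq ?_) r2
      rw [mul_assoc, mul_comm 2 B, mul_assoc B 2, Finset.mul_sum]
      congr 3
      funext i; ring
  set Du : Fin d → ℝ := fun i => pd d i u xs with hDu
  have hlap : σ * ε * lap u xs ≤ 2 * B * d := by
    have : ∀ i : Fin d, σ * ε * pd d i (pd d i u) xs ≤ 2 * B := by
      intro i
      have := (test (Pi.single i 1)).2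
      rw [qf_single] at this
      have h2 : ∑ j, (Pi.single i (1:ℝ) : Fin d → ℝ) j ^ 2 = 1 := by
        rw [Finset.sum_eq_single i] <;> simp +contextual
      rw [h2] at this; linarith
    unfold lap
    rw [Finset.mul_sum]
    refine (Finset.sum_le_sum fun i _ => this i).trans ?_
    simp; linarith
  have hqf : σ * ε * qf u xs Du ≤ 2 * B * Q ^ 2 := by
    have h1 := (test Du).2
    have h2 : ∑ i, Du i ^ 2 ≤ Q ^ 2 := G.du xs
    have : 2 * B * ∑ i, Du i ^ 2 ≤ 2 * B * Q ^ 2 := by gcongr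
    linarith
  have hgr : σ * ε * (ε * gradSq d u xs + ∑ i, pd d i V xs * pd d i u xs)
      ≤ d * (Q * (Q * (q * ρ) + 2 * B * ρ)) := by
    have h1 := (test Du).1
    have h2 : σ * ε * (ε * gradSq d u xs + ∑ i, pd d i V xs * pd d i u xs)
        = ∑ i, ε * Du i * (σ * (pd d i V xs - pd d i V x1) + 2 * B * (xs - x1) i) := by
      have h3 : σ * ε * (ε * gradSq d u xs + ∑ i, pd d i V xs * pd d i u xs)
        - ∑ i, ε * Du i * (σ * (pd d i V xs - pd d i V x1) + 2 * B * (xs - x1) i)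
        = ε * ∑ i, Du i * (σ * ε * pd d i u xs + σ * pd d i V x1 - 2 * B * (xs - x1) i) := by
        simp only [gradSq, Finset.mul_sum, ← Finset.sum_add_distrib, ← Finset.sum_sub_distrib]
        refine Finset.sum_congr rfl fun i _ => ?_
        simp only [hDu]; ring
      rw [h1] at h3; linarith
    rw [h2]
    have h4 : ∀ i ∈ (Finset.univ : Finset (Fin d)),
        ε * Du i * (σ * (pd d i V xs - pd d i V x1) + 2 * B * (xs - x1) i)
        ≤ Q * (Q * (q * ρ) + 2 * B * ρ) := by
      intro i _
      refine (le_abs_self _).trans ?_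
      rw [abs_mul]
      have a1 : |ε * Du i| ≤ Q := by
        rw [abs_mul, abs_of_pos hε0]; exact G.epdu i xs
      have a2 : |pd d i V xs - pd d i V x1| ≤ Q * (q * ρ) := by
        refine (G.v_hold i xs x1).trans ?_
        rw [← e1]
        gcongr
        rw [dist_eq_norm]
        exact (norm_le_nE _).trans hxs.le
      have a3 : |(xs - x1) i| ≤ ρ := (abs_le_nE _ i).trans hxs.le
      have a4 : |σ * (pd d i V xs - pd d i V x1) + 2 * B * (xs - x1) i|
          ≤ Q * (q * ρ) + 2 * B * ρ := by
        refine (abs_add_le _ _).trans ?_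
        rw [abs_mul, hσa, one_mul, abs_mul, abs_of_nonneg (by linarith : 0 ≤ 2 * B)]
        gcongr
      exact mul_le_mul a1 a4 (abs_nonneg _) hq.le
    refine (Finset.sum_le_sum h4).trans ?_
    simp
  have heq := sol_nondiv' G.sol G.ghyp G.vhyp xs (G.m_pos xs) (G.gp_pos xs)
  have hgp := G.gp_pos xs
  have hgl := G.gp_lo xs
  -- combine
  have hT : σ * ε * (qf u xs Du + ε * gradSq d u xs + ∑ i, pd d i V xs * pd d i u xs)
      ≤ 2 * B * Q ^ 2 + d * (Q * (Q * (q * ρ) + 2 * B * ρ)) := by linarith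
  have hT0 : 0 ≤ 2 * B * Q ^ 2 + d * (Q * (Q * (q * ρ) + 2 * B * ρ)) := by positivity
  have h5 : σ * ε * (qf u xs Du + ε * gradSq d u xs + ∑ i, pd d i V xs * pd d i u xs)
      / deriv g (m xs) ≤ (2 * B * Q ^ 2 + d * (Q * (Q * (q * ρ) + 2 * B * ρ))) * Q := by
    rw [div_le_iff₀ hgp]
    refine hT.trans ?_
    have : 1 ≤ Q * deriv g (m xs) := by
      rw [div_le_iff₀ hq] at hgl; linarith
    rw [mul_assoc (_ + _) Q]
    exact le_mul_of_one_le_right hT0 this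
  have h6 : m xs * (σ * ε * lap u xs) ≤ Q * (2 * B * d) :=
    (mul_le_mul_of_nonneg_left hlap (G.m_pos xs).le).trans
      (mul_le_mul_of_nonneg_right (G.m_hi xs) (by positivity))
  have h7 : ε ^ 2 * (σ * (m xs - 1)) = m xs * (σ * ε * lap u xs) +
      σ * ε * (qf u xs Du + ε * gradSq d u xs + ∑ i, pd d i V xs * pd d i u xs)
      / deriv g (m xs) := by
    rw [mul_div_assoc]
    linear_combination (- σ * ε) * heq
  have h8 : ε ^ 2 * (σ * (m xs - 1)) ≤ 10 * (d + 1) ^ 2 * Q ^ 4 * q := by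
    rw [h7]
    refine (add_le_add h6 h5).trans ?_
    exact m3_arith d hq1 hq0.le hρ0.le hρ1 hB
  have h9 : ρ ^ 2 * (ε ^ 2 * (σ * (m xs - 1))) = σ * (m xs - 1) := by
    have : ρ ^ 2 * ε ^ 2 = 1 := by rw [← mul_pow, mul_comm, hρε, one_pow]
    rw [← mul_assoc, this, one_mul]
  rw [← h9]
  calc _ ≤ ρ ^ 2 * (10 * (d + 1) ^ 2 * Q ^ 4 * q) := by gcongr
    _ = _ := by ring

theorem m3_main {d : ℕ} {α : ℝ} (hα0 : 0 < α) (hα1 : α < 1) {g : ℝ → ℝ} {V : (Fin d → ℝ) → ℝ}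
    {Q ε : ℝ} {u m : (Fin d → ℝ) → ℝ} (G : Good d α g V Q ε u m) (hε : 1 ≤ ε) (x : Fin d → ℝ) :
    |m x - 1| ≤ 30 * (d + 1) ^ 2 * Q ^ 6 * ε ^ (-1 - α) := by
  have hq := G.qpos
  have hq1 := G.q1
  have hε0 := G.epos
  obtain ⟨S, s1, s2, s3, s4⟩ := G.g_lip
  have e0 : 0 < ε ^ (-1 - α) := by positivity
  have hgr : ∀ x, 0 ≤ gradSq d u x ∧ gradSq d u x ≤ Q ^ 2 * ε ^ (-1 - α) := by
    intro x
    refine ⟨gradSq_nonneg _, ?_⟩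
    have a := G.edu x
    have b : ε ^ (-2 : ℝ) ≤ ε ^ (-1 - α) := Real.rpow_le_rpow_of_exponent_le hε (by linarith)
    have c : ε ^ (-2 : ℝ) * ε ^ 2 = 1 := by
      rw [← Real.rpow_natCast ε 2, ← Real.rpow_add hε0]; norm_num
    calc gradSq d u x = ε ^ (-2 : ℝ) * (ε ^ 2 * gradSq d u x) := by rw [← mul_assoc, c, one_mul]
      _ ≤ ε ^ (-1 - α) * Q ^ 2 := mul_le_mul b a
          (mul_nonneg (by positivity) (gradSq_nonneg _)) e0.le
      _ = _ := by ring
  set T := ε ^ (-1 - α) with hT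
  have hmono := G.ghyp.1
  have gl : ∀ z ∈ S, ∀ D : ℝ, 0 ≤ D → z - 1 ≤ D → g z - g 1 ≤ Q * D := by
    intro z hz D hD hzD
    rcases le_total z 1 with h | h
    · have := hmono.monotoneOn (show z ∈ Ici 0 from (s3 z hz).le) (show (1:ℝ) ∈ Ici 0 by simp) h
      have : 0 ≤ Q * D := by positivity
      linarith
    · have a := (s4 z hz 1 s1).1
      rw [abs_of_nonneg (by linarith : 0 ≤ z - 1)] at a
      have := le_abs_self (g z - g 1)
      have : Q * (z - 1) ≤ Q * D := by gcongr
      linarith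
  have gl2 : ∀ z ∈ S, ∀ D : ℝ, 0 ≤ D → 1 - z ≤ D → g 1 - g z ≤ Q * D := by
    intro z hz D hD hzD
    rcases le_total 1 z with h | h
    · have := hmono.monotoneOn (show (1:ℝ) ∈ Ici 0 by simp) (show z ∈ Ici 0 from (s3 z hz).le) h
      have : 0 ≤ Q * D := by positivity
      linarith
    · have a := (s4 1 s1 z hz).1
      rw [abs_of_nonneg (by linarith : 0 ≤ 1 - z)] at a
      have := le_abs_self (g 1 - g z)
      have : Q * (1 - z) ≤ Q * D := by gcongr
      linarith
  obtain ⟨xa, ha1, ha2⟩ := m3_core hα0 hα1 G hε 1 (Or.inl rfl)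
  obtain ⟨xb, hb1, hb2⟩ := m3_core hα0 hα1 G hε (-1) (Or.inr rfl)
  rw [← hT] at ha1 ha2 hb1 hb2
  set D := 10 * (d + 1) ^ 2 * Q ^ 4 * T with hD
  have hD0 : 0 ≤ D := by positivity
  have k1 := gl _ (s2 xa) D hD0 (by linarith)
  have k2 := gl2 _ (s2 xb) D hD0 (by linarith)
  have l1 := ha2 x
  have l2 := hb2 x
  have j := G.sol.hj x
  have ja := G.sol.hj xa
  have jb := G.sol.hj xb
  have gx := hgr x
  have ga := hgr xa
  have gb := hgr xb
  have f := (s4 _ (s2 x) _ s1).2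
  have f2 : |g (m x) - g 1| ≤ Q * D + d * Q * T + Q ^ 2 * T := by
    rw [abs_le]
    have : 0 ≤ Q ^ 2 * T := by positivity
    constructor <;> linarith
  refine f.trans ((mul_le_mul_of_nonneg_left f2 hq.le).trans ?_)
  have hdd : (d:ℝ) ≤ (d + 1) ^ 2 := by nlinarith [Nat.cast_nonneg (α := ℝ) d]
  have hdd1 : (1:ℝ) ≤ (d + 1) ^ 2 := by nlinarith [Nat.cast_nonneg (α := ℝ) d]
  have q2 : Q ^ 2 ≤ Q ^ 6 := pow_le_pow_right₀ hq1 (by norm_num)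
  have q3 : Q ^ 3 ≤ Q ^ 6 := pow_le_pow_right₀ hq1 (by norm_num)
  have b1 : Q * (d * Q * T) ≤ (d + 1) ^ 2 * Q ^ 6 * T := by
    calc Q * (d * Q * T) = d * Q ^ 2 * T := by ring
      _ ≤ _ := by gcongr
  have b2 : Q * (Q ^ 2 * T) ≤ (d + 1) ^ 2 * Q ^ 6 * T := by
    calc Q * (Q ^ 2 * T) = 1 * Q ^ 3 * T := by ring
      _ ≤ _ := by gcongr
  have b3 : Q * (Q * D) = 10 * ((d + 1) ^ 2 * Q ^ 6 * T) := by rw [hD]; ring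
  have b5 : 0 ≤ (d + 1) ^ 2 * Q ^ 6 * T := by positivity
  linarith

open MeasureTheory Set Filter Topology

/-- constant coefficient operator `c Δ + κ ∂_p²` -/
noncomputable def Aop {d : ℕ} (c κ : ℝ) (p : Fin d → ℝ) (w : (Fin d → ℝ) → ℝ) (x : Fin d → ℝ) : ℝ :=
  c * lap w x + κ * qf w x p

/-- forward difference -/
def Dl {d : ℕ} (l : Fin d → ℝ) (w : (Fin d → ℝ) → ℝ) : (Fin d → ℝ) → ℝ := fun x => w (x + l) - w x

lemma contDiff_Dl {d : ℕ} {n : WithTop ℕ∞} {w : (Fin d → ℝ) → ℝ} (hw : ContDiff ℝ n w) (l : Fin d → ℝ) :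
    ContDiff ℝ n (Dl l w) := by
  unfold Dl
  exact (hw.comp (contDiff_id.add contDiff_const)).sub hw

lemma pd_Dl {d : ℕ} {w : (Fin d → ℝ) → ℝ} (hw : Differentiable ℝ w) (l : Fin d → ℝ) (i : Fin d) :
    pd d i (Dl l w) = Dl l (pd d i w) := by
  funext x
  unfold pd Dl
  have h1 : DifferentiableAt ℝ (fun x => w (x + l)) x :=
    (hw (x + l)).comp x (differentiableAt_id.add_const l)
  rw [fderiv_fun_sub h1 (hw x), fderiv_comp_add_right]
  rfl

lemma pd2_Dl {d : ℕ} {w : (Fin d → ℝ) → ℝ} (hw : ContDiff ℝ 2 w) (l : Fin d → ℝ) (i j : Fin d) :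
    pd d i (pd d j (Dl l w)) = Dl l (pd d i (pd d j w)) := by
  rw [pd_Dl (hw.differentiable (by norm_num)), pd_Dl ((contDiff_pd hw j).differentiable (by norm_num))]

lemma Aop_Dl {d : ℕ} {w : (Fin d → ℝ) → ℝ} (hw : ContDiff ℝ 2 w) (c κ : ℝ) (l p : Fin d → ℝ) :
    Aop c κ p (Dl l w) = Dl l (Aop c κ p w) := by
  funext x
  unfold Aop lap qf
  simp only [pd2_Dl hw]
  unfold Dl
  simp only [mul_sub, Finset.sum_sub_distrib]
  ring

lemma slope_line {d : ℕ} {f : (Fin d → ℝ) → ℝ} (hf : Differentiable ℝ f) (y v : Fin d → ℝ) :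
    ∃ t ∈ Ioo (0:ℝ) 1, f (y + v) - f y = ∑ k, v k * pd d k f (y + t • v) := by
  have hd : ∀ t : ℝ, HasDerivAt (fun t : ℝ => f (y + t • v)) (∑ k, v k * pd d k f (y + t • v)) t :=
    fun t => hasDerivAt_line y v t (hf _)
  have hc : Continuous (fun t : ℝ => f (y + t • v)) :=
    continuous_iff_continuousAt.2 fun t => (hd t).continuousAt
  obtain ⟨t, ht, hte⟩ := exists_hasDerivAt_eq_slope (fun t : ℝ => f (y + t • v))
      (fun t : ℝ => ∑ k, v k * pd d k f (y + t • v)) (zero_lt_one' ℝ) hc.continuousOn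
      (fun t _ => hd t)
  refine ⟨t, ht, ?_⟩
  simp only [one_smul, zero_smul, add_zero, sub_zero, div_one] at hte
  exact hte.symm

lemma mvt2 {d : ℕ} {w : (Fin d → ℝ) → ℝ} (hw : ContDiff ℝ 2 w) (i j : Fin d) {τ : ℝ} (hτ : 0 < τ)
    (x : Fin d → ℝ) : ∃ ξ, dist ξ x ≤ 2 * τ ∧
      Dl (Pi.single i τ) (Dl (Pi.single j τ) w) x = τ ^ 2 * pd d i (pd d j w) ξ := by
  have gen : ∀ (f : (Fin d → ℝ) → ℝ) (_ : Differentiable ℝ f) (i : Fin d) (y : Fin d → ℝ),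
      ∃ t ∈ Ioo (0:ℝ) 1, Dl (Pi.single i τ) f y = τ * pd d i f (y + t • Pi.single i τ) := by
    intro f hf i y
    obtain ⟨t, ht, hte⟩ := slope_line hf y (Pi.single i τ)
    refine ⟨t, ht, ?_⟩
    unfold Dl
    rw [hte, Finset.sum_eq_single i]
    · simp
    · intro k _ hk; simp [hk]
    · simp
  obtain ⟨t, ht, h1⟩ := gen (Dl (Pi.single j τ) w)
    ((contDiff_Dl hw _).differentiable (by norm_num)) i x
  rw [pd_Dl (hw.differentiable (by norm_num))] at h1
  obtain ⟨s, hs, h2⟩ := gen (pd d i w) ((contDiff_pd hw i).differentiable (by norm_num)) j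
    (x + t • Pi.single i τ)
  refine ⟨x + t • Pi.single i τ + s • Pi.single j τ, ?_, ?_⟩
  · rw [dist_eq_norm]
    have : x + t • Pi.single i τ + s • Pi.single j τ - x
      = t • (Pi.single i τ : Fin d → ℝ) + s • (Pi.single j τ : Fin d → ℝ) := by abel
    rw [this]
    refine (norm_add_le _ _).trans ?_
    rw [norm_smul, norm_smul, Pi.norm_single, Pi.norm_single, Real.norm_eq_abs, Real.norm_eq_abs,
      Real.norm_eq_abs, abs_of_pos ht.1, abs_of_pos hs.1, abs_of_pos hτ]
    nlinarith [ht.2, hs.2]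
  · rw [h1, h2, pd_comm hw]; ring

lemma qf_neg {d : ℕ} (u : (Fin d → ℝ) → ℝ) (x v : Fin d → ℝ) : qf u x (-v) = qf u x v := by
  have := qf_smul u x v (-1)
  simpa using this

/-- Brandt's barrier argument -/
theorem brandt {d : ℕ} {Z : (Fin d → ℝ) → ℝ} (hZ : ContDiff ℝ 2 Z) {e y0 p : Fin d → ℝ}
    (he : ∑ i, e i ^ 2 = 1) {R M lam Lam c κ E : ℝ} (hR : 0 < R) (hM : 0 < M)
    (hZM : ∀ x, |Z x| ≤ M) (hlam : 0 < lam) (hc1 : lam ≤ c) (hc2 : c ≤ Lam) (hκ : 0 ≤ κ)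
    (hp : κ * ∑ i, p i ^ 2 ≤ Lam) (hE0 : 0 ≤ E)
    (hE : ∀ x, dist x y0 ≤ 2 * R → |Aop c κ p Z x| ≤ E) {s : ℝ} (hs0 : 0 ≤ s) (hsR : s ≤ R) :
    Z (y0 + s • e) - Z (y0 - s • e) ≤ (Lam * (d + 2) * (2 * M / R ^ 2) + E) / lam * (2 * R * s) := by
  have hLam : 0 < Lam := by linarith
  set μ := 2 * M / R ^ 2 with hμ
  have hμ0 : 0 < μ := by positivity
  have hμR : μ * R ^ 2 = 2 * M := by rw [hμ]; field_simp
  set ν := (Lam * (d + 2) * μ + E) / lam with hν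
  have hνl : lam * ν = Lam * (d + 2) * μ + E := by rw [hν]; field_simp
  have hν0 : 0 < ν := by positivity
  have hνμ : μ ≤ ν := by
    have h1 : lam * μ ≤ Lam * μ := by gcongr; linarith
    have h2 : 0 ≤ Lam * (d + 1) * μ := by positivity
    have : lam * μ ≤ lam * ν := by rw [hνl]; linarith
    exact le_of_mul_le_mul_left this hlam
  have hνR : 2 * M ≤ ν * R ^ 2 := by rw [← hμR]; gcongr
  set F : (Fin d → ℝ) × ℝ → ℝ := fun q => Z (y0 + q.1 + q.2 • e) - Z (y0 + q.1 - q.2 • e)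
    - μ * ∑ i, q.1 i ^ 2 - ν * (q.2 * (2 * R - q.2)) with hF
  have hFc : Continuous F := by
    have := hZ.continuous
    rw [hF]; fun_prop
  have hK : IsCompact ({z : Fin d → ℝ | nE z ≤ R} ×ˢ Icc (0:ℝ) R) :=
    (isCompact_nE_le R).prod isCompact_Icc
  have hn0 : nE (0 : Fin d → ℝ) = 0 := by simp [nE]
  obtain ⟨⟨z, σ⟩, ⟨hz, hσ⟩, hmax⟩ := hK.exists_isMaxOn ⟨(0, 0), by
    refine ⟨?_, ?_⟩
    · show nE (0 : Fin d → ℝ) ≤ R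
      rw [hn0]; exact hR.le
    · exact ⟨le_refl _, hR.le⟩⟩ hFc.continuousOn
  have hz : nE z ≤ R := hz
  have hσ0 : 0 ≤ σ := hσ.1
  have hσR : σ ≤ R := hσ.2
  have hmax' : ∀ z' s', nE z' ≤ R → 0 ≤ s' → s' ≤ R → F (z', s') ≤ F (z, σ) :=
    fun z' s' h1 h2 h3 => hmax (show (z', s') ∈ _ from ⟨h1, h2, h3⟩)
  have hosc : ∀ x y, Z x - Z y ≤ 2 * M := fun x y => by
    have := abs_le.1 (hZM x); have := abs_le.1 (hZM y); linarith
  suffices hle : F (z, σ) ≤ 0 by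
    have h1 := (hmax' 0 s (by rw [hn0]; exact hR.le) hs0 hsR).trans hle
    simp only [hF, add_zero, Pi.zero_apply, ne_eq, OfNat.ofNat_ne_zero, not_false_eq_true,
      zero_pow, Finset.sum_const_zero, mul_zero, sub_zero] at h1
    have h2 : ν * (s * (2 * R - s)) ≤ ν * (2 * R * s) := by
      apply mul_le_mul_of_nonneg_left _ hν0.le
      nlinarith
    linarith
  by_contra hpos
  push Not at hpos
  have hzsq := nE_sq z
  have hFv : F (z, σ) = Z (y0 + z + σ • e) - Z (y0 + z - σ • e)
    - μ * nE z ^ 2 - ν * (σ * (2 * R - σ)) := by rw [hzsq]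
  have hσpos : 0 < σ := by
    rcases hσ0.lt_or_eq with h | h
    · exact h
    · exfalso
      rw [hFv, ← h] at hpos
      simp only [zero_smul, add_zero, sub_zero, sub_self, zero_mul, mul_zero] at hpos
      nlinarith [sq_nonneg (nE z)]
  have hσlt : σ < R := by
    rcases hσR.lt_or_eq with h | h
    · exact h
    · exfalso
      rw [hFv] at hpos
      have := hosc (y0 + z + σ • e) (y0 + z - σ • e)
      rw [h] at this hpos
      nlinarith [sq_nonneg (nE z)]
  have hzlt : nE z < R := by
    rcases hz.lt_or_eq with h | h
    · exact h
    · exfalso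
      rw [hFv, h] at hpos
      have := hosc (y0 + z + σ • e) (y0 + z - σ • e)
      have : 0 ≤ ν * (σ * (2 * R - σ)) := by
        apply mul_nonneg hν0.le (mul_nonneg hσ0 (by linarith))
      linarith
  set xp := y0 + z + σ • e with hxp
  set xm := y0 + z - σ • e with hxm
  have hZd : Differentiable ℝ Z := hZ.differentiable (by norm_num)
  -- tests in `x`
  have tx : ∀ v : Fin d → ℝ, qf Z xp v - qf Z xm v ≤ 2 * μ * ∑ i, v i ^ 2 := by
    intro v
    have hlm : IsLocalMax (fun t : ℝ => Z (xp + t • v) - Z (xm + t • v)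
        - μ * ∑ i, (z i + t * v i) ^ 2) 0 := by
      have hcont : Tendsto (fun t : ℝ => nE (z + t • v)) (𝓝 0) (𝓝 (nE (z + (0:ℝ) • v))) := by
        apply Continuous.tendsto
        exact continuous_nE.comp (by fun_prop)
      have : ∀ᶠ t : ℝ in 𝓝 0, nE (z + t • v) < R := by
        refine hcont.eventually_lt_const ?_
        simpa using hzlt
      filter_upwards [this] with t ht
      have := hmax' (z + t • v) σ ht.le hσ0 hσR
      simp only [hF] at this
      have a1 : y0 + (z + t • v) + σ • e = xp + t • v := by rw [hxp]; abel
      have a2 : y0 + (z + t • v) - σ • e = xm + t • v := by rw [hxm]; abel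
      rw [a1, a2] at this
      simp only [Pi.add_apply, Pi.smul_apply, smul_eq_mul] at this
      simp only [zero_smul, add_zero, zero_mul]
      linarith
    have hd1 : ∀ t : ℝ, HasDerivAt (fun t : ℝ => Z (xp + t • v) - Z (xm + t • v)
        - μ * ∑ i, (z i + t * v i) ^ 2)
        ((∑ i, v i * pd d i Z (xp + t • v)) - (∑ i, v i * pd d i Z (xm + t • v))
          - μ * ∑ i, 2 * (z i + t * v i) * v i) t := by
      intro t
      have hc : ∀ i, HasDerivAt (fun t : ℝ => z i + t * v i) (v i) t := by
        intro i
        have h1 : HasDerivAt (fun t : ℝ => t) 1 t := hasDerivAt_id' t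
        exact ((h1.mul_const (v i)).const_add (z i)).congr_deriv (by ring)
      have h3 : HasDerivAt (fun t : ℝ => ∑ i, (z i + t * v i) ^ 2)
          (∑ i, 2 * (z i + t * v i) * v i) t := HasDerivAt.fun_sum fun i _ =>
            ((hc i).pow 2).congr_deriv (by norm_num)
      exact ((hasDerivAt_line xp v t (hZd _)).sub (hasDerivAt_line xm v t (hZd _))).sub
        (h3.const_mul μ)
    have hd2 : HasDerivAt (fun t : ℝ => (∑ i, v i * pd d i Z (xp + t • v))
          - (∑ i, v i * pd d i Z (xm + t • v)) - μ * ∑ i, 2 * (z i + t * v i) * v i)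
        (qf Z (xp + (0:ℝ) • v) v - qf Z (xm + (0:ℝ) • v) v - μ * ∑ i, 2 * v i * v i) 0 := by
      have hc : ∀ i, HasDerivAt (fun t : ℝ => z i + t * v i) (v i) 0 := by
        intro i
        have h1 : HasDerivAt (fun t : ℝ => t) 1 0 := hasDerivAt_id' 0
        exact ((h1.mul_const (v i)).const_add (z i)).congr_deriv (by ring)
      have h3 : HasDerivAt (fun t : ℝ => ∑ i, 2 * (z i + t * v i) * v i)
          (∑ i, 2 * v i * v i) 0 := HasDerivAt.fun_sum fun i _ => ((hc i).const_mul 2).mul_const _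
      exact ((hasDerivAt_line2 hZ xp v 0).sub (hasDerivAt_line2 hZ xm v 0)).sub (h3.const_mul μ)
    have r2 := (snd_test hlm (Eventually.of_forall hd1) hd2).2
    simp only [zero_smul, add_zero] at r2
    have : ∑ i, 2 * v i * v i = 2 * ∑ i, v i ^ 2 := by
      rw [Finset.mul_sum]; refine Finset.sum_congr rfl fun i _ => by ring
    rw [this] at r2
    linarith
  -- test in `s`
  have ts : qf Z xp e - qf Z xm e ≤ - (2 * ν) := by
    have hlm : IsLocalMax (fun t : ℝ => Z (xp + t • e) - Z (xm + t • (-e))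
        - ν * ((σ + t) * (2 * R - (σ + t)))) 0 := by
      have h1 : ∀ᶠ t : ℝ in 𝓝 0, 0 < σ + t := by
        have : Tendsto (fun t : ℝ => σ + t) (𝓝 0) (𝓝 (σ + 0)) := by
          apply Continuous.tendsto; fun_prop
        exact this.eventually_const_lt (by simpa using hσpos)
      have h2 : ∀ᶠ t : ℝ in 𝓝 0, σ + t < R := by
        have : Tendsto (fun t : ℝ => σ + t) (𝓝 0) (𝓝 (σ + 0)) := by
          apply Continuous.tendsto; fun_prop
        exact this.eventually_lt_const (by simpa using hσlt)
      filter_upwards [h1, h2] with t ht1 ht2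
      have := hmax' z (σ + t) hz ht1.le ht2.le
      simp only [hF] at this
      have a1 : y0 + z + (σ + t) • e = xp + t • e := by rw [hxp, add_smul]; abel
      have a2 : y0 + z - (σ + t) • e = xm + t • (-e) := by rw [hxm, add_smul, smul_neg]; abel
      rw [a1, a2] at this
      simp only [zero_smul, add_zero]
      linarith
    have hq1 : ∀ t : ℝ, HasDerivAt (fun t : ℝ => ν * ((σ + t) * (2 * R - (σ + t))))
        (ν * (2 * R - 2 * (σ + t))) t := by
      intro t
      have h1 : HasDerivAt (fun t : ℝ => σ + t) 1 t := (hasDerivAt_id' t).const_add σ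
      exact ((h1.mul (h1.const_sub (2 * R))).const_mul ν).congr_deriv (by ring)
    have hq2 : HasDerivAt (fun t : ℝ => ν * (2 * R - 2 * (σ + t))) (- (2 * ν)) 0 := by
      have h1 : HasDerivAt (fun t : ℝ => σ + t) 1 0 := (hasDerivAt_id' 0).const_add σ
      exact (((h1.const_mul 2).const_sub (2 * R)).const_mul ν).congr_deriv (by ring)
    have hd1 : ∀ t : ℝ, HasDerivAt (fun t : ℝ => Z (xp + t • e) - Z (xm + t • (-e))
        - ν * ((σ + t) * (2 * R - (σ + t))))
        ((∑ i, e i * pd d i Z (xp + t • e)) - (∑ i, (-e) i * pd d i Z (xm + t • (-e)))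
          - ν * (2 * R - 2 * (σ + t))) t := fun t =>
      ((hasDerivAt_line xp e t (hZd _)).sub (hasDerivAt_line xm (-e) t (hZd _))).sub (hq1 t)
    have hd2 := ((hasDerivAt_line2 hZ xp e 0).sub (hasDerivAt_line2 hZ xm (-e) 0)).sub hq2
    have r2 := (snd_test hlm (Eventually.of_forall hd1) hd2).2
    simp only [zero_smul, add_zero, qf_neg] at r2
    linarith
  -- trace inequality
  have htr : lap Z xp - lap Z xm ≤ 2 * μ * d - 2 * ν := by
    have := trace_ge (fun i j => (if i = j then 2 * μ else 0)
        - (pd d i (pd d j Z) xp - pd d i (pd d j Z) xm))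
      (fun i j => by simp only [pd_comm hZ i j, eq_comm]) (fun v => by
        have h1 := tx v
        unfold qf at h1
        simp only [mul_sub, Finset.sum_sub_distrib, mul_ite, mul_zero, Finset.sum_ite_eq,
          Finset.mem_univ, if_true]
        have h2 : ∑ i, v i * v i * (2 * μ) = 2 * μ * ∑ i, v i ^ 2 := by
          rw [Finset.mul_sum]; refine Finset.sum_congr rfl fun i _ => by ring
        linarith) e he
    simp only [mul_sub, Finset.sum_sub_distrib, mul_ite, mul_zero, Finset.sum_ite_eq,
          Finset.mem_univ, if_true] at this
    have h2 : ∑ i, e i * e i * (2 * μ) = 2 * μ := by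
      rw [← Finset.sum_mul, show ∑ i, e i * e i = 1 by
        rw [← he]; exact Finset.sum_congr rfl fun i _ => by ring]
      ring
    simp only [Finset.sum_const, Finset.card_univ, Fintype.card_fin, nsmul_eq_mul] at this
    unfold lap
    unfold qf at ts
    linarith
  have hne1 : nE e = 1 := by unfold nE; rw [he, Real.sqrt_one]
  have hen : ‖e‖ ≤ 1 := (norm_le_nE e).trans hne1.le
  have hzn : ‖z‖ ≤ R := (norm_le_nE z).trans hz
  have hse : ‖σ • e‖ ≤ R := by
    rw [norm_smul, Real.norm_eq_abs, abs_of_nonneg hσ0]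
    nlinarith [norm_nonneg e]
  have hep := abs_le.1 (hE xp (by
    rw [dist_eq_norm, show xp - y0 = z + σ • e by rw [hxp]; abel]
    linarith [norm_add_le z (σ • e)]))
  have hem := abs_le.1 (hE xm (by
    rw [dist_eq_norm, show xm - y0 = z - σ • e by rw [hxm]; abel]
    linarith [norm_sub_le z (σ • e)]))
  unfold Aop at hep hem
  have hp2 : κ * (qf Z xp p - qf Z xm p) ≤ 2 * μ * Lam := by
    calc κ * (qf Z xp p - qf Z xm p) ≤ κ * (2 * μ * ∑ i, p i ^ 2) := by
          gcongr; exact tx p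
      _ = 2 * μ * (κ * ∑ i, p i ^ 2) := by ring
      _ ≤ _ := by gcongr
  have hl2 : c * (lap Z xp - lap Z xm) ≤ c * (2 * μ * d - 2 * ν) := by
    apply mul_le_mul_of_nonneg_left htr; linarith
  have h1 : c * (2 * μ * d) ≤ Lam * (2 * μ * d) := by gcongr
  have h2 : lam * ν ≤ c * ν := by gcongr
  have h3 : 0 < Lam * μ := by positivity
  linarith

open MeasureTheory Set Filter Topology

lemma Dl_tel {d : ℕ} (a b l : Fin d → ℝ) (u : (Fin d → ℝ) → ℝ) (x : Fin d → ℝ) (n : ℕ) :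
    ∑ k ∈ Finset.range n, Dl a (Dl b (Dl l u)) (x + (k:ℝ) • l) = Dl a (Dl b (Dl ((n:ℝ) • l) u)) x := by
  induction n with
  | zero => simp [Dl]
  | succ n ih =>
    rw [Finset.sum_range_succ, ih]
    unfold Dl
    have e : ((n + 1 : ℕ) : ℝ) • l = (n:ℝ) • l + l := by push_cast; rw [add_smul, one_smul]
    rw [e]
    have h1 : x + (n:ℝ) • l + a + b + l = x + a + b + ((n:ℝ) • l + l) := by abel
    have h2 : x + (n:ℝ) • l + a + b = x + a + b + (n:ℝ) • l := by abel
    have h3 : x + (n:ℝ) • l + a + l = x + a + ((n:ℝ) • l + l) := by abel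
    have h4 : x + (n:ℝ) • l + a = x + a + (n:ℝ) • l := by abel
    have h5 : x + (n:ℝ) • l + b + l = x + b + ((n:ℝ) • l + l) := by abel
    have h6 : x + (n:ℝ) • l + b = x + b + (n:ℝ) • l := by abel
    have h7 : x + (n:ℝ) • l + l = x + ((n:ℝ) • l + l) := by abel
    rw [h1, h2, h3, h4, h5, h6, h7]
    ring

lemma Dl_abs {d : ℕ} {f : (Fin d → ℝ) → ℝ} {l x : Fin d → ℝ} {c B ρ : ℝ} {x0 : Fin d → ℝ}
    (h : ∀ y, dist y x0 ≤ ρ + ‖l‖ → |f y - c| ≤ B) (hx : dist x x0 ≤ ρ) :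
    |Dl l f x| ≤ 2 * B := by
  have h1 := h (x + l) (by
    have : dist (x + l) x = ‖l‖ := by simp [dist_eq_norm]
    linarith [dist_triangle (x + l) x x0])
  have h2 := h x (by linarith [norm_nonneg l])
  unfold Dl
  have e : f (x + l) - f x = (f (x + l) - c) - (f x - c) := by ring
  rw [e]
  exact (abs_sub _ _).trans (by linarith)

lemma Dl3_abs {d : ℕ} {f : (Fin d → ℝ) → ℝ} {a b l x : Fin d → ℝ} {c B ρ : ℝ} {x0 : Fin d → ℝ}
    (h : ∀ y, dist y x0 ≤ ρ + ‖a‖ + ‖b‖ + ‖l‖ → |f y - c| ≤ B) (hx : dist x x0 ≤ ρ) :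
    |Dl a (Dl b (Dl l f)) x| ≤ 8 * B := by
  have h1 : ∀ y, dist y x0 ≤ ρ + ‖a‖ + ‖b‖ → |Dl l f y| ≤ 2 * B := fun y hy => Dl_abs h hy
  have h2 : ∀ y, dist y x0 ≤ ρ + ‖a‖ → |Dl b (Dl l f) y| ≤ 2 * (2 * B) :=
    fun y hy => Dl_abs (c := 0) (fun y hy => by simpa using h1 y hy) hy
  have := Dl_abs (c := 0) (fun y hy => by simpa using h2 y hy) hx
  linarith

set_option maxHeartbeats 1000000 in
lemma S_step {d : ℕ} (hd : 1 ≤ d) {γ lam Lam θ ρ : ℝ} {n0 : ℕ} (hγ0 : 0 < γ) (hlam : 0 < lam)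
    (hθ : 0 < θ) (hn0 : 0 < n0) (hρ : (n0:ℝ) * d ≤ ρ)
    {u : (Fin d → ℝ) → ℝ} (hu : ContDiff ℝ 2 u) {H N : ℝ} (hH : 0 < H) (hN : 0 ≤ N)
    (hval : ∀ i j x y, |pd d i (pd d j u) x - pd d i (pd d j u) y| ≤ H * dist x y ^ γ)
    {x0 x1 p : Fin d → ℝ} {c κ : ℝ} (hc1 : lam ≤ c) (hc2 : c ≤ Lam) (hκ : 0 ≤ κ)
    (hp : κ * ∑ i, p i ^ 2 ≤ Lam)
    (hA : ∀ x, |Aop c κ p u x - Aop c κ p u x0| ≤ N * dist x x0 ^ γ) (hx : x1 ≠ x0) (i j : Fin d) :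
    |pd d i (pd d j u) x1 - pd d i (pd d j u) x0| ≤
      (H * (2 * (2 * θ) ^ γ + (n0:ℝ) ^ γ / n0 + 2 * Lam * (d + 2) * d * n0 / (lam * ρ))
        + N * (8 * (2 * ρ + n0 + 2 * θ + 1) ^ γ * ρ * n0 * d / (lam * θ ^ 2))) * dist x1 x0 ^ γ := by
  have hLam : 0 < Lam := by linarith
  set r := dist x1 x0 with hr
  have hr0 : 0 < r := dist_pos.2 hx
  set l := x1 - x0 with hl
  have hln : ‖l‖ = r := by rw [hl, hr, dist_eq_norm]
  have hl0 : l ≠ 0 := by rw [hl]; exact sub_ne_zero.2 hx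
  have hdR : (1:ℝ) ≤ d := by exact_mod_cast hd
  have hnR : (1:ℝ) ≤ n0 := by exact_mod_cast hn0
  have hρ0 : 0 < ρ := by
    have : 0 < (n0:ℝ) * d := by positivity
    linarith
  set τ := θ * r with hτ
  have hτ0 : 0 < τ := by positivity
  set a : Fin d → ℝ := Pi.single i τ with ha
  set b : Fin d → ℝ := Pi.single j τ with hb
  have han : ‖a‖ = τ := by rw [ha, Pi.norm_single, Real.norm_eq_abs, abs_of_pos hτ0]
  have hbn : ‖b‖ = τ := by rw [hb, Pi.norm_single, Real.norm_eq_abs, abs_of_pos hτ0]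
  set Z := Dl a (Dl b (Dl l u)) with hZ
  have hZc : ContDiff ℝ 2 Z := contDiff_Dl (contDiff_Dl (contDiff_Dl hu _) _) _
  set M := τ ^ 2 * (H * r ^ γ) with hM
  have hM0 : 0 < M := by positivity
  have hgen : ∀ (l' x : Fin d → ℝ), |Dl a (Dl b (Dl l' u)) x| ≤ τ ^ 2 * (H * ‖l'‖ ^ γ) := by
    intro l' x
    obtain ⟨ξ, -, hξ⟩ := mvt2 (contDiff_Dl hu l') i j hτ0 x
    rw [ha, hb, hξ, pd2_Dl hu, abs_mul, abs_of_nonneg (sq_nonneg τ)]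
    refine mul_le_mul_of_nonneg_left ?_ (sq_nonneg τ)
    have := hval i j (ξ + l') ξ
    rwa [show dist (ξ + l') ξ = ‖l'‖ by simp [dist_eq_norm]] at this
  have hZM : ∀ x, |Z x| ≤ M := fun x => by
    have := hgen l x
    rwa [hln] at this
  have h0 : |Z x0 - τ ^ 2 * (pd d i (pd d j u) x1 - pd d i (pd d j u) x0)|
      ≤ τ ^ 2 * (2 * (H * (2 * τ) ^ γ)) := by
    obtain ⟨ξ, hξd, hξ⟩ := mvt2 (contDiff_Dl hu l) i j hτ0 x0
    rw [hZ, ha, hb, hξ, pd2_Dl hu, ← mul_sub, abs_mul, abs_of_nonneg (sq_nonneg τ)]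
    refine mul_le_mul_of_nonneg_left ?_ (sq_nonneg τ)
    unfold Dl
    have e1 : x1 = x0 + l := by rw [hl]; abel
    have h1 := hval i j (ξ + l) (x0 + l)
    have h2 := hval i j ξ x0
    rw [dist_add_right] at h1
    have h3 : dist ξ x0 ^ γ ≤ (2 * τ) ^ γ := Real.rpow_le_rpow dist_nonneg hξd hγ0.le
    have h4 : H * dist ξ x0 ^ γ ≤ H * (2 * τ) ^ γ := mul_le_mul_of_nonneg_left h3 hH.le
    rw [e1, abs_le]
    rw [abs_le] at h1 h2
    constructor <;> linarith [h1.1, h1.2, h2.1, h2.2]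
  have htel : |∑ k ∈ Finset.range n0, Z (x0 + (k:ℝ) • l)| ≤ τ ^ 2 * (H * (n0 * r) ^ γ) := by
    rw [hZ, Dl_tel]
    have := hgen ((n0:ℝ) • l) x0
    rwa [norm_smul, hln, Real.norm_of_nonneg (by linarith)] at this
  set R := ρ * r with hR
  have hR0 : 0 < R := by positivity
  set Γ := 2 * ρ + n0 + 2 * θ + 1 with hΓ
  have hΓ0 : 0 < Γ := by positivity
  set E := 8 * (N * (Γ * r) ^ γ) with hE
  have hE0 : 0 ≤ E := by positivity
  have hAZ : ∀ x, dist x x0 ≤ 2 * R + n0 * r → |Aop c κ p Z x| ≤ E := by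
    intro x hx
    rw [hZ, Aop_Dl (contDiff_Dl (contDiff_Dl hu _) _), Aop_Dl (contDiff_Dl hu _), Aop_Dl hu]
    refine Dl3_abs (c := Aop c κ p u x0) (x0 := x0) (fun y hy => ?_) hx
    refine (hA y).trans ?_
    have : dist y x0 ≤ Γ * r := by
      rw [han, hbn, hln] at hy
      rw [hΓ]; rw [hτ, hR] at hy; linarith
    exact mul_le_mul_of_nonneg_left (Real.rpow_le_rpow dist_nonneg this hγ0.le) hN
  -- Brandt
  set nl := nE l with hnl
  have hnl0 : 0 < nl := by
    rcases (nE_nonneg l).lt_or_eq with h | h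
    · exact h
    · exact absurd (nE_eq_zero h.symm) hl0
  have hnld : nl ≤ d * r := by
    refine (nE_le_norm l).trans ?_
    rw [hln]
    refine mul_le_mul_of_nonneg_right ?_ hr0.le
    rw [Real.sqrt_le_left (by positivity)]
    nlinarith
  set e : Fin d → ℝ := nl⁻¹ • l with he
  have he1 : ∑ i, e i ^ 2 = 1 := by
    rw [← nE_sq, he, nE_smul, abs_of_pos (by positivity), inv_mul_cancel₀ hnl0.ne', one_pow]
  set D := (Lam * (d + 2) * (2 * M / R ^ 2) + E) / lam * (2 * R * (n0 * d * r / 2)) with hD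
  have hbr : ∀ k < n0, |Z (x0 + (k:ℝ) • l) - Z x0| ≤ D := by
    intro k hk
    have hkR : (k:ℝ) ≤ n0 := by exact_mod_cast hk.le
    have hk0 : (0:ℝ) ≤ k := Nat.cast_nonneg k
    set s := (k:ℝ) * nl / 2 with hs
    have hs0 : 0 ≤ s := by positivity
    have hs1 : s ≤ n0 * d * r / 2 := by
      have : (k:ℝ) * nl ≤ n0 * (d * r) := mul_le_mul hkR hnld hnl0.le (by positivity)
      rw [hs]; linarith
    have hsR : s ≤ R := by
      have : (n0:ℝ) * d * r ≤ ρ * r := mul_le_mul_of_nonneg_right hρ hr0.le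
      have : 0 < (n0:ℝ) * d * r := by positivity
      linarith
    set y0 := x0 + ((k:ℝ) / 2) • l with hy0
    have hse : s • e = ((k:ℝ) / 2) • l := by
      rw [he, smul_smul, hs]; congr 1; field_simp
    have hyp : y0 + s • e = x0 + (k:ℝ) • l := by
      rw [hse, hy0, add_assoc, ← add_smul]; congr 2; ring
    have hym : y0 - s • e = x0 := by rw [hse, hy0]; abel
    have hy0d : dist y0 x0 ≤ n0 * r := by
      rw [hy0, dist_eq_norm, add_sub_cancel_left, norm_smul, hln, Real.norm_of_nonneg (by positivity)]
      apply mul_le_mul_of_nonneg_right _ hr0.le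
      linarith
    have hEy : ∀ x, dist x y0 ≤ 2 * R → |Aop c κ p Z x| ≤ E := fun x hx =>
      hAZ x (by linarith [dist_triangle x y0 x0])
    have hmono : (Lam * (d + 2) * (2 * M / R ^ 2) + E) / lam * (2 * R * s) ≤ D := by
      rw [hD]; gcongr
    have b1 := brandt hZc he1 hR0 hM0 hZM hlam hc1 hc2 hκ hp hE0 hEy hs0 hsR
    have b2 := brandt hZc (e := -e) (by simpa using he1) hR0 hM0 hZM hlam hc1 hc2 hκ hp hE0 hEy hs0 hsR
    rw [hyp, hym] at b1
    rw [smul_neg, sub_neg_eq_add, ← sub_eq_add_neg, hyp, hym] at b2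
    rw [abs_le]
    constructor <;> linarith
  have hnZ : n0 * |Z x0| ≤ τ ^ 2 * (H * (n0 * r) ^ γ) + n0 * D := by
    have e1 : (n0:ℝ) * Z x0 = (∑ k ∈ Finset.range n0, Z (x0 + (k:ℝ) • l))
        - ∑ k ∈ Finset.range n0, (Z (x0 + (k:ℝ) • l) - Z x0) := by
      rw [Finset.sum_sub_distrib]; simp
    have e2 : |∑ k ∈ Finset.range n0, (Z (x0 + (k:ℝ) • l) - Z x0)| ≤ n0 * D := by
      refine (Finset.abs_sum_le_sum_abs _ _).trans ?_
      refine (Finset.sum_le_sum fun k hk => hbr k (Finset.mem_range.1 hk)).trans ?_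
      simp
    rw [← abs_of_nonneg (by linarith : (0:ℝ) ≤ n0), ← abs_mul, abs_of_nonneg (by linarith : (0:ℝ) ≤ n0), e1]
    exact (abs_sub _ _).trans (add_le_add htel e2)
  have hZ0 : |Z x0| ≤ τ ^ 2 * (H * ((n0:ℝ) ^ γ / n0 * r ^ γ)) + D := by
    have hn : (0:ℝ) < n0 := by linarith
    rw [Real.mul_rpow hn.le hr0.le] at hnZ
    have : (n0:ℝ) * |Z x0| ≤ n0 * (τ ^ 2 * (H * ((n0:ℝ) ^ γ / n0 * r ^ γ)) + D) := by
      refine hnZ.trans (le_of_eq ?_)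
      field_simp
    exact le_of_mul_le_mul_left this hn
  have hDe : D = τ ^ 2 * ((H * (2 * Lam * (d + 2) * d * n0 / (lam * ρ))
      + N * (8 * Γ ^ γ * ρ * n0 * d / (lam * θ ^ 2))) * r ^ γ) := by
    rw [hD, hM, hE, hR, hτ, Real.mul_rpow hΓ0.le hr0.le]
    field_simp
  have h2τ : (2 * τ) ^ γ = (2 * θ) ^ γ * r ^ γ := by
    rw [hτ, ← mul_assoc, Real.mul_rpow (by positivity) hr0.le]
  have hfin : τ ^ 2 * |pd d i (pd d j u) x1 - pd d i (pd d j u) x0| ≤ τ ^ 2 * (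
      (H * (2 * (2 * θ) ^ γ + (n0:ℝ) ^ γ / n0 + 2 * Lam * (d + 2) * d * n0 / (lam * ρ))
        + N * (8 * Γ ^ γ * ρ * n0 * d / (lam * θ ^ 2))) * r ^ γ) := by
    rw [← abs_of_nonneg (sq_nonneg τ), ← abs_mul, abs_of_nonneg (sq_nonneg τ)]
    have e1 : τ ^ 2 * (pd d i (pd d j u) x1 - pd d i (pd d j u) x0)
      = Z x0 - (Z x0 - τ ^ 2 * (pd d i (pd d j u) x1 - pd d i (pd d j u) x0)) := by ring
    rw [e1]
    refine (abs_sub _ _).trans ((add_le_add hZ0 h0).trans (le_of_eq ?_))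
    rw [hDe, h2τ]; ring
  exact le_of_mul_le_mul_left hfin (by positivity)

/-- Lemma S: interior-type Schauder estimate on the whole space for `C^{2,γ}` functions -/
theorem schauder {d : ℕ} (hd : 1 ≤ d) {γ lam Lam : ℝ} (hγ0 : 0 < γ) (hγ1 : γ < 1) (hlam : 0 < lam)
    (hLam : 0 < Lam) : ∃ C : ℝ, 0 < C ∧ ∀ u : (Fin d → ℝ) → ℝ, ContDiff ℝ 2 u →
      ∀ N H0 : ℝ, 0 ≤ N →
      (∀ i j x y, |pd d i (pd d j u) x - pd d i (pd d j u) y| ≤ H0 * dist x y ^ γ) →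
      (∀ x0, ∃ (c κ : ℝ) (p : Fin d → ℝ), lam ≤ c ∧ c ≤ Lam ∧ 0 ≤ κ ∧ κ * ∑ i, p i ^ 2 ≤ Lam ∧
        ∀ x, |Aop c κ p u x - Aop c κ p u x0| ≤ N * dist x x0 ^ γ) →
      ∀ i j x y, |pd d i (pd d j u) x - pd d i (pd d j u) y| ≤ C * N * dist x y ^ γ := by
  obtain ⟨θ, hθ, hθe⟩ : ∃ θ : ℝ, 0 < θ ∧ 2 * (2 * θ) ^ γ ≤ 1 / 6 := by
    refine ⟨(1 / 12 : ℝ) ^ γ⁻¹ / 2, by positivity, ?_⟩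
    rw [mul_div_cancel₀ _ (two_ne_zero), Real.rpow_inv_rpow (by norm_num) hγ0.ne']
    norm_num
  obtain ⟨n0, hn0, hne⟩ : ∃ n0 : ℕ, 0 < n0 ∧ (n0:ℝ) ^ γ / n0 ≤ 1 / 6 := by
    have h1 : Tendsto (fun n : ℕ => (n:ℝ) ^ (-(1 - γ))) atTop (𝓝 0) :=
      (tendsto_rpow_neg_atTop (by linarith)).comp tendsto_natCast_atTop_atTop
    obtain ⟨n, hn, hn1⟩ := ((h1.eventually_lt_const (show (0:ℝ) < 1 / 6 by norm_num)).and
      (eventually_gt_atTop 0)).exists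
    refine ⟨n, hn1, ?_⟩
    have hnp : (0:ℝ) < n := by exact_mod_cast hn1
    have : (n:ℝ) ^ γ / n = (n:ℝ) ^ (-(1 - γ)) := by
      rw [show -(1 - γ) = γ - 1 by ring, Real.rpow_sub hnp, Real.rpow_one]
    rw [this]; exact hn.le
  have hdR : (1:ℝ) ≤ d := by exact_mod_cast hd
  have hnR : (1:ℝ) ≤ n0 := by exact_mod_cast hn0
  set ρ : ℝ := n0 * d + 12 * Lam * (d + 2) * d * n0 / lam with hρ
  have hρ0 : 0 < ρ := by positivity
  have hρ1 : (n0:ℝ) * d ≤ ρ := by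
    have : 0 ≤ 12 * Lam * (d + 2) * d * n0 / lam := by positivity
    linarith
  have hρ2 : 2 * Lam * (d + 2) * d * n0 / (lam * ρ) ≤ 1 / 6 := by
    rw [div_le_iff₀ (by positivity)]
    have : lam * ρ = lam * (n0 * d) + 12 * Lam * (d + 2) * d * n0 := by rw [hρ]; field_simp
    rw [this]
    have : 0 < lam * (n0 * d) := by positivity
    linarith
  set K : ℝ := 8 * (2 * ρ + n0 + 2 * θ + 1) ^ γ * ρ * n0 * d / (lam * θ ^ 2) with hK
  have hK0 : 0 < K := by positivity
  refine ⟨2 * K, by positivity, ?_⟩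
  intro u hu N H0 hN hH0 hA
  have step : ∀ H : ℝ, 0 < H →
      (∀ i j x y, |pd d i (pd d j u) x - pd d i (pd d j u) y| ≤ H * dist x y ^ γ) →
      (∀ i j x y, |pd d i (pd d j u) x - pd d i (pd d j u) y| ≤ (H / 2 + K * N) * dist x y ^ γ) := by
    intro H hH hval i j x y
    rcases eq_or_ne x y with rfl | hxy
    · simp only [sub_self, abs_zero]; positivity
    obtain ⟨c, κ, p, h1, h2, h3, h4, h5⟩ := hA y
    refine (S_step hd hγ0 hlam hθ hn0 hρ1 hu hH hN hval h1 h2 h3 h4 h5 hxy i j).trans ?_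
    rw [← hK]
    apply mul_le_mul_of_nonneg_right _ (by positivity)
    have : H * (2 * (2 * θ) ^ γ + (n0:ℝ) ^ γ / n0 + 2 * Lam * (d + 2) * d * n0 / (lam * ρ))
        ≤ H * (1 / 2) := by
      apply mul_le_mul_of_nonneg_left _ hH.le; linarith
    linarith
  set H1 := |H0| + 1 with hH1
  have hH1p : 0 < H1 := by positivity
  have it : ∀ n : ℕ, ∀ i j x y, |pd d i (pd d j u) x - pd d i (pd d j u) y|
      ≤ (H1 / 2 ^ n + 2 * K * N) * dist x y ^ γ := by
    intro n
    induction n with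
    | zero =>
      intro i j x y
      refine (hH0 i j x y).trans (mul_le_mul_of_nonneg_right ?_ (by positivity))
      have := le_abs_self H0
      have : 0 ≤ 2 * K * N := by positivity
      simp only [pow_zero, div_one]; linarith
    | succ n ih =>
      intro i j x y
      refine (step _ (by positivity) ih i j x y).trans (le_of_eq ?_)
      rw [pow_succ]; field_simp; ring
  intro i j x y
  have hlim : Tendsto (fun n : ℕ => (H1 / 2 ^ n + 2 * K * N) * dist x y ^ γ) atTop
      (𝓝 ((0 + 2 * K * N) * dist x y ^ γ)) := by
    refine Tendsto.mul_const _ (Tendsto.add_const _ ?_)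
    have : Tendsto (fun n : ℕ => H1 * (1 / 2 : ℝ) ^ n) atTop (𝓝 (H1 * 0)) :=
      (tendsto_pow_atTop_nhds_zero_of_lt_one (by norm_num) (by norm_num)).const_mul H1
    rw [mul_zero] at this
    refine this.congr fun n => ?_
    rw [one_div, inv_pow]; ring
  rw [zero_add] at hlim
  exact ge_of_tendsto' hlim fun n => it n i j x y

open MeasureTheory Set Filter Topology

/-- squared Euclidean norm -/
def nsq {d : ℕ} (x : Fin d → ℝ) : ℝ := ∑ i, x i ^ 2

structure WF (d : ℕ) (lam Lam F : ℝ) (s : (Fin d → ℝ) → ℝ) (B : Fin d → (Fin d → ℝ) → ℝ) : Prop where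
  sC : ContDiff ℝ 1 s
  Bc : ∀ i, Continuous (B i)
  weak : ∀ φ : (Fin d → ℝ) → ℝ, ContDiff ℝ 1 φ → HasCompactSupport φ →
    ∫ x, ∑ i, B i x * pd d i φ x = 0
  lo : ∀ x, lam * gradSq d s x - Lam * F ^ 2 ≤ ∑ i, B i x * pd d i s x
  hi : ∀ x, ∑ i, B i x ^ 2 ≤ Lam * (gradSq d s x + F ^ 2)

lemma pd_comp1 {d : ℕ} {s : (Fin d → ℝ) → ℝ} {Φ : ℝ → ℝ} {Φ' : ℝ} {x : Fin d → ℝ}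
    (hΦ : HasDerivAt Φ Φ' (s x)) (hs : DifferentiableAt ℝ s x) (i : Fin d) :
    pd d i (fun y => Φ (s y)) x = Φ' * pd d i s x := by
  unfold pd
  have : HasFDerivAt (fun y => Φ (s y)) (Φ' • fderiv ℝ s x) x :=
    hΦ.comp_hasFDerivAt x hs.hasFDerivAt
  rw [this.fderiv]
  simp

lemma hasDerivAt_pp2 (t : ℝ) : HasDerivAt (fun t : ℝ => (max t 0) ^ 2) (2 * max t 0) t := by
  rcases lt_trichotomy t 0 with h | h | h
  · have : (fun t : ℝ => (max t 0) ^ 2) =ᶠ[𝓝 t] fun _ => 0 := by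
      filter_upwards [Iio_mem_nhds h] with y hy
      rw [max_eq_right (le_of_lt hy)]; norm_num
    rw [max_eq_right h.le, mul_zero]
    exact (hasDerivAt_const t (0:ℝ)).congr_of_eventuallyEq this
  · subst h
    rw [max_self, mul_zero, hasDerivAt_iff_isLittleO_nhds_zero]
    have h1 : (fun h : ℝ => (max (0 + h) 0) ^ 2 - (max (0:ℝ) 0) ^ 2 - h • (0:ℝ)) =O[𝓝 0] fun h : ℝ => h ^ 2 := by
      refine Asymptotics.IsBigO.of_bound 1 (Eventually.of_forall fun h => ?_)
      simp only [zero_add, max_self, smul_zero, sub_zero, norm_pow, one_mul, Real.norm_eq_abs]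
      rw [zero_pow two_ne_zero, sub_zero, abs_pow, sq_abs]
      rcases le_total h 0 with h0 | h0
      · rw [max_eq_right h0]; nlinarith [sq_nonneg h]
      · rw [max_eq_left h0, sq_abs]
    have h2 : (fun h : ℝ => h ^ 2) =o[𝓝 0] fun h : ℝ => h := by
      simpa using Asymptotics.isLittleO_pow_pow (𝕜 := ℝ) (show 1 < 2 by norm_num)
    exact h1.trans_isLittleO h2
  · have : (fun t : ℝ => (max t 0) ^ 2) =ᶠ[𝓝 t] fun t => t ^ 2 := by
      filter_upwards [Ioi_mem_nhds h] with y hy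
      rw [max_eq_left (le_of_lt hy)]
    rw [max_eq_left h.le]
    have h2 := hasDerivAt_pow 2 t
    exact (h2.congr_of_eventuallyEq this).congr_deriv (by norm_num)

lemma contDiff_pp2 : ContDiff ℝ 1 (fun t : ℝ => (max t 0) ^ 2) := by
  rw [contDiff_one_iff_deriv]
  refine ⟨fun t => (hasDerivAt_pp2 t).differentiableAt, ?_⟩
  have : deriv (fun t : ℝ => (max t 0) ^ 2) = fun t => 2 * max t 0 :=
    funext fun t => (hasDerivAt_pp2 t).deriv
  rw [this]; fun_prop

lemma continuous_gradSq {d : ℕ} {u : (Fin d → ℝ) → ℝ} (hu : ContDiff ℝ 1 u) :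
    Continuous (gradSq d u) := by
  unfold gradSq
  exact continuous_finsetSum _ fun i _ => (continuous_pd hu i).pow 2

lemma hasDerivAt_Phi {h h' : ℝ → ℝ} (hh : ∀ t, HasDerivAt h (h' t) t) (t : ℝ) :
    HasDerivAt (fun t : ℝ => h (- Real.arsinh t) * (√(1 + t ^ 2))⁻¹)
      (- (h' (- Real.arsinh t) + t * (√(1 + t ^ 2))⁻¹ * h (-Real.arsinh t)) * (√(1 + t ^ 2))⁻¹ ^ 2) t := by
  have hq : 0 < √(1 + t ^ 2) := Real.sqrt_pos.2 (by positivity)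
  have h1 : HasDerivAt (fun t : ℝ => - Real.arsinh t) (-(√(1 + t ^ 2))⁻¹) t :=
    (Real.hasDerivAt_arsinh t).neg
  have h2 : HasDerivAt (fun t : ℝ => h (- Real.arsinh t))
      (h' (- Real.arsinh t) * (-(√(1 + t ^ 2))⁻¹)) t := (hh _).comp t h1
  have h3 : HasDerivAt (fun t : ℝ => 1 + t ^ 2) (2 * t) t :=
    ((hasDerivAt_pow 2 t).const_add 1).congr_deriv (by norm_num)
  have h4 : HasDerivAt (fun t : ℝ => √(1 + t ^ 2)) (2 * t / (2 * √(1 + t ^ 2))) t :=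
    h3.sqrt (by positivity)
  have h5 : HasDerivAt (fun t : ℝ => (√(1 + t ^ 2))⁻¹)
    (- (2 * t / (2 * √(1 + t ^ 2))) / (√(1 + t ^ 2)) ^ 2) t := h4.inv hq.ne'
  refine (h2.mul h5).congr_deriv ?_
  field_simp
  ring

lemma energy_arith {lam Lam θ e h h' X p2BD pBE G pB2 : ℝ} (hlam : 0 < lam) (hLam : 0 < Lam)
    (hθ : 1 / 2 ≤ θ) (hθ1 : θ ≤ 1) (hh : 0 ≤ h) (hh' : 0 ≤ h') (hX : 0 ≤ X)
    (h1 : lam * X - Lam ≤ p2BD) (h2 : pB2 ≤ Lam * (X + 1))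
    (h3 : e * pBE * 2 ≤ lam / (4 * Lam) * e ^ 2 * pB2 + 4 * Lam / lam * G) :
    lam / 4 * (e ^ 2 * (h' + h) * X) - ((Lam + lam / 4) * (e ^ 2 * (h' + h)) + 4 * Lam / lam * (h * G))
      ≤ - (2 * e * h * pBE - e ^ 2 * (h' + θ * h) * p2BD) := by
  have a1 : e ^ 2 * (h' + θ * h) * (lam * X - Lam) ≤ e ^ 2 * (h' + θ * h) * p2BD :=
    mul_le_mul_of_nonneg_left h1 (by positivity)
  have a2 : lam / (4 * Lam) * e ^ 2 * pB2 ≤ lam / (4 * Lam) * e ^ 2 * (Lam * (X + 1)) :=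
    mul_le_mul_of_nonneg_left h2 (by positivity)
  have a3 : lam / (4 * Lam) * e ^ 2 * (Lam * (X + 1)) = lam / 4 * e ^ 2 * (X + 1) := by field_simp
  have a4 : h * (e * pBE * 2) ≤ h * (lam / 4 * e ^ 2 * (X + 1) + 4 * Lam / lam * G) :=
    mul_le_mul_of_nonneg_left (by linarith) hh
  have a5 : 0 ≤ e ^ 2 * h * (θ - 1 / 2) * (lam * X) := by
    have : 0 ≤ θ - 1 / 2 := by linarith
    positivity
  have a6 : 0 ≤ e ^ 2 * h * (1 - θ) * Lam := by
    have : 0 ≤ 1 - θ := by linarith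
    positivity
  have a7 : 0 ≤ lam * (e ^ 2 * h' * X) := by positivity
  have a8 : 0 ≤ lam * (e ^ 2 * h') := by positivity
  nlinarith

set_option maxHeartbeats 1000000 in
theorem energy {d : ℕ} {lam Lam : ℝ} (hlam : 0 < lam) (hLam : 0 < Lam) {s : (Fin d → ℝ) → ℝ}
    {B : Fin d → (Fin d → ℝ) → ℝ} (W : WF d lam Lam 1 s B) {η : (Fin d → ℝ) → ℝ}
    (hη : ContDiff ℝ 1 η) (hηc : HasCompactSupport η) (hs : ∀ x, η x ≠ 0 → 1 ≤ s x)
    {h h' : ℝ → ℝ} (hh : ∀ t, HasDerivAt h (h' t) t) (hc' : Continuous h')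
    (hh0 : ∀ t, 0 ≤ h t) (hh0' : ∀ t, 0 ≤ h' t) {z : (Fin d → ℝ) → ℝ}
    (hz : z = fun x => - Real.arsinh (s x)) :
    lam / 4 * ∫ x, η x ^ 2 * (h' (z x) + h (z x)) * gradSq d z x ≤
      ∫ x, ((Lam + lam / 4) * (η x ^ 2 * (h' (z x) + h (z x)))
        + 4 * Lam / lam * (h (z x) * gradSq d η x)) := by
  have hsd : Differentiable ℝ s := W.sC.differentiable (by norm_num)
  have hηd : Differentiable ℝ η := hη.differentiable (by norm_num)
  have hzC : ContDiff ℝ 1 z := by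
    rw [hz]; exact (Real.contDiff_arsinh.comp W.sC).neg
  set Φ : ℝ → ℝ := fun t : ℝ => h (- Real.arsinh t) * (√(1 + t ^ 2))⁻¹ with hΦ
  have hhC : ContDiff ℝ 1 h := by
    rw [contDiff_one_iff_deriv]
    refine ⟨fun t => (hh t).differentiableAt, ?_⟩
    rw [show deriv h = h' from funext fun t => (hh t).deriv]; exact hc'
  have hΦC : ContDiff ℝ 1 Φ := by
    have h1 : ContDiff ℝ 1 (fun t : ℝ => (√(1 + t ^ 2))⁻¹) := by
      refine ContDiff.inv ?_ fun t => ?_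
      · refine ContDiff.sqrt (by fun_prop) fun t => by positivity
      · exact (Real.sqrt_pos.2 (by positivity)).ne'
    exact (hhC.comp Real.contDiff_arsinh.neg).mul h1
  have hφC : ContDiff ℝ 1 (fun x => η x ^ 2 * Φ (s x)) := (hη.pow 2).mul (hΦC.comp W.sC)
  have hφc : HasCompactSupport (fun x => η x ^ 2 * Φ (s x)) := by
    refine HasCompactSupport.mul_right ?_
    exact hηc.comp_left (g := fun t : ℝ => t ^ 2) (by norm_num)
  have hw := W.weak _ hφC hφc
  have hpd : ∀ i x, pd d i (fun x => η x ^ 2 * Φ (s x)) x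
      = 2 * η x * pd d i η x * Φ (s x) + η x ^ 2 * (deriv Φ (s x) * pd d i s x) := by
    intro i x
    have d1 : DifferentiableAt ℝ (fun x => η x ^ 2) x := (hηd x).pow 2
    have d2 : DifferentiableAt ℝ (fun x => Φ (s x)) x :=
      (hΦC.differentiable (by norm_num) _).comp x (hsd x)
    rw [pd_mul d1 d2,
      pd_comp1 (hΦC.differentiable (by norm_num) _).hasDerivAt (hsd x),
      pd_comp1 (Φ := fun t : ℝ => t ^ 2) (hasDerivAt_pow 2 (η x)) (hηd x)]
    norm_num
    ring
  have hzpd : ∀ i x, pd d i z x = - (√(1 + s x ^ 2))⁻¹ * pd d i s x := by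
    intro i x
    rw [hz, pd_comp1 (Φ := fun t => - Real.arsinh t) (Real.hasDerivAt_arsinh (s x)).neg (hsd x)]
  have hgz : ∀ x, gradSq d z x = (√(1 + s x ^ 2))⁻¹ ^ 2 * gradSq d s x := by
    intro x
    unfold gradSq
    rw [Finset.mul_sum]
    refine Finset.sum_congr rfl fun i _ => ?_
    rw [hzpd]; ring
  have hzc := hzC.continuous
  have hhc := hhC.continuous
  have hηcont := hη.continuous
  have hgzc := continuous_gradSq hzC
  have hgηc := continuous_gradSq hη
  have hgη0 : ∀ x, x ∉ tsupport η → gradSq d η x = 0 := by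
    intro x hx
    unfold gradSq pd
    refine Finset.sum_eq_zero fun i _ => ?_
    have : fderiv ℝ η x = 0 := by
      by_contra hne
      exact hx (support_fderiv_subset ℝ hne)
    rw [this]; simp
  have hcs : ∀ f : (Fin d → ℝ) → ℝ, (∀ x, x ∉ tsupport η → f x = 0) → Continuous f → Integrable f := by
    intro f hf hfc
    exact hfc.integrable_of_hasCompactSupport (HasCompactSupport.intro hηc hf)
  have hη0 : ∀ x, x ∉ tsupport η → η x = 0 := fun x hx => image_eq_zero_of_notMem_tsupport hx
  have I1 : Integrable (fun x => η x ^ 2 * (h' (z x) + h (z x)) * gradSq d z x) :=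
    hcs _ (fun x hx => by rw [hη0 x hx]; ring) (by fun_prop)
  have I2 : Integrable (fun x => (Lam + lam / 4) * (η x ^ 2 * (h' (z x) + h (z x)))
        + 4 * Lam / lam * (h (z x) * gradSq d η x)) :=
    hcs _ (fun x hx => by rw [hη0 x hx, hgη0 x hx]; ring) (by fun_prop)
  have I3 : Integrable (fun x => ∑ i, B i x * pd d i (fun x => η x ^ 2 * Φ (s x)) x) := by
    refine hcs _ (fun x hx => ?_) ?_
    · refine Finset.sum_eq_zero fun i _ => ?_
      rw [hpd, hη0 x hx]; ring
    · exact continuous_finsetSum _ fun i _ => (W.Bc i).mul (continuous_pd hφC i)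
  have key : ∀ x, lam / 4 * (η x ^ 2 * (h' (z x) + h (z x)) * gradSq d z x) -
      ((Lam + lam / 4) * (η x ^ 2 * (h' (z x) + h (z x)))
        + 4 * Lam / lam * (h (z x) * gradSq d η x))
      ≤ - ∑ i, B i x * pd d i (fun x => η x ^ 2 * Φ (s x)) x := by
    intro x
    set q := (√(1 + s x ^ 2))⁻¹ with hq
    have hsq : 0 < √(1 + s x ^ 2) := Real.sqrt_pos.2 (by positivity)
    have hsq2 : √(1 + s x ^ 2) ^ 2 = 1 + s x ^ 2 := Real.sq_sqrt (by positivity)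
    have hq0 : 0 < q := by positivity
    have hq1 : q ≤ 1 := by
      rw [hq]; apply inv_le_one_of_one_le₀
      rw [Real.one_le_sqrt]; nlinarith [sq_nonneg (s x)]
    have hdΦ : deriv Φ (s x) = - (h' (z x) + s x * q * h (z x)) * q ^ 2 := by
      rw [(hasDerivAt_Phi hh (s x)).deriv, hz]
    have hΦe : Φ (s x) = h (z x) * q := by rw [hz]
    have hsum : ∑ i, B i x * pd d i (fun x => η x ^ 2 * Φ (s x)) x
        = 2 * η x * h (z x) * (q * ∑ i, B i x * pd d i η x)
          - η x ^ 2 * (h' (z x) + s x * q * h (z x)) * (q ^ 2 * ∑ i, B i x * pd d i s x) := by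
      simp only [Finset.mul_sum, ← Finset.sum_sub_distrib]
      refine Finset.sum_congr rfl fun i _ => ?_
      rw [hpd, hdΦ, hΦe]; ring
    rw [hsum]
    by_cases hη1 : η x = 0
    · rw [hη1]
      have := gradSq_nonneg (d := d) (u := η) x
      have := hh0 (z x)
      have : 0 ≤ 4 * Lam / lam * (h (z x) * gradSq d η x) := by positivity
      linarith
    have hs1 := hs x hη1
    have hθ1 : s x * q ≤ 1 := by
      rw [hq, ← div_eq_mul_inv, div_le_one hsq]
      apply Real.le_sqrt_of_sq_le; linarith
    have hθ0 : 1 / 2 ≤ s x * q := by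
      rw [hq, ← div_eq_mul_inv, div_le_div_iff₀ (by norm_num) hsq, one_mul]
      rw [Real.sqrt_le_left (by linarith)]
      nlinarith
    have hX := gradSq_nonneg (d := d) (u := z) x
    refine energy_arith (pB2 := q ^ 2 * ∑ i, B i x ^ 2) hlam hLam hθ0 hθ1 (hh0 _) (hh0' _) hX ?_ ?_ ?_
    · rw [hgz]
      have h1 := mul_le_mul_of_nonneg_left (W.lo x) (sq_nonneg q)
      have h2 : q ^ 2 ≤ 1 := by nlinarith
      have h3 : q ^ 2 * Lam ≤ 1 * Lam := mul_le_mul_of_nonneg_right h2 hLam.le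
      linarith
    · rw [hgz]
      have h1 := mul_le_mul_of_nonneg_left (W.hi x) (sq_nonneg q)
      have h2 : q ^ 2 ≤ 1 := by nlinarith
      have h3 : q ^ 2 * Lam ≤ 1 * Lam := mul_le_mul_of_nonneg_right h2 hLam.le
      linarith
    · unfold gradSq
      simp only [Finset.mul_sum, Finset.sum_mul, ← Finset.sum_add_distrib]
      refine Finset.sum_le_sum fun i _ => ?_
      have h1 : 0 ≤ (lam / (4 * Lam)) * (η x * (q * B i x) - (4 * Lam / lam) * pd d i η x) ^ 2 := by
        positivity
      have h2 : (lam / (4 * Lam)) * (η x * (q * B i x) - (4 * Lam / lam) * pd d i η x) ^ 2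
          = lam / (4 * Lam) * η x ^ 2 * (q ^ 2 * B i x ^ 2) + 4 * Lam / lam * pd d i η x ^ 2
            - η x * (q * (B i x * pd d i η x)) * 2 := by
        field_simp; ring
      linarith
  have hintg := integral_mono ((I1.const_mul (lam / 4)).sub I2) I3.neg key
  simp only [Pi.sub_apply, Pi.neg_apply] at hintg
  rw [integral_sub (I1.const_mul _) I2, integral_neg, hw, integral_const_mul] at hintg
  linarith

open MeasureTheory Set Filter Topology
open scoped ENNReal

lemma sq_integral_le {f : ℝ → ℝ} (hf : Continuous f) :
    (∫ t in (0:ℝ)..1, f t) ^ 2 ≤ ∫ t in (0:ℝ)..1, f t ^ 2 := by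
  set c := ∫ t in (0:ℝ)..1, f t with hc
  have h0 : 0 ≤ ∫ t in (0:ℝ)..1, (f t - c) ^ 2 :=
    intervalIntegral.integral_nonneg (by norm_num) fun t _ => sq_nonneg _
  have h1 : ∫ t in (0:ℝ)..1, (f t - c) ^ 2
      = (∫ t in (0:ℝ)..1, f t ^ 2) - 2 * c * c + c ^ 2 := by
    have : ∀ t, (f t - c) ^ 2 = f t ^ 2 - 2 * c * f t + c ^ 2 := fun t => by ring
    simp only [this]
    rw [intervalIntegral.integral_add, intervalIntegral.integral_sub,
      intervalIntegral.integral_const_mul, ← hc]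
    · simp
    · exact (Continuous.intervalIntegrable (by fun_prop) _ _)
    · exact (Continuous.intervalIntegrable (by fun_prop) _ _)
    · exact (Continuous.intervalIntegrable (by fun_prop) _ _)
    · exact (Continuous.intervalIntegrable (by fun_prop) _ _)
  nlinarith

lemma seg_ineq {d : ℕ} {z : (Fin d → ℝ) → ℝ} (hz : ContDiff ℝ 1 z) (x y : Fin d → ℝ) :
    (z x - z y) ^ 2 ≤ nsq (x - y) * ∫ t in (0:ℝ)..1, gradSq d z (y + t • (x - y)) := by
  have hzd : Differentiable ℝ z := hz.differentiable (by norm_num)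
  set v := x - y with hv
  have hd : ∀ t : ℝ, HasDerivAt (fun t : ℝ => z (y + t • v)) (∑ k, v k * pd d k z (y + t • v)) t :=
    fun t => hasDerivAt_line y v t (hzd _)
  have hc : Continuous fun t : ℝ => ∑ k, v k * pd d k z (y + t • v) := by
    refine continuous_finsetSum _ fun i _ => continuous_const.mul ?_
    exact (continuous_pd hz i).comp (by fun_prop)
  have hg : Continuous fun t : ℝ => gradSq d z (y + t • v) :=
    (continuous_gradSq hz).comp (by fun_prop)
  have h1 := intervalIntegral.integral_eq_sub_of_hasDerivAt (a := 0) (b := 1) (fun t _ => hd t)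
    (hc.intervalIntegrable _ _)
  simp only [one_smul, zero_smul, add_zero] at h1
  have e1 : y + v = x := by rw [hv]; abel
  rw [e1] at h1
  rw [← h1]
  refine (sq_integral_le hc).trans ?_
  rw [← intervalIntegral.integral_const_mul]
  refine intervalIntegral.integral_mono_on (by norm_num) ((hc.pow 2).intervalIntegrable _ _)
    ((continuous_const.mul hg).intervalIntegrable _ _) fun t _ => ?_
  exact Finset.sum_mul_sq_le_sq_mul_sq _ _ _

lemma cv_ineq {d : ℕ} {S : Set (Fin d → ℝ)} (hS : Convex ℝ S) (hSm : MeasurableSet S)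
    {F : (Fin d → ℝ) → ℝ≥0∞} (hF : Measurable F) {y : Fin d → ℝ} (hy : y ∈ S) {t : ℝ}
    (ht : 1 / 2 ≤ t) (ht1 : t ≤ 1) :
    ∫⁻ x in S, F (y + t • (x - y)) ≤ 2 ^ d * ∫⁻ x in S, F x := by
  have ht0 : 0 < t := by linarith
  rw [← lintegral_indicator hSm, ← lintegral_indicator hSm]
  set G := S.indicator F with hG
  have hGm : Measurable G := hF.indicator hSm
  have h1 : ∫⁻ x, S.indicator (fun x => F (y + t • (x - y))) x ≤ ∫⁻ x, G (t • x + (y - t • y)) := by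
    refine lintegral_mono fun x => ?_
    by_cases hx : x ∈ S
    · rw [indicator_of_mem hx]
      have e : y + t • (x - y) = t • x + (y - t • y) := by rw [smul_sub]; abel
      have hm : t • x + (y - t • y) ∈ S := by
        rw [← e]; exact hS.add_smul_sub_mem hy hx ⟨ht0.le, ht1⟩
      rw [hG, indicator_of_mem hm, e]
    · rw [indicator_of_notMem hx]; exact zero_le
  refine h1.trans ?_
  set H : (Fin d → ℝ) → ℝ≥0∞ := fun w => G (w + (y - t • y)) with hH
  have hHm : Measurable H := hGm.comp (measurable_id.add_const _)
  have h2 : ∫⁻ x, G (t • x + (y - t • y)) = ∫⁻ x, H x ∂(Measure.map (fun x => t • x) volume) := by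
    rw [lintegral_map hHm (measurable_const_smul t)]
  have h3 : Measure.map (fun x : Fin d → ℝ => t • x) volume = _ :=
    Measure.map_addHaar_smul (volume : Measure (Fin d → ℝ)) ht0.ne'
  rw [h2, h3, lintegral_smul_measure]
  have h4 : ∫⁻ x, H x = ∫⁻ x, G x := lintegral_add_right_eq_self G _
  rw [h4, smul_eq_mul]
  refine mul_le_mul_left ?_ _
  rw [Module.finrank_fin_fun, abs_of_pos (by positivity)]
  refine ENNReal.ofReal_le_of_le_toReal ?_
  rw [ENNReal.toReal_pow, ENNReal.toReal_ofNat, ← inv_pow]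
  gcongr
  rw [inv_le_comm₀ ht0 (by norm_num)]
  linarith

set_option maxHeartbeats 1000000 in
theorem poincare {d : ℕ} {z : (Fin d → ℝ) → ℝ} (hz : ContDiff ℝ 1 z) {S A : Set (Fin d → ℝ)}
    (hS : Convex ℝ S) (hSm : MeasurableSet S) {D : ℝ} (hD0 : 0 ≤ D)
    (hD : ∀ x ∈ S, ∀ y ∈ S, nsq (x - y) ≤ D)
    (hA : A ⊆ S) (hAm : MeasurableSet A) {k0 : ℝ} (hk : ∀ y ∈ A, z y ≤ k0) :
    volume A * ∫⁻ x in S, ENNReal.ofReal ((max (z x - k0) 0) ^ 2) ≤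
      ENNReal.ofReal D * (volume S * (2 ^ d * ∫⁻ x in S, ENNReal.ofReal (gradSq d z x))) := by
  set F : (Fin d → ℝ) → ℝ≥0∞ := fun x => ENNReal.ofReal (gradSq d z x) with hF
  have hFm : Measurable F := (continuous_gradSq hz).measurable.ennreal_ofReal
  set w : (Fin d → ℝ) → ℝ≥0∞ := fun x => ENNReal.ofReal ((max (z x - k0) 0) ^ 2) with hw
  set I := ∫⁻ x in S, F x with hI
  have h1 : ∀ y ∈ A, ∀ x ∈ S, w x ≤ ENNReal.ofReal D * ∫⁻ t in Ioc (0:ℝ) 1, F (y + t • (x - y)) := by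
    intro y hy x hx
    have hg : Continuous fun t : ℝ => gradSq d z (y + t • (x - y)) :=
      (continuous_gradSq hz).comp (by fun_prop)
    have hgn : 0 ≤ ∫ t in (0:ℝ)..1, gradSq d z (y + t • (x - y)) :=
      intervalIntegral.integral_nonneg (by norm_num) fun t _ => gradSq_nonneg _
    have a1 : (max (z x - k0) 0) ^ 2 ≤ (z x - z y) ^ 2 := by
      rcases le_total (z x - k0) 0 with h | h
      · rw [max_eq_right h]; nlinarith [sq_nonneg (z x - z y)]
      · rw [max_eq_left h]; have := hk y hy
        apply pow_le_pow_left₀ h; linarith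
    have a2 := (a1.trans (seg_ineq hz x y)).trans
      (mul_le_mul_of_nonneg_right (hD x hx y (hA hy)) hgn)
    have a3 := ENNReal.ofReal_le_ofReal a2
    rw [ENNReal.ofReal_mul hD0] at a3
    refine a3.trans (le_of_eq ?_)
    rw [intervalIntegral.integral_of_le (by norm_num), ofReal_integral_eq_lintegral_ofReal]
    · exact (hg.integrableOn_Icc).mono_set Ioc_subset_Icc_self
    · exact Eventually.of_forall fun t => gradSq_nonneg _
  have hm3 : Measurable fun q : (Fin d → ℝ) × (Fin d → ℝ) × ℝ => F (q.1 + q.2.2 • (q.2.1 - q.1)) :=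
    hFm.comp (by fun_prop)
  have h2 : volume A * ∫⁻ x in S, w x ≤
      ∫⁻ y in S, ∫⁻ x in S, ENNReal.ofReal D * ∫⁻ t in Ioc (0:ℝ) 1, F (y + t • (x - y)) := by
    calc volume A * ∫⁻ x in S, w x = ∫⁻ y in A, ∫⁻ x in S, w x := by
          rw [setLIntegral_const, mul_comm]
      _ ≤ ∫⁻ y in A, ∫⁻ x in S, ENNReal.ofReal D * ∫⁻ t in Ioc (0:ℝ) 1, F (y + t • (x - y)) :=
          setLIntegral_mono' hAm fun y hy => setLIntegral_mono' hSm fun x hx => h1 y hy x hx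
      _ ≤ _ := lintegral_mono_set hA
  refine h2.trans ?_
  have hmA : Measurable fun q : (Fin d → ℝ) × (Fin d → ℝ) =>
      ∫⁻ t in Ioc (0:ℝ) 1, F (q.1 + t • (q.2 - q.1)) := by
    refine Measurable.lintegral_prod_right' (f := fun q : ((Fin d → ℝ) × (Fin d → ℝ)) × ℝ =>
      F (q.1.1 + q.2 • (q.1.2 - q.1.1))) (hFm.comp (by fun_prop))
  have h3 : ∫⁻ y in S, ∫⁻ x in S, ENNReal.ofReal D * ∫⁻ t in Ioc (0:ℝ) 1, F (y + t • (x - y))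
      = ENNReal.ofReal D * ∫⁻ y in S, ∫⁻ x in S, ∫⁻ t in Ioc (0:ℝ) 1, F (y + t • (x - y)) := by
    rw [← lintegral_const_mul]
    · congr 1; funext y
      have hy : Measurable fun x => ∫⁻ t in Ioc (0:ℝ) 1, F (y + t • (x - y)) :=
        Measurable.lintegral_prod_right' (f := fun q : (Fin d → ℝ) × ℝ =>
          F (y + q.2 • (q.1 - y))) (hFm.comp (by fun_prop))
      rw [lintegral_const_mul _ hy]
    · exact Measurable.lintegral_prod_right' (f := fun q : (Fin d → ℝ) × (Fin d → ℝ) =>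
        ∫⁻ t in Ioc (0:ℝ) 1, F (q.1 + t • (q.2 - q.1))) hmA
  rw [h3]
  refine mul_le_mul_right ?_ _
  have h4 : ∫⁻ y in S, ∫⁻ x in S, ∫⁻ t in Ioc (0:ℝ) 1, F (y + t • (x - y))
      = ∫⁻ t in Ioc (0:ℝ) 1, ∫⁻ y in S, ∫⁻ x in S, F (y + t • (x - y)) := by
    have a1 : ∀ y, ∫⁻ x in S, ∫⁻ t in Ioc (0:ℝ) 1, F (y + t • (x - y))
        = ∫⁻ t in Ioc (0:ℝ) 1, ∫⁻ x in S, F (y + t • (x - y)) := fun y =>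
      lintegral_lintegral_swap (hFm.comp (by fun_prop) : Measurable
        (Function.uncurry fun (x : Fin d → ℝ) (t : ℝ) => F (y + t • (x - y)))).aemeasurable
    simp only [a1]
    refine lintegral_lintegral_swap (Measurable.aemeasurable ?_)
    exact Measurable.lintegral_prod_right' (f := fun q : ((Fin d → ℝ) × ℝ) × (Fin d → ℝ) =>
      F (q.1.1 + q.1.2 • (q.2 - q.1.1))) (hFm.comp (by fun_prop))
  rw [h4]
  calc ∫⁻ t in Ioc (0:ℝ) 1, ∫⁻ y in S, ∫⁻ x in S, F (y + t • (x - y))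
      ≤ ∫⁻ t in Ioc (0:ℝ) 1, volume S * (2 ^ d * I) := by
        refine setLIntegral_mono' measurableSet_Ioc fun t ht => ?_
        rcases le_total (1 / 2) t with h | h
        · calc ∫⁻ y in S, ∫⁻ x in S, F (y + t • (x - y)) ≤ ∫⁻ y in S, 2 ^ d * I :=
                setLIntegral_mono' hSm fun y hy => cv_ineq hS hSm hFm hy h ht.2
            _ = _ := by rw [setLIntegral_const, mul_comm]
        · have e : ∀ x y : Fin d → ℝ, y + t • (x - y) = x + (1 - t) • (y - x) := by
            intro x y
            rw [sub_smul, one_smul, smul_sub, smul_sub]; abel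
          have sw : ∫⁻ y in S, ∫⁻ x in S, F (y + t • (x - y))
              = ∫⁻ x in S, ∫⁻ y in S, F (y + t • (x - y)) :=
            lintegral_lintegral_swap (hFm.comp (by fun_prop) : Measurable
              (Function.uncurry fun (y x : Fin d → ℝ) => F (y + t • (x - y)))).aemeasurable
          rw [sw]
          simp only [e]
          calc ∫⁻ x in S, ∫⁻ y in S, F (x + (1 - t) • (y - x)) ≤ ∫⁻ x in S, 2 ^ d * I :=
                setLIntegral_mono' hSm fun x hx => cv_ineq hS hSm hFm hx (by linarith)
                  (by linarith [ht.1])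
            _ = _ := by rw [setLIntegral_const, mul_comm]
    _ = volume S * (2 ^ d * I) := by rw [setLIntegral_const]; simp

open MeasureTheory Set Filter Topology
open scoped ENNReal

lemma fderiv_norm_le {d : ℕ} (f : (Fin d → ℝ) → ℝ) (x : Fin d → ℝ) :
    ‖fderiv ℝ f x‖ ≤ ∑ i, |pd d i f x| := by
  refine ContinuousLinearMap.opNorm_le_bound _ (Finset.sum_nonneg fun i _ => abs_nonneg _) fun v => ?_
  rw [fderiv_eq_sum_pd, Real.norm_eq_abs, Finset.sum_mul]
  refine (Finset.abs_sum_le_sum_abs _ _).trans (Finset.sum_le_sum fun i _ => ?_)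
  rw [abs_mul, mul_comm]
  exact mul_le_mul_of_nonneg_left (norm_le_pi_norm v i) (abs_nonneg _)

lemma sobolev_ENN {d : ℕ} (hd : 2 ≤ d) : ∃ Cs : ℝ, 0 < Cs ∧ ∀ f : (Fin d → ℝ) → ℝ, ContDiff ℝ 1 f →
    HasCompactSupport f → ∀ E : Set (Fin d → ℝ), MeasurableSet E →
    (∫⁻ x in E, ‖f x‖ₑ) ^ d ≤ ENNReal.ofReal Cs * (∫⁻ x, ‖fderiv ℝ f x‖ₑ) ^ d * volume E := by
  have hdR : (2:ℝ) ≤ d := by exact_mod_cast hd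
  set p := Real.conjExponent d with hp
  have hpq : Real.HolderConjugate (d:ℝ) p := Real.HolderConjugate.conjExponent (by linarith)
  have hp0 : 0 < p := hpq.symm.pos
  set C := lintegralPowLePowLIntegralFDerivConst (volume : Measure (Fin d → ℝ)) p with hC
  refine ⟨((C:ℝ) + 1) ^ d, by positivity, ?_⟩
  intro f hf hfc E hE
  set T := ∫⁻ x, ‖fderiv ℝ f x‖ₑ with hT
  have h1 : ∫⁻ x, ‖f x‖ₑ ^ p ≤ C * T ^ p :=
    lintegral_pow_le_pow_lintegral_fderiv (F := ℝ) volume hf hfc (by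
      rw [Module.finrank_fin_fun]; exact hpq)
  have h2 := ENNReal.lintegral_mul_le_Lp_mul_Lq (volume : Measure (Fin d → ℝ)) hpq.symm
    (f := fun x => ‖f x‖ₑ) (g := E.indicator 1) hf.continuous.enorm.measurable.aemeasurable
    ((measurable_one.indicator hE).aemeasurable)
  have h3 : ∫⁻ a, ((fun x => ‖f x‖ₑ : (Fin d → ℝ) → ℝ≥0∞) * E.indicator (1 : (Fin d → ℝ) → ℝ≥0∞) : (Fin d → ℝ) → ℝ≥0∞) a = ∫⁻ x in E, ‖f x‖ₑ := by
    rw [← lintegral_indicator hE]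
    congr 1; funext x
    by_cases hx : x ∈ E <;> simp [hx]
  have h4 : ∫⁻ a, (E.indicator (1 : (Fin d → ℝ) → ℝ≥0∞) a) ^ (d:ℝ) = volume E := by
    rw [← lintegral_indicator_one hE]
    congr 1; funext x
    by_cases hx : x ∈ E
    · simp [hx]
    · simp [hx]; omega
  rw [h3, h4] at h2
  have h5 : (∫⁻ x, ‖f x‖ₑ ^ p) ^ (1 / p) ≤ (C : ℝ≥0∞) ^ (1 / p) * T := by
    refine (ENNReal.rpow_le_rpow h1 (by positivity)).trans (le_of_eq ?_)
    rw [ENNReal.mul_rpow_of_nonneg _ _ (by positivity), ← ENNReal.rpow_mul, mul_one_div_cancel hp0.ne',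
      ENNReal.rpow_one]
  have h6 : (C : ℝ≥0∞) ^ (1 / p) ≤ ENNReal.ofReal (C + 1) := by
    have a1 : (C : ℝ≥0∞) ≤ ENNReal.ofReal (C + 1) := by
      rw [← ENNReal.ofReal_coe_nnreal]; exact ENNReal.ofReal_le_ofReal (by linarith)
    refine (ENNReal.rpow_le_rpow a1 (by positivity)).trans ?_
    have a2 : 1 ≤ ENNReal.ofReal (C + 1) := by
      rw [ENNReal.one_le_ofReal]; linarith [C.2]
    calc ENNReal.ofReal (C + 1) ^ (1 / p) ≤ ENNReal.ofReal (C + 1) ^ (1:ℝ) :=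
          ENNReal.rpow_le_rpow_of_exponent_le a2 (by
            rw [div_le_one hp0]; exact hpq.symm.lt.le)
      _ = _ := ENNReal.rpow_one _
  have h7 : ∫⁻ x in E, ‖f x‖ₑ ≤ ENNReal.ofReal (C + 1) * T * volume E ^ (1 / (d:ℝ)) :=
    h2.trans (by gcongr; exact h5.trans (by gcongr))
  refine (pow_le_pow_left₀ (zero_le) h7 d).trans (le_of_eq ?_)
  rw [mul_pow, mul_pow, ← ENNReal.ofReal_pow (by positivity)]
  congr 1
  rw [← ENNReal.rpow_natCast, ← ENNReal.rpow_mul, one_div, inv_mul_cancel₀ (by positivity),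
    ENNReal.rpow_one]

/-- real form of the Sobolev inequality -/
lemma sobolev_R {d : ℕ} (hd : 2 ≤ d) : ∃ Cs : ℝ, 0 < Cs ∧ ∀ f : (Fin d → ℝ) → ℝ, ContDiff ℝ 1 f →
    HasCompactSupport f → ∀ E : Set (Fin d → ℝ), MeasurableSet E → volume E ≠ ∞ →
    (∫ x in E, |f x|) ^ d ≤ Cs * (∫ x, ∑ i, |pd d i f x|) ^ d * (volume E).toReal := by
  obtain ⟨Cs, hCs, h⟩ := sobolev_ENN hd
  refine ⟨Cs, hCs, fun f hf hfc E hE hEf => ?_⟩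
  have h1 := h f hf hfc E hE
  have hi : Integrable f := hf.continuous.integrable_of_hasCompactSupport hfc
  have hpi : ∀ i, Integrable (fun x => |pd d i f x|) := fun i =>
    ((continuous_pd hf i).integrable_of_hasCompactSupport
      (hfc.fderiv_apply (𝕜 := ℝ) (Pi.single i 1))).abs
  have hsi : Integrable (fun x => ∑ i, |pd d i f x|) := integrable_finsetSum _ fun i _ => hpi i
  have e1 : ∫⁻ x in E, ‖f x‖ₑ = ENNReal.ofReal (∫ x in E, |f x|) := by
    rw [ofReal_integral_eq_lintegral_ofReal hi.integrableOn.abs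
      (Eventually.of_forall fun x => abs_nonneg _)]
    congr 1; funext x
    rw [← Real.norm_eq_abs, ofReal_norm_eq_enorm]
  have e2 : ∫⁻ x, ‖fderiv ℝ f x‖ₑ ≤ ENNReal.ofReal (∫ x, ∑ i, |pd d i f x|) := by
    rw [ofReal_integral_eq_lintegral_ofReal hsi
      (Eventually.of_forall fun x => Finset.sum_nonneg fun i _ => abs_nonneg _)]
    refine lintegral_mono fun x => ?_
    rw [← ofReal_norm_eq_enorm]
    exact ENNReal.ofReal_le_ofReal (fderiv_norm_le f x)
  have hn : 0 ≤ ∫ x, ∑ i, |pd d i f x| :=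
    integral_nonneg fun x => Finset.sum_nonneg fun i _ => abs_nonneg _
  have hn' : 0 ≤ ∫ x in E, |f x| := integral_nonneg fun x => abs_nonneg _
  rw [e1] at h1
  have h2 : ENNReal.ofReal (∫ x in E, |f x|) ^ d ≤
      ENNReal.ofReal Cs * ENNReal.ofReal (∫ x, ∑ i, |pd d i f x|) ^ d * volume E :=
    h1.trans (by gcongr)
  rw [← ENNReal.ofReal_toReal hEf, ← ENNReal.ofReal_pow hn', ← ENNReal.ofReal_pow hn,
    ← ENNReal.ofReal_mul hCs.le, ← ENNReal.ofReal_mul (by positivity)] at h2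
  exact (ENNReal.ofReal_le_ofReal_iff (by positivity)).1 h2

/-- Euclidean ball -/
def EB (d : ℕ) (b : ℝ) : Set (Fin d → ℝ) := {x | nsq x < b ^ 2}

lemma nsq_nonneg {d : ℕ} (x : Fin d → ℝ) : 0 ≤ nsq x := Finset.sum_nonneg fun i _ => sq_nonneg _

lemma continuous_nsq {d : ℕ} : Continuous (nsq : (Fin d → ℝ) → ℝ) := by
  unfold nsq; fun_prop

lemma EB_meas {d : ℕ} (b : ℝ) : MeasurableSet (EB d b) :=
  (isOpen_lt continuous_nsq continuous_const).measurableSet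

lemma isCompact_nsq {d : ℕ} (b : ℝ) : IsCompact {x : Fin d → ℝ | nsq x ≤ b ^ 2} := by
  refine (isCompact_nE_le |b|).of_isClosed_subset (isClosed_le continuous_nsq continuous_const) ?_
  intro x hx
  have : nE x ^ 2 ≤ |b| ^ 2 := by rw [nE_sq, sq_abs]; exact hx
  exact abs_le_of_sq_le_sq' this (abs_nonneg b) |>.2

lemma EB_sub {d : ℕ} (b : ℝ) : EB d b ⊆ {x : Fin d → ℝ | nsq x ≤ b ^ 2} := fun x hx => by
  have h : nsq x < b ^ 2 := hx
  exact h.le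

lemma EB_fin {d : ℕ} (b : ℝ) : volume (EB d b) ≠ ∞ :=
  ((measure_mono (EB_sub b)).trans_lt (isCompact_nsq b).measure_lt_top).ne

lemma EB_int {d : ℕ} {f : (Fin d → ℝ) → ℝ} (hf : Continuous f) (b : ℝ) : IntegrableOn f (EB d b) :=
  (hf.continuousOn.integrableOn_compact (isCompact_nsq b)).mono_set (EB_sub b)

lemma EB_mono {d : ℕ} {a b : ℝ} (ha : 0 ≤ a) (hab : a ≤ b) : EB d a ⊆ EB d b := fun x hx => by
  have h : nsq x < a ^ 2 := hx
  show nsq x < b ^ 2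
  nlinarith

lemma EB_convex {d : ℕ} (b : ℝ) : Convex ℝ (EB d b) := by
  intro x hx y hy s t hs ht hst
  have hx : nsq x < b ^ 2 := hx
  have hy : nsq y < b ^ 2 := hy
  show nsq (s • x + t • y) < b ^ 2
  have h1 : nsq (s • x + t • y) ≤ s * nsq x + t * nsq y := by
    unfold nsq
    rw [Finset.mul_sum, Finset.mul_sum, ← Finset.sum_add_distrib]
    refine Finset.sum_le_sum fun i _ => ?_
    simp only [Pi.add_apply, Pi.smul_apply, smul_eq_mul]
    have : t = 1 - s := by linarith
    subst this
    nlinarith [mul_nonneg (mul_nonneg hs ht) (sq_nonneg (x i - y i))]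
  refine h1.trans_lt ?_
  rcases hs.lt_or_eq with h | h
  · nlinarith
  · rw [← h] at hst ⊢
    have : t = 1 := by linarith
    rw [this]; linarith

/-- the cutoff -/
noncomputable def cut (d : ℕ) (b : ℝ) (x : Fin d → ℝ) : ℝ := (max (b ^ 2 - nsq x) 0) ^ 2

lemma cut_contDiff {d : ℕ} (b : ℝ) : ContDiff ℝ 1 (cut d b) := by
  have : ContDiff ℝ 1 (fun x : Fin d → ℝ => b ^ 2 - nsq x) := by
    unfold nsq; fun_prop
  exact contDiff_pp2.comp this

lemma cut_pd {d : ℕ} (b : ℝ) (x : Fin d → ℝ) (i : Fin d) :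
    pd d i (cut d b) x = - (4 * x i * max (b ^ 2 - nsq x) 0) := by
  have hd : DifferentiableAt ℝ (fun x : Fin d → ℝ => b ^ 2 - nsq x) x := by
    unfold nsq; fun_prop
  have h1 : pd d i (fun x : Fin d → ℝ => b ^ 2 - nsq x) x = - (2 * x i) := by
    have hp : ∀ k, HasFDerivAt (fun x : Fin d → ℝ => x k ^ 2)
        ((2 * x k) • ContinuousLinearMap.proj (R := ℝ) (φ := fun _ : Fin d => ℝ) k) x := by
      intro k
      have := (hasDerivAt_pow 2 (x k)).comp_hasFDerivAt x (hasFDerivAt_apply (𝕜 := ℝ) k x)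
      refine this.congr_fderiv ?_
      norm_num
    have hs : HasFDerivAt (fun x : Fin d → ℝ => b ^ 2 - nsq x)
        (- ∑ k, (2 * x k) • ContinuousLinearMap.proj (R := ℝ) (φ := fun _ : Fin d => ℝ) k) x :=
      (HasFDerivAt.fun_sum fun k _ => hp k).const_sub _
    unfold pd
    rw [hs.fderiv]
    simp [Pi.single_apply]
  have h2 := pd_comp1 (Φ := fun t : ℝ => (max t 0) ^ 2) (hasDerivAt_pp2 (b ^ 2 - nsq x)) hd i
  unfold cut
  rw [h2, h1]; ring

lemma cut_gradSq {d : ℕ} (b : ℝ) (x : Fin d → ℝ) :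
    gradSq d (cut d b) x = 16 * nsq x * (max (b ^ 2 - nsq x) 0) ^ 2 := by
  unfold gradSq
  simp only [cut_pd]
  have : ∀ i, (-(4 * x i * max (b ^ 2 - nsq x) 0)) ^ 2 = 16 * (max (b ^ 2 - nsq x) 0) ^ 2 * x i ^ 2 :=
    fun i => by ring
  simp only [this, ← Finset.mul_sum]
  unfold nsq; ring

lemma cut_zero {d : ℕ} {b : ℝ} {x : Fin d → ℝ} (h : x ∉ EB d b) : max (b ^ 2 - nsq x) 0 = 0 := by
  have h : ¬ nsq x < b ^ 2 := h
  exact max_eq_right (by linarith)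

lemma cut_cs {d : ℕ} (b : ℝ) : HasCompactSupport (cut d b) := by
  refine HasCompactSupport.intro (isCompact_nsq b) fun x hx => ?_
  unfold cut
  rw [cut_zero (fun h => hx (EB_sub b h))]; norm_num

lemma cut_max {d : ℕ} {b : ℝ} (hb0 : 0 ≤ b) (hb : b ≤ 3) (x : Fin d → ℝ) : 0 ≤ max (b ^ 2 - nsq x) 0 ∧ max (b ^ 2 - nsq x) 0 ≤ 9 := by
  refine ⟨le_max_right _ _, max_le ?_ (by norm_num)⟩
  have := nsq_nonneg x
  nlinarith

lemma cut_le {d : ℕ} {b : ℝ} (hb0 : 0 ≤ b) (hb : b ≤ 3) (x : Fin d → ℝ) : 0 ≤ cut d b x ∧ cut d b x ^ 2 ≤ 11664 := by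
  obtain ⟨h1, h2⟩ := cut_max hb0 hb x
  have h3 : cut d b x ≤ 9 ^ 2 := by unfold cut; gcongr
  have h4 : 0 ≤ cut d b x := by unfold cut; positivity
  refine ⟨h4, ?_⟩
  nlinarith

lemma cut_gle {d : ℕ} {b : ℝ} (hb0 : 0 ≤ b) (hb : b ≤ 3) (x : Fin d → ℝ) : gradSq d (cut d b) x ≤ 11664 := by
  rw [cut_gradSq]
  by_cases hx : x ∈ EB d b
  · obtain ⟨h1, h2⟩ := cut_max hb0 hb x
    have hx : nsq x < b ^ 2 := hx
    have hn : nsq x ≤ 9 := by nlinarith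
    have hn0 := nsq_nonneg x
    have h3 : (max (b ^ 2 - nsq x) 0) ^ 2 ≤ 9 ^ 2 := by gcongr
    calc 16 * nsq x * (max (b ^ 2 - nsq x) 0) ^ 2 ≤ 16 * 9 * 9 ^ 2 := by gcongr
      _ = 11664 := by norm_num
  · rw [cut_zero hx]; norm_num

open MeasureTheory Set Filter Topology
open scoped ENNReal

/-- truncated energy on a ball -/
noncomputable def YY (d : ℕ) (z : (Fin d → ℝ) → ℝ) (b k : ℝ) : ℝ :=
  ∫ x in EB d b, (max (z x - k) 0) ^ 2

lemma YY_nonneg {d : ℕ} (z : (Fin d → ℝ) → ℝ) (b k : ℝ) : 0 ≤ YY d z b k :=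
  integral_nonneg fun x => sq_nonneg _

noncomputable def C0 (d : ℕ) (lam Lam : ℝ) : ℝ :=
  11664 * ((4 / lam) * (2 * (Lam + lam / 4) + 4 * Lam / lam) + d + 1)

lemma C0_pos {d : ℕ} {lam Lam : ℝ} (hlam : 0 < lam) (hLam : 0 < Lam) : 0 < C0 d lam Lam := by
  unfold C0; positivity

lemma trunc_pd_arith {d : ℕ} (e w : ℝ) (hw : 0 ≤ w) (ei zi : Fin d → ℝ) :
    ∑ i, |2 * e * ei i * w ^ 2 + e ^ 2 * (2 * w * zi i)| ≤
      w ^ 2 * (d * e ^ 2 + ∑ i, ei i ^ 2) + e ^ 2 * w * (d + ∑ i, zi i ^ 2) := by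
  have : ∀ i, |2 * e * ei i * w ^ 2 + e ^ 2 * (2 * w * zi i)| ≤
      w ^ 2 * (e ^ 2 + ei i ^ 2) + e ^ 2 * w * (1 + zi i ^ 2) := by
    intro i
    have h1 : |2 * e * ei i * w ^ 2| ≤ w ^ 2 * (e ^ 2 + ei i ^ 2) := by
      rw [show 2 * e * ei i * w ^ 2 = w ^ 2 * (2 * e * ei i) by ring, abs_mul, abs_of_nonneg (sq_nonneg w)]
      refine mul_le_mul_of_nonneg_left (abs_le.2 ⟨?_, ?_⟩) (sq_nonneg w)
      · nlinarith [sq_nonneg (e + ei i)]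
      · nlinarith [sq_nonneg (e - ei i)]
    have h2 : |e ^ 2 * (2 * w * zi i)| ≤ e ^ 2 * w * (1 + zi i ^ 2) := by
      rw [show e ^ 2 * (2 * w * zi i) = e ^ 2 * w * (2 * zi i) by ring, abs_mul,
        abs_of_nonneg (by positivity : 0 ≤ e ^ 2 * w)]
      refine mul_le_mul_of_nonneg_left (abs_le.2 ⟨?_, ?_⟩) (by positivity)
      · nlinarith [sq_nonneg (1 + zi i)]
      · nlinarith [sq_nonneg (1 - zi i)]
    exact (abs_add_le _ _).trans (add_le_add h1 h2)
  refine (Finset.sum_le_sum fun i _ => this i).trans (le_of_eq ?_)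
  rw [Finset.sum_add_distrib, ← Finset.mul_sum, ← Finset.mul_sum, Finset.sum_add_distrib,
    Finset.sum_add_distrib]
  simp

set_option maxHeartbeats 1000000 in
/-- gradient bound for the truncated function -/
lemma grad_trunc {d : ℕ} {lam Lam : ℝ} (hlam : 0 < lam) (hLam : 0 < Lam) {s : (Fin d → ℝ) → ℝ}
    {B : Fin d → (Fin d → ℝ) → ℝ} (W : WF d lam Lam 1 s B) {z : (Fin d → ℝ) → ℝ}
    (hz : z = fun x => - Real.arsinh (s x)) {b : ℝ} (hb0 : 0 ≤ b) (hb3 : b ≤ 3)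
    (hs : ∀ x ∈ EB d b, 1 ≤ s x) (k' : ℝ) :
    ContDiff ℝ 1 (fun x => cut d b x ^ 2 * (max (z x - k') 0) ^ 2) ∧
    HasCompactSupport (fun x => cut d b x ^ 2 * (max (z x - k') 0) ^ 2) ∧
    ∫ x, ∑ i, |pd d i (fun x => cut d b x ^ 2 * (max (z x - k') 0) ^ 2) x| ≤
      C0 d lam Lam * ∫ x in EB d b, (max (z x - k') 0 + (max (z x - k') 0) ^ 2) := by
  have hzC : ContDiff ℝ 1 z := by
    rw [hz]; exact (Real.contDiff_arsinh.comp W.sC).neg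
  have hzd : Differentiable ℝ z := hzC.differentiable (by norm_num)
  set η := cut d b with hη
  have hηC : ContDiff ℝ 1 η := cut_contDiff b
  have hηd : Differentiable ℝ η := hηC.differentiable (by norm_num)
  have hηc : HasCompactSupport η := cut_cs b
  set w := fun x => max (z x - k') 0 with hw
  have hw0 : ∀ x, 0 ≤ w x := fun x => le_max_right _ _
  have hwc : Continuous w := by have := hzC.continuous; simp only [hw]; fun_prop
  have hw2 : ContDiff ℝ 1 (fun x => w x ^ 2) :=
    contDiff_pp2.comp (hzC.sub contDiff_const)
  have hpw : ∀ i x, pd d i (fun x => w x ^ 2) x = 2 * w x * pd d i z x := by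
    intro i x
    have h1 : HasDerivAt (fun t : ℝ => (max (t - k') 0) ^ 2) (2 * max (z x - k') 0) (z x) := by
      have := (hasDerivAt_pp2 (z x - k')).comp (z x) ((hasDerivAt_id' (z x)).sub_const k')
      exact this.congr_deriv (by ring)
    exact pd_comp1 h1 (hzd x) i
  set f := fun x => η x ^ 2 * w x ^ 2 with hf
  have hfC : ContDiff ℝ 1 f := (hηC.pow 2).mul hw2
  have hη2c : HasCompactSupport (fun x => η x ^ 2) :=
    hηc.comp_left (g := fun t : ℝ => t ^ 2) (by norm_num)
  have hfc : HasCompactSupport f := hη2c.mul_right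
  refine ⟨hfC, hfc, ?_⟩
  have hpf : ∀ i x, pd d i f x = 2 * η x * pd d i η x * w x ^ 2 + η x ^ 2 * (2 * w x * pd d i z x) := by
    intro i x
    have d1 : DifferentiableAt ℝ (fun x => η x ^ 2) x := (hηd x).pow 2
    have d2 : DifferentiableAt ℝ (fun x => w x ^ 2) x := hw2.differentiable (by norm_num) x
    have e1 : pd d i (fun x => η x ^ 2) x = 2 * η x * pd d i η x := by
      have := pd_comp1 (Φ := fun t : ℝ => t ^ 2) (hasDerivAt_pow 2 (η x)) (hηd x) i
      rw [this]; norm_num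
    rw [hf, pd_mul d1 d2, hpw, e1]; ring
  have hen := energy hlam hLam W hηC hηc (h := fun t => (max (t - k') 0) ^ 2)
    (h' := fun t => 2 * max (t - k') 0) (fun x hx => hs x (by
      by_contra hx'
      apply hx
      rw [hη]; unfold cut; rw [cut_zero hx']; norm_num)) (fun t => by
      have := (hasDerivAt_pp2 (t - k')).comp t ((hasDerivAt_id' t).sub_const k')
      exact this.congr_deriv (by ring)) (by fun_prop) (fun t => sq_nonneg _)
      (fun t => by positivity) hz
  have hgz : Continuous (gradSq d z) := continuous_gradSq hzC
  have hgη : Continuous (gradSq d η) := continuous_gradSq hηC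
  have hηcont := hηC.continuous
  have hgηc : HasCompactSupport (gradSq d η) := by
    refine HasCompactSupport.intro (isCompact_nsq b) fun x hx => ?_
    rw [hη, cut_gradSq, cut_zero (fun h => hx (EB_sub b h))]; norm_num
  have i1 : Integrable (fun x => η x ^ 2 * (2 * w x + w x ^ 2) * gradSq d z x) :=
    Continuous.integrable_of_hasCompactSupport (by fun_prop) (hη2c.mul_right.mul_right)
  have i2 : Integrable (fun x => w x ^ 2 * (d * η x ^ 2 + gradSq d η x) + d * (η x ^ 2 * w x)) := by
    refine Continuous.integrable_of_hasCompactSupport (by fun_prop) ?_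
    refine HasCompactSupport.add ?_ ?_
    · exact HasCompactSupport.mul_left (HasCompactSupport.add hη2c.mul_left hgηc)
    · exact HasCompactSupport.mul_left hη2c.mul_right
  have i3 : Integrable (fun x => (Lam + lam / 4) * (η x ^ 2 * (2 * w x + w x ^ 2))
        + 4 * Lam / lam * (w x ^ 2 * gradSq d η x)) := by
    refine Continuous.integrable_of_hasCompactSupport (by fun_prop) ?_
    refine HasCompactSupport.add ?_ ?_
    · exact HasCompactSupport.mul_left hη2c.mul_right
    · exact HasCompactSupport.mul_left hgηc.mul_left
  have s1 : ∫ x, ∑ i, |pd d i f x| ≤ (∫ x, η x ^ 2 * (2 * w x + w x ^ 2) * gradSq d z x) +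
      ∫ x, (w x ^ 2 * (d * η x ^ 2 + gradSq d η x) + d * (η x ^ 2 * w x)) := by
    rw [← integral_add i1 i2]
    refine integral_mono_of_nonneg (Eventually.of_forall fun x => Finset.sum_nonneg fun i _ => abs_nonneg _)
      (i1.add i2) (Eventually.of_forall fun x => ?_)
    have h1 := trunc_pd_arith (η x) (w x) (hw0 x) (fun i => pd d i η x) (fun i => pd d i z x)
    simp only [hpf]
    refine h1.trans ?_
    have h2 : 0 ≤ gradSq d z x := gradSq_nonneg x
    have h3 : 0 ≤ η x ^ 2 * w x * gradSq d z x :=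
      mul_nonneg (mul_nonneg (sq_nonneg _) (hw0 x)) h2
    have h4 : 0 ≤ η x ^ 2 * w x ^ 2 * gradSq d z x := by positivity
    have e1 : ∑ i, pd d i η x ^ 2 = gradSq d η x := rfl
    have e2 : ∑ i, pd d i z x ^ 2 = gradSq d z x := rfl
    simp only [e1, e2, Pi.add_apply]
    linarith
  have s2 : ∫ x, η x ^ 2 * (2 * w x + w x ^ 2) * gradSq d z x ≤
      4 / lam * ∫ x, ((Lam + lam / 4) * (η x ^ 2 * (2 * w x + w x ^ 2))
        + 4 * Lam / lam * (w x ^ 2 * gradSq d η x)) := by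
    have := mul_le_mul_of_nonneg_left hen (by positivity : 0 ≤ 4 / lam)
    rw [← mul_assoc, show 4 / lam * (lam / 4) = 1 by field_simp, one_mul] at this
    exact this
  refine s1.trans ((add_le_add s2 le_rfl).trans ?_)
  rw [← integral_const_mul, ← integral_add (i3.const_mul _) i2, ← integral_const_mul,
    ← integral_indicator (EB_meas b)]
  have i4 : Integrable ((EB d b).indicator fun x => C0 d lam Lam * (w x + w x ^ 2)) :=
    (integrable_indicator_iff (EB_meas b)).2 (EB_int (by fun_prop) b)
  refine integral_mono ((i3.const_mul _).add i2) i4 fun x => ?_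
  by_cases hx : x ∈ EB d b
  · rw [indicator_of_mem hx]
    obtain ⟨-, c1⟩ := cut_le hb0 hb3 x
    have c2 := cut_gle hb0 hb3 x
    rw [← hη] at c1 c2
    have hwx := hw0 x
    have g0 : 0 ≤ gradSq d η x := gradSq_nonneg x
    show 4 / lam * ((Lam + lam / 4) * (η x ^ 2 * (2 * w x + w x ^ 2))
        + 4 * Lam / lam * (w x ^ 2 * gradSq d η x)) +
        (w x ^ 2 * (d * η x ^ 2 + gradSq d η x) + d * (η x ^ 2 * w x)) ≤ _
    have q1 : 4 / lam * ((Lam + lam / 4) * (η x ^ 2 * (2 * w x + w x ^ 2))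
        + 4 * Lam / lam * (w x ^ 2 * gradSq d η x)) ≤
        4 / lam * ((Lam + lam / 4) * (11664 * (2 * (w x + w x ^ 2)))
        + 4 * Lam / lam * ((w x + w x ^ 2) * 11664)) := by
      have : 2 * w x + w x ^ 2 ≤ 2 * (w x + w x ^ 2) := by nlinarith
      have : w x ^ 2 ≤ w x + w x ^ 2 := by linarith
      gcongr
    have q2 : w x ^ 2 * (d * η x ^ 2 + gradSq d η x) ≤ w x ^ 2 * (d * 11664 + 11664) := by gcongr
    have q3 : d * (η x ^ 2 * w x) ≤ d * (11664 * w x) := by gcongr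
    refine (add_le_add q1 (add_le_add q2 q3)).trans ?_
    unfold C0
    have : 0 ≤ 11664 * w x := by positivity
    linarith
  · rw [indicator_of_notMem hx]
    have h1 : η x = 0 := by rw [hη]; unfold cut; rw [cut_zero hx]; norm_num
    have h2 : gradSq d η x = 0 := by rw [hη, cut_gradSq, cut_zero hx]; norm_num
    simp [h1, h2]

open MeasureTheory Set Filter Topology
open scoped ENNReal

/-- the Sobolev inequality in the form used below -/
def SobC (d : ℕ) (Cs : ℝ) : Prop := ∀ f : (Fin d → ℝ) → ℝ, ContDiff ℝ 1 f →
    HasCompactSupport f → ∀ E : Set (Fin d → ℝ), MeasurableSet E → volume E ≠ ∞ →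
    (∫ x in E, |f x|) ^ d ≤ Cs * (∫ x, ∑ i, |pd d i f x|) ^ d * (volume E).toReal

set_option maxHeartbeats 1000000 in
lemma dg_step {d : ℕ} {lam Lam Cs : ℝ} (hlam : 0 < lam) (hLam : 0 < Lam) (hCs : 0 < Cs)
    (hS : SobC d Cs) {s : (Fin d → ℝ) → ℝ}
    {B : Fin d → (Fin d → ℝ) → ℝ} (W : WF d lam Lam 1 s B) {z : (Fin d → ℝ) → ℝ}
    (hz : z = fun x => - Real.arsinh (s x)) {a b : ℝ} (ha0 : 0 ≤ a) (hab : a < b) (hb3 : b ≤ 3)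
    (hs : ∀ x ∈ EB d b, 1 ≤ s x) (k δ : ℝ) (hδ : 0 < δ) :
    ((b ^ 2 - a ^ 2) ^ 4 * YY d z a (k + δ)) ^ d ≤
      Cs * (C0 d lam Lam * ((1 + 1 / δ) * YY d z b k)) ^ d * (YY d z b k / δ ^ 2) := by
  obtain ⟨f1, f2, f3⟩ := grad_trunc hlam hLam W hz (ha0.trans hab.le) hb3 hs (k + δ)
  have hzc : Continuous z := by
    rw [hz]; exact (Real.contDiff_arsinh.comp (n := 1) W.sC).neg.continuous
  set w := fun x => max (z x - (k + δ)) 0 with hw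
  set v := fun x => max (z x - k) 0 with hv
  have hw0 : ∀ x, 0 ≤ w x := fun x => le_max_right _ _
  have hv0 : ∀ x, 0 ≤ v x := fun x => le_max_right _ _
  have hwc : Continuous w := by simp only [hw]; fun_prop
  have hvc : Continuous v := by simp only [hv]; fun_prop
  set f := fun x => cut d b x ^ 2 * w x ^ 2 with hf
  set E := EB d b ∩ {x | k + δ < z x} with hE
  have hEm : MeasurableSet E := (EB_meas b).inter (isOpen_lt continuous_const hzc).measurableSet
  have hEf : volume E ≠ ∞ := ((measure_mono inter_subset_left).trans_lt (EB_fin b).lt_top).ne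
  have hYb : YY d z b k = ∫ x in EB d b, v x ^ 2 := rfl
  have hYa : YY d z a (k + δ) = ∫ x in EB d a, w x ^ 2 := rfl
  have hvE : ∀ x, k + δ < z x → δ ≤ v x := fun x hx => le_max_of_le_left (by linarith)
  have hwv : ∀ x, w x + w x ^ 2 ≤ (1 + 1 / δ) * v x ^ 2 := by
    intro x
    by_cases hx : k + δ < z x
    · have h1 := hvE x hx
      have h2 : w x ≤ v x := max_le_max (by linarith) le_rfl
      have h3 : w x ^ 2 ≤ v x ^ 2 := pow_le_pow_left₀ (hw0 x) h2 2
      have h4 : v x ≤ 1 / δ * v x ^ 2 := by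
        rw [one_div, inv_mul_eq_div, le_div_iff₀ hδ]
        nlinarith [hv0 x]
      linarith
    · have : w x = 0 := max_eq_right (by linarith)
      rw [this]
      have := hv0 x
      have : 0 ≤ (1 + 1 / δ) * v x ^ 2 := by positivity
      simpa using this
  have h1 : ∫ x, ∑ i, |pd d i f x| ≤ C0 d lam Lam * ((1 + 1 / δ) * YY d z b k) := by
    refine f3.trans (mul_le_mul_of_nonneg_left ?_ (C0_pos hlam hLam).le)
    rw [hYb, ← integral_const_mul]
    exact integral_mono (EB_int (by fun_prop) b) (EB_int (by fun_prop) b) fun x => hwv x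
  have h2 : (volume E).toReal ≤ YY d z b k / δ ^ 2 := by
    rw [le_div_iff₀ (by positivity)]
    have e1 : (volume E).toReal * δ ^ 2 = ∫ x in E, δ ^ 2 := by
      rw [setIntegral_const]; simp [Measure.real]
    rw [e1, hYb]
    calc ∫ x in E, δ ^ 2 ≤ ∫ x in E, v x ^ 2 := by
          refine setIntegral_mono_on (integrableOn_const hEf) ((EB_int (by fun_prop) b).mono_set inter_subset_left) hEm fun x hx => ?_
          exact pow_le_pow_left₀ hδ.le (hvE x hx.2) 2
      _ ≤ ∫ x in EB d b, v x ^ 2 := setIntegral_mono_set (EB_int (by fun_prop) b)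
          (Eventually.of_forall fun x => sq_nonneg _) (Eventually.of_forall inter_subset_left)
  have hfc : Continuous f := f1.continuous
  have hf0 : ∀ x, 0 ≤ f x := fun x => by simp only [hf]; positivity
  have h3 : (b ^ 2 - a ^ 2) ^ 4 * YY d z a (k + δ) ≤ ∫ x in E, |f x| := by
    have e1 : ∫ x in E, |f x| = ∫ x in EB d b, |f x| := by
      refine (setIntegral_eq_of_subset_of_forall_sdiff_eq_zero (EB_meas b) inter_subset_left fun x hx => ?_).symm
      have : w x = 0 := max_eq_right (by
        by_contra h
        exact hx.2 ⟨hx.1, by show k + δ < z x; linarith⟩)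
      simp [hf, this]
    rw [e1, hYa, ← integral_const_mul]
    calc ∫ x in EB d a, (b ^ 2 - a ^ 2) ^ 4 * w x ^ 2 ≤ ∫ x in EB d a, |f x| := by
          refine setIntegral_mono_on (EB_int (by fun_prop) a) (EB_int (by fun_prop) a) (EB_meas a) fun x hx => ?_
          rw [abs_of_nonneg (hf0 x)]
          refine mul_le_mul_of_nonneg_right ?_ (sq_nonneg _)
          have hx : nsq x < a ^ 2 := hx
          have hba : 0 ≤ b ^ 2 - a ^ 2 := by nlinarith
          have q1 : b ^ 2 - a ^ 2 ≤ max (b ^ 2 - nsq x) 0 := le_max_of_le_left (by linarith)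
          unfold cut
          rw [← pow_mul]
          exact pow_le_pow_left₀ hba q1 4
      _ ≤ ∫ x in EB d b, |f x| := setIntegral_mono_set (EB_int (by fun_prop) b)
          (Eventually.of_forall fun x => abs_nonneg _) (Eventually.of_forall (EB_mono ha0 hab.le))
  have hba : 0 ≤ b ^ 2 - a ^ 2 := by nlinarith
  have hY0 := YY_nonneg z a (k + δ)
  refine (pow_le_pow_left₀ (by positivity) h3 d).trans ((hS f f1 f2 E hEm hEf).trans ?_)
  have : 0 ≤ ∫ x, ∑ i, |pd d i f x| := integral_nonneg fun x => Finset.sum_nonneg fun i _ => abs_nonneg _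
  have hY1 := YY_nonneg z b k
  have hC := C0_pos (d := d) hlam hLam
  gcongr

/-- numerical iteration lemma -/
lemma dg_iter {d : ℕ} (hd : 1 ≤ d) {A K Y : ℝ} (hA : 0 < A) (hK : 1 ≤ K) (hY : 0 ≤ Y) {y : ℕ → ℝ}
    (hy0 : ∀ j, 0 ≤ y j) (h0 : y 0 ≤ Y)
    (hy : ∀ j, ((1 / 16) ^ j * y (j + 1)) ^ d ≤ A * (4 * 2 ^ j * y j) ^ d * (y j * (4 * 4 ^ j) / K ^ 2))
    (hAK : A * 4 ^ d * 4 * Y * (128 ^ d) ^ d ≤ K ^ 2) (j : ℕ) :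
    y j ≤ Y * ((1 / 128 : ℝ) ^ d) ^ j := by
  set σ : ℝ := (1 / 128 : ℝ) ^ d with hσ
  have hσ0 : 0 < σ := by positivity
  induction j with
  | zero => simpa using h0
  | succ j ih =>
    have h1 := hy j
    have hj0 := hy0 j
    have hT : 0 ≤ Y * σ ^ j := by positivity
    have h2 : A * (4 * 2 ^ j * y j) ^ d * (y j * (4 * 4 ^ j) / K ^ 2) ≤
        A * (4 * 2 ^ j * (Y * σ ^ j)) ^ d * ((Y * σ ^ j) * (4 * 4 ^ j) / K ^ 2) := by gcongr
    have h3 : A * (4 * 2 ^ j * (Y * σ ^ j)) ^ d * ((Y * σ ^ j) * (4 * 4 ^ j) / K ^ 2) =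
        (A * 4 ^ d * 4 * Y / K ^ 2) * ((2 ^ d * 4 * σ) ^ j) * (Y * σ ^ j) ^ d := by
      rw [mul_pow (4 * 2 ^ j), mul_pow (4:ℝ), mul_pow _ σ, mul_pow _ (4:ℝ), ← pow_mul 2 j d, ← pow_mul 2 d j,
        mul_comm d j]
      ring
    have h4 : A * 4 ^ d * 4 * Y / K ^ 2 ≤ σ ^ d := by
      rw [div_le_iff₀ (by positivity), hσ]
      have : ((1 / 128 : ℝ) ^ d) ^ d * (128 ^ d) ^ d = 1 := by
        rw [← mul_pow, ← mul_pow]; norm_num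
      calc A * 4 ^ d * 4 * Y = ((1 / 128 : ℝ) ^ d) ^ d * (A * 4 ^ d * 4 * Y * (128 ^ d) ^ d) := by
            linear_combination (-(A * 4 ^ d * 4 * Y)) * this
        _ ≤ _ := mul_le_mul_of_nonneg_left hAK (by positivity)
    have h5 : (16 ^ d * (2 ^ d * 4 * σ)) ≤ 1 := by
      have : (4:ℝ) ≤ 4 ^ d := le_self_pow₀ (by norm_num) (by omega)
      calc 16 ^ d * (2 ^ d * 4 * σ) ≤ 16 ^ d * (2 ^ d * 4 ^ d * σ) := by gcongr
        _ = 1 := by rw [hσ, ← mul_pow, ← mul_pow, ← mul_pow]; norm_num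
    have h6 : y (j + 1) ^ d = (16 ^ d) ^ j * ((1 / 16) ^ j * y (j + 1)) ^ d := by
      rw [← pow_mul, mul_comm d j, pow_mul, ← mul_pow, ← mul_assoc, ← mul_pow]; norm_num
    have h7 : y (j + 1) ^ d ≤ (Y * σ ^ (j + 1)) ^ d := by
      calc y (j + 1) ^ d ≤ (16 ^ d) ^ j * ((A * 4 ^ d * 4 * Y / K ^ 2) * ((2 ^ d * 4 * σ) ^ j) * (Y * σ ^ j) ^ d) := by
            rw [h6, ← h3]
            exact mul_le_mul_of_nonneg_left (h1.trans h2) (by positivity)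
        _ = (A * 4 ^ d * 4 * Y / K ^ 2) * ((16 ^ d * (2 ^ d * 4 * σ)) ^ j) * (Y * σ ^ j) ^ d := by
            rw [mul_pow ((16:ℝ) ^ d)]; ring
        _ ≤ σ ^ d * 1 * (Y * σ ^ j) ^ d := by
            gcongr
            exact pow_le_one₀ (by positivity) h5
        _ = (Y * σ ^ (j + 1)) ^ d := by rw [mul_one, ← mul_pow]; congr 1; ring
    exact (pow_le_pow_iff_left₀ (hy0 _) (by positivity) (by omega)).1 h7

set_option maxHeartbeats 1000000 in
theorem dg_sup {d : ℕ} (hd : 1 ≤ d) {lam Lam Cs : ℝ} (hlam : 0 < lam) (hLam : 0 < Lam) (hCs : 0 < Cs)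
    (hS : SobC d Cs) {s : (Fin d → ℝ) → ℝ}
    {B : Fin d → (Fin d → ℝ) → ℝ} (W : WF d lam Lam 1 s B) {z : (Fin d → ℝ) → ℝ}
    (hz : z = fun x => - Real.arsinh (s x))
    (hs : ∀ x ∈ EB d 2, 1 ≤ s x) (k0 K Y : ℝ) (hK : 1 ≤ K) (hY : YY d z 2 k0 ≤ Y)
    (hAK : Cs * C0 d lam Lam ^ d * 4 ^ d * 4 * Y * (128 ^ d) ^ d ≤ K ^ 2) :
    ∀ x ∈ EB d 1, z x ≤ k0 + K := by
  have hzc : Continuous z := by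
    rw [hz]; exact (Real.contDiff_arsinh.comp (n := 1) W.sC).neg.continuous
  have hC := C0_pos (d := d) hlam hLam
  have hY0 : 0 ≤ Y := (YY_nonneg _ _ _).trans hY
  set q : ℕ → ℝ := fun j => (1 / 2 : ℝ) ^ j with hq
  have q0 : ∀ j, 0 < q j := fun j => by simp only [hq]; positivity
  have q1 : ∀ j, q j ≤ 1 := fun j => pow_le_one₀ (by norm_num) (by norm_num)
  have qs : ∀ j, q (j + 1) = q j / 2 := fun j => by simp only [hq, pow_succ]; ring
  set y : ℕ → ℝ := fun j => YY d z (1 + q j) (k0 + K * (1 - q j)) with hy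
  have hit := dg_iter hd (A := Cs * C0 d lam Lam ^ d) (K := K) (Y := Y) (y := y) (by positivity) hK hY0
    (fun j => YY_nonneg _ _ _) (by
      have : y 0 = YY d z 2 k0 := by simp only [hy, hq]; norm_num
      rw [this]; exact hY) (fun j => by
      have hst := dg_step hlam hLam hCs hS W hz (a := 1 + q (j + 1)) (b := 1 + q j)
        (by linarith [q0 (j + 1)]) (by rw [qs]; linarith [q0 j]) (by linarith [q1 j])
        (fun x hx => hs x (EB_mono (by linarith [q0 j]) (by linarith [q1 j]) hx))
        (k0 + K * (1 - q j)) (K * q (j + 1)) (by have := q0 (j + 1); positivity)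
      have e1 : k0 + K * (1 - q j) + K * q (j + 1) = k0 + K * (1 - q (j + 1)) := by rw [qs]; ring
      rw [e1] at hst
      have e2 : YY d z (1 + q (j + 1)) (k0 + K * (1 - q (j + 1))) = y (j + 1) := rfl
      have e3 : YY d z (1 + q j) (k0 + K * (1 - q j)) = y j := rfl
      rw [e2, e3] at hst
      have hyj : 0 ≤ y j := YY_nonneg _ _ _
      have hyj1 : 0 ≤ y (j + 1) := YY_nonneg _ _ _
      have r1 : (1 / 16 : ℝ) ^ j ≤ ((1 + q j) ^ 2 - (1 + q (j + 1)) ^ 2) ^ 4 := by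
        have : (1 / 16 : ℝ) ^ j = q j ^ 4 := by
          simp only [hq]; rw [← pow_mul, mul_comm, pow_mul]; norm_num
        rw [this]
        have := q0 j
        refine pow_le_pow_left₀ this.le ?_ 4
        rw [qs]; nlinarith
      have qi : 1 / q j = 2 ^ j := by simp only [hq]; simp
      have r2 : 1 + 1 / (K * q (j + 1)) ≤ 4 * 2 ^ j := by
        have h2 : 1 / (K * q (j + 1)) ≤ 2 * 2 ^ j := by
          rw [← qi, qs, div_le_iff₀ (by have := q0 j; positivity)]
          have := (q0 j).ne'
          field_simp
          linarith
        have : (1:ℝ) ≤ 2 ^ j := one_le_pow₀ (by norm_num)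
        linarith
      have r3 : y j / (K * q (j + 1)) ^ 2 = y j * (4 * 4 ^ j) / K ^ 2 := by
        have : (4:ℝ) ^ j = (1 / q j) ^ 2 := by rw [qi, ← pow_mul, mul_comm, pow_mul]; norm_num
        rw [this, qs]
        have := (q0 j).ne'
        field_simp
        norm_num
      rw [r3] at hst
      calc ((1 / 16) ^ j * y (j + 1)) ^ d ≤ (((1 + q j) ^ 2 - (1 + q (j + 1)) ^ 2) ^ 4 * y (j + 1)) ^ d := by
            gcongr
        _ ≤ _ := hst
        _ ≤ Cs * (C0 d lam Lam * (4 * 2 ^ j * y j)) ^ d * (y j * (4 * 4 ^ j) / K ^ 2) := by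
            have : 0 ≤ 1 + 1 / (K * q (j + 1)) := by have := q0 (j + 1); positivity
            gcongr
        _ = _ := by rw [mul_pow (C0 d lam Lam)]; ring) hAK
  have hle : ∀ j, YY d z 1 (k0 + K) ≤ Y * ((1 / 128 : ℝ) ^ d) ^ j := by
    intro j
    refine le_trans ?_ (hit j)
    simp only [hy]
    unfold YY
    calc ∫ x in EB d 1, (max (z x - (k0 + K)) 0) ^ 2 ≤ ∫ x in EB d 1, (max (z x - (k0 + K * (1 - q j))) 0) ^ 2 := by
          refine integral_mono (EB_int (by fun_prop) 1) (EB_int (by fun_prop) 1) fun x => ?_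
          refine pow_le_pow_left₀ (le_max_right _ _) (max_le_max ?_ le_rfl) 2
          nlinarith [q0 j]
      _ ≤ _ := setIntegral_mono_set (EB_int (by fun_prop) _)
          (Eventually.of_forall fun x => sq_nonneg _)
          (Eventually.of_forall (EB_mono (by norm_num) (by linarith [q0 j])))
  have hz0 : YY d z 1 (k0 + K) = 0 := by
    have ht : Tendsto (fun j : ℕ => Y * ((1 / 128 : ℝ) ^ d) ^ j) atTop (𝓝 (Y * 0)) :=
      (tendsto_pow_atTop_nhds_zero_of_lt_one (by positivity)
        (pow_lt_one₀ (by norm_num) (by norm_num) (by omega))).const_mul Y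
    have := ge_of_tendsto' ht hle
    rw [mul_zero] at this
    exact le_antisymm this (YY_nonneg _ _ _)
  have hpc : Continuous (fun x => (max (z x - (k0 + K)) 0) ^ 2) := by fun_prop
  unfold YY at hz0
  rw [integral_eq_zero_iff_of_nonneg (fun x => sq_nonneg _) (EB_int hpc 1)] at hz0
  have ho : IsOpen (EB d 1) := isOpen_lt continuous_nsq continuous_const
  have heq := Measure.eqOn_open_of_ae_eq hz0 ho hpc.continuousOn continuousOn_const
  intro x hx
  have h1 := heq hx
  simp only [Pi.zero_apply] at h1
  have h2 := pow_eq_zero_iff (two_ne_zero) |>.1 h1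
  have h3 : z x - (k0 + K) ≤ 0 := by rw [← h2]; exact le_max_left _ _
  linarith

open MeasureTheory Set Filter Topology
open scoped ENNReal

set_option maxHeartbeats 1000000 in
lemma grad_bound {d : ℕ} {lam Lam : ℝ} (hlam : 0 < lam) (hLam : 0 < Lam) {s : (Fin d → ℝ) → ℝ}
    {B : Fin d → (Fin d → ℝ) → ℝ} (W : WF d lam Lam 1 s B) {z : (Fin d → ℝ) → ℝ}
    (hz : z = fun x => - Real.arsinh (s x)) (hs : ∀ x ∈ EB d 3, 1 ≤ s x) :
    ∫ x in EB d 2, gradSq d z x ≤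
      4 / lam * ((11664 * (Lam + lam / 4) + 4 * Lam / lam * 11664) * (volume (EB d 3)).toReal) := by
  have hzC : ContDiff ℝ 1 z := by
    rw [hz]; exact (Real.contDiff_arsinh.comp W.sC).neg
  set η := cut d 3 with hη
  have hηC : ContDiff ℝ 1 η := cut_contDiff 3
  have hηc : HasCompactSupport η := cut_cs 3
  have hen := energy hlam hLam W hηC hηc (h := fun _ => 1)
    (h' := fun _ => 0) (fun x hx => hs x (by
      by_contra hx'
      apply hx
      rw [hη]; unfold cut; rw [cut_zero hx']; norm_num)) (fun t => hasDerivAt_const t 1)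
      (by fun_prop) (fun t => by norm_num) (fun t => le_rfl) hz
  simp only [zero_add, mul_one, one_mul] at hen
  have hgz : Continuous (gradSq d z) := continuous_gradSq hzC
  have hgη : Continuous (gradSq d η) := continuous_gradSq hηC
  have hηcont := hηC.continuous
  have hη2c : HasCompactSupport (fun x => η x ^ 2) :=
    hηc.comp_left (g := fun t : ℝ => t ^ 2) (by norm_num)
  have hgηc : HasCompactSupport (gradSq d η) := by
    refine HasCompactSupport.intro (isCompact_nsq 3) fun x hx => ?_
    rw [hη, cut_gradSq, cut_zero (fun h => hx (EB_sub 3 h))]; norm_num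
  have i1 : Integrable (fun x => η x ^ 2 * gradSq d z x) :=
    Continuous.integrable_of_hasCompactSupport (by fun_prop) (hη2c.mul_right)
  have i3 : Integrable (fun x => (Lam + lam / 4) * η x ^ 2
        + 4 * Lam / lam * gradSq d η x) := by
    refine Continuous.integrable_of_hasCompactSupport (by fun_prop) ?_
    exact HasCompactSupport.add (HasCompactSupport.mul_left hη2c) (HasCompactSupport.mul_left hgηc)
  have h1 : ∫ x in EB d 2, gradSq d z x ≤ ∫ x, η x ^ 2 * gradSq d z x := by
    calc ∫ x in EB d 2, gradSq d z x ≤ ∫ x in EB d 2, η x ^ 2 * gradSq d z x := by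
          refine setIntegral_mono_on (EB_int hgz 2) i1.integrableOn (EB_meas 2) fun x hx => ?_
          have hx : nsq x < 2 ^ 2 := hx
          have h0 : 0 ≤ gradSq d z x := gradSq_nonneg x
          have q1 : 1 ≤ max ((3:ℝ) ^ 2 - nsq x) 0 := le_max_of_le_left (by linarith)
          have q2 : 1 ≤ η x ^ 2 := by
            rw [hη]; unfold cut
            exact one_le_pow₀ (one_le_pow₀ q1)
          nlinarith
      _ ≤ _ := setIntegral_le_integral i1 (Eventually.of_forall fun x =>
          mul_nonneg (sq_nonneg _) (gradSq_nonneg x))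
  have h2 : ∫ x, ((Lam + lam / 4) * η x ^ 2 + 4 * Lam / lam * gradSq d η x) ≤
      (11664 * (Lam + lam / 4) + 4 * Lam / lam * 11664) * (volume (EB d 3)).toReal := by
    have i4 : Integrable ((EB d 3).indicator fun _ => 11664 * (Lam + lam / 4) + 4 * Lam / lam * 11664) :=
      (integrable_indicator_iff (EB_meas 3)).2 (integrableOn_const (EB_fin 3))
    have e1 : (11664 * (Lam + lam / 4) + 4 * Lam / lam * 11664) * (volume (EB d 3)).toReal =
        ∫ x, (EB d 3).indicator (fun _ => 11664 * (Lam + lam / 4) + 4 * Lam / lam * 11664) x := by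
      rw [integral_indicator (EB_meas 3), setIntegral_const]
      simp [Measure.real, mul_comm]
    rw [e1]
    refine integral_mono i3 i4 fun x => ?_
    by_cases hx : x ∈ EB d 3
    · rw [indicator_of_mem hx]
      obtain ⟨-, c1⟩ := cut_le (b := 3) (by norm_num) le_rfl x
      have c2 := cut_gle (b := 3) (by norm_num) le_rfl x
      rw [← hη] at c1 c2
      show (Lam + lam / 4) * η x ^ 2 + 4 * Lam / lam * gradSq d η x ≤ _
      rw [mul_comm (11664:ℝ)]
      gcongr
    · rw [indicator_of_notMem hx]
      have h1 : η x = 0 := by rw [hη]; unfold cut; rw [cut_zero hx]; norm_num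
      have h2 : gradSq d η x = 0 := by rw [hη, cut_gradSq, cut_zero hx]; norm_num
      simp [h1, h2]
  have h3 := mul_le_mul_of_nonneg_left (hen.trans h2) (by positivity : 0 ≤ 4 / lam)
  rw [← mul_assoc, show 4 / lam * (lam / 4) = 1 by field_simp, one_mul] at h3
  exact h1.trans h3

lemma EB_pos {d : ℕ} {b : ℝ} (hb : 0 < b) : 0 < volume (EB d b) := by
  refine (isOpen_lt continuous_nsq continuous_const).measure_pos volume ⟨0, ?_⟩
  show nsq (0 : Fin d → ℝ) < b ^ 2
  unfold nsq; simp; positivity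

set_option maxHeartbeats 1000000 in
/-- weak Harnack type lower bound -/
theorem dg_lower {d : ℕ} (hd : 2 ≤ d) {lam Lam : ℝ} (hlam : 0 < lam) (hLam : 0 < Lam) :
    ∃ K : ℝ, 1 ≤ K ∧ ∀ (s : (Fin d → ℝ) → ℝ) (B : Fin d → (Fin d → ℝ) → ℝ), WF d lam Lam 1 s B →
      (∀ x ∈ EB d 3, 1 ≤ s x) → ∀ M : ℝ, volume (EB d 2) ≤ 2 * volume (EB d 2 ∩ {x | M ≤ s x}) →
      ∀ x ∈ EB d 1, Real.arsinh M - K ≤ Real.arsinh (s x) := by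
  obtain ⟨Cs, hCs, hS⟩ := sobolev_R hd
  set G := 4 / lam * ((11664 * (Lam + lam / 4) + 4 * Lam / lam * 11664) * (volume (EB d 3)).toReal) with hG
  have hG0 : 0 ≤ G := by rw [hG]; positivity
  set Y := 32 * 2 ^ d * G with hY
  have hY0 : 0 ≤ Y := by rw [hY]; positivity
  have hC := C0_pos (d := d) hlam hLam
  set T := Cs * C0 d lam Lam ^ d * 4 ^ d * 4 * Y * (128 ^ d) ^ d with hT
  have hT0 : 0 ≤ T := by rw [hT]; positivity
  refine ⟨1 + T, by linarith, fun s B W hs M hM x hx => ?_⟩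
  set z : (Fin d → ℝ) → ℝ := fun x => - Real.arsinh (s x) with hz
  have hzC : ContDiff ℝ 1 z := by
    rw [hz]; exact (Real.contDiff_arsinh.comp W.sC).neg
  have hgz : Continuous (gradSq d z) := continuous_gradSq hzC
  have hzc := hzC.continuous
  have hgb := grad_bound hlam hLam W hz hs
  rw [← hG] at hgb
  set A := EB d 2 ∩ {x | M ≤ s x} with hA
  have hAm : MeasurableSet A := (EB_meas 2).inter
    (isClosed_le continuous_const W.sC.continuous).measurableSet
  have hp := poincare hzC (EB_convex 2) (EB_meas 2) (D := 16) (by norm_num) (fun x hx y hy => by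
    have hx : nsq x < 2 ^ 2 := hx
    have hy : nsq y < 2 ^ 2 := hy
    have : nsq (x - y) ≤ 2 * nsq x + 2 * nsq y := by
      unfold nsq
      rw [Finset.mul_sum, Finset.mul_sum, ← Finset.sum_add_distrib]
      refine Finset.sum_le_sum fun i _ => ?_
      simp only [Pi.sub_apply]
      nlinarith [sq_nonneg (x i + y i)]
    linarith) (A := A) inter_subset_left hAm (k0 := - Real.arsinh M) (fun y hy => by
      have : Real.arsinh M ≤ Real.arsinh (s y) := Real.arsinh_le_arsinh.2 hy.2
      simp only [hz]; linarith)
  have hYY : YY d z 2 (- Real.arsinh M) ≤ Y := by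
    have e1 : ∫⁻ x in EB d 2, ENNReal.ofReal ((max (z x - - Real.arsinh M) 0) ^ 2) =
        ENNReal.ofReal (YY d z 2 (- Real.arsinh M)) := by
      unfold YY
      rw [ofReal_integral_eq_lintegral_ofReal (EB_int (by fun_prop) 2)
        (Eventually.of_forall fun x => sq_nonneg _)]
    have e2 : ∫⁻ x in EB d 2, ENNReal.ofReal (gradSq d z x) =
        ENNReal.ofReal (∫ x in EB d 2, gradSq d z x) := by
      rw [ofReal_integral_eq_lintegral_ofReal (EB_int hgz 2)
        (Eventually.of_forall fun x => gradSq_nonneg x)]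
    rw [e1, e2] at hp
    set I := ∫ x in EB d 2, gradSq d z x with hI
    have hI0 : 0 ≤ I := integral_nonneg fun x => gradSq_nonneg x
    have hAf : volume A ≠ ∞ := ((measure_mono inter_subset_left).trans_lt (EB_fin 2).lt_top).ne
    have hp2 := ENNReal.toReal_mono (by
      refine ENNReal.mul_ne_top ENNReal.ofReal_ne_top (ENNReal.mul_ne_top (EB_fin 2)
        (ENNReal.mul_ne_top (by simp) ENNReal.ofReal_ne_top))) hp
    rw [ENNReal.toReal_mul, ENNReal.toReal_mul, ENNReal.toReal_mul, ENNReal.toReal_mul,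
      ENNReal.toReal_ofReal (YY_nonneg _ _ _), ENNReal.toReal_ofReal hI0,
      ENNReal.toReal_ofReal (by norm_num), ENNReal.toReal_pow] at hp2
    have hM2 := ENNReal.toReal_mono (ENNReal.mul_ne_top (by simp) hAf) hM
    rw [ENNReal.toReal_mul] at hM2
    simp only [ENNReal.toReal_ofNat] at hp2 hM2
    have hv : 0 < (volume (EB d 2)).toReal := ENNReal.toReal_pos (EB_pos (by norm_num)).ne' (EB_fin 2)
    have hYn := YY_nonneg z 2 (- Real.arsinh M)
    set y := YY d z 2 (- Real.arsinh M)
    set v := (volume (EB d 2)).toReal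
    have h3 : v * y ≤ v * (32 * 2 ^ d * I) := by
      have := mul_le_mul_of_nonneg_right hM2 hYn
      linarith
    have h4 := le_of_mul_le_mul_left h3 hv
    refine h4.trans ?_
    rw [hY]
    exact mul_le_mul_of_nonneg_left hgb (by positivity)
  have hfin := dg_sup (by omega) hlam hLam hCs hS W hz
    (fun x hx => hs x (EB_mono (by norm_num) (by norm_num) hx)) (- Real.arsinh M) (1 + T) Y
    (by linarith) hYY (by rw [← hT]; nlinarith) x hx
  simp only [hz] at hfin
  linarith

open MeasureTheory Set Filter Topology
open scoped ENNReal

lemma pd_affine {d : ℕ} {v : (Fin d → ℝ) → ℝ} (hv : Differentiable ℝ v) (x0 : Fin d → ℝ) (r a c : ℝ)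
    (i : Fin d) (x : Fin d → ℝ) :
    pd d i (fun x => a * v (x0 + r • x) + c) x = a * r * pd d i v (x0 + r • x) := by
  have h1 : HasFDerivAt (fun x : Fin d → ℝ => x0 + r • x) (r • ContinuousLinearMap.id ℝ (Fin d → ℝ)) x :=
    ((hasFDerivAt_id x).const_smul r).const_add x0
  have h2 := (((hv (x0 + r • x)).hasFDerivAt.comp x h1).const_mul a).add_const c
  unfold pd
  have h3 := h2.fderiv
  simp only [Function.comp_def] at h3
  rw [h3]
  simp [mul_assoc]

lemma WF_scale {d : ℕ} {lam Lam F : ℝ} (hF : 0 < F) {v : (Fin d → ℝ) → ℝ}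
    {B : Fin d → (Fin d → ℝ) → ℝ} (W : WF d lam Lam F v B) (x0 : Fin d → ℝ) {r : ℝ} (hr : 0 < r)
    {σ : ℝ} (hσ : σ ^ 2 = 1) (c : ℝ) :
    WF d lam Lam 1 (fun x => σ / (r * F) * v (x0 + r • x) + c) (fun i x => σ / F * B i (x0 + r • x)) := by
  have hvd : Differentiable ℝ v := W.sC.differentiable (by norm_num)
  have hp : ∀ i x, pd d i (fun x => σ / (r * F) * v (x0 + r • x) + c) x = σ / F * pd d i v (x0 + r • x) := by
    intro i x
    rw [pd_affine hvd]
    congr 1; field_simp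
  have hg : ∀ x, gradSq d (fun x => σ / (r * F) * v (x0 + r • x) + c) x = gradSq d v (x0 + r • x) / F ^ 2 := by
    intro x
    unfold gradSq
    simp only [hp, mul_pow, div_pow, hσ]
    rw [← Finset.mul_sum]; ring
  have hF2 : 0 < F ^ 2 := by positivity
  refine ⟨?_, ?_, ?_, ?_, ?_⟩
  · have := W.sC
    have h1 : ContDiff ℝ 1 (fun x : Fin d → ℝ => x0 + r • x) := by fun_prop
    exact ((contDiff_const.mul (this.comp h1)).add contDiff_const)
  · intro i
    have := W.Bc i
    fun_prop
  · intro φ hφ hφc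
    have hφd : Differentiable ℝ φ := hφ.differentiable (by norm_num)
    set ψ : (Fin d → ℝ) → ℝ := fun y => 1 * φ (-(r⁻¹ • x0) + r⁻¹ • y) + 0 with hψ
    have hψC : ContDiff ℝ 1 ψ := by
      have h1 : ContDiff ℝ 1 (fun y : Fin d → ℝ => -(r⁻¹ • x0) + r⁻¹ • y) := by fun_prop
      exact ((contDiff_const.mul (hφ.comp h1)).add contDiff_const)
    have hψc : HasCompactSupport ψ := by
      have e : ψ = φ ∘ ((Homeomorph.smulOfNeZero r⁻¹ (by positivity)).trans
          (Homeomorph.addLeft (-(r⁻¹ • x0)))) := by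
        funext y; simp [hψ]
      rw [e]
      exact hφc.comp_homeomorph _
    have hw := W.weak ψ hψC hψc
    have e1 : ∀ x i, pd d i φ x = r * pd d i ψ (x0 + r • x) := by
      intro x i
      rw [hψ, pd_affine hφd]
      have : -(r⁻¹ • x0) + r⁻¹ • (x0 + r • x) = x := by
        rw [smul_add, smul_smul, inv_mul_cancel₀ hr.ne', one_smul]; simp
      rw [this]; field_simp
    have e2 : ∀ x, ∑ i, σ / F * B i (x0 + r • x) * pd d i φ x =
        (σ / F * r) * (fun y => ∑ i, B i (x0 + y) * pd d i ψ (x0 + y)) (r • x) := by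
      intro x
      simp only [Finset.mul_sum]
      refine Finset.sum_congr rfl fun i _ => ?_
      rw [e1]; ring
    simp only [e2]
    rw [integral_const_mul,
      Measure.integral_comp_smul volume (fun y => ∑ i, B i (x0 + y) * pd d i ψ (x0 + y)) r,
      integral_add_left_eq_self (fun y => ∑ i, B i y * pd d i ψ y) x0, hw]
    simp
  · intro x
    rw [hg]
    simp only [hp]
    have h1 := W.lo (x0 + r • x)
    have e : ∑ i, σ / F * B i (x0 + r • x) * (σ / F * pd d i v (x0 + r • x)) =
        (∑ i, B i (x0 + r • x) * pd d i v (x0 + r • x)) / F ^ 2 := by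
      rw [Finset.sum_div]
      refine Finset.sum_congr rfl fun i _ => ?_
      have : σ / F * B i (x0 + r • x) * (σ / F * pd d i v (x0 + r • x)) =
        σ ^ 2 * (B i (x0 + r • x) * pd d i v (x0 + r • x) / F ^ 2) := by ring
      rw [this, hσ, one_mul]
    rw [e, le_div_iff₀ hF2]
    have : (lam * (gradSq d v (x0 + r • x) / F ^ 2) - Lam * 1 ^ 2) * F ^ 2 =
        lam * gradSq d v (x0 + r • x) - Lam * F ^ 2 := by field_simp
    linarith
  · intro x
    rw [hg]
    have h1 := W.hi (x0 + r • x)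
    have e : ∑ i, (σ / F * B i (x0 + r • x)) ^ 2 = (∑ i, B i (x0 + r • x) ^ 2) / F ^ 2 := by
      simp only [mul_pow, div_pow, hσ]
      rw [← Finset.mul_sum]; ring
    rw [e, div_le_iff₀ hF2]
    have : Lam * (gradSq d v (x0 + r • x) / F ^ 2 + 1 ^ 2) * F ^ 2 =
        Lam * (gradSq d v (x0 + r • x) + F ^ 2) := by field_simp
    linarith

lemma arsinh_lower {K M s : ℝ} (hM : 1 ≤ M) (hs : 1 ≤ s) (h : Real.arsinh M - K ≤ Real.arsinh s) :
    Real.exp (-K) / 3 * M ≤ s := by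
  have h1 : Real.exp (Real.arsinh s) ≤ 3 * s := by
    rw [Real.exp_arsinh]
    have : √(1 + s ^ 2) ≤ 2 * s := Real.sqrt_le_iff.2 ⟨by linarith, by nlinarith⟩
    linarith
  have h2 : M ≤ Real.exp (Real.arsinh M) := by
    rw [Real.exp_arsinh]
    linarith [Real.sqrt_nonneg (1 + M ^ 2)]
  have h3 := Real.exp_le_exp.2 h
  rw [sub_eq_add_neg, Real.exp_add] at h3
  have h4 := mul_le_mul_of_nonneg_right h2 (Real.exp_pos (-K)).le
  linarith

set_option maxHeartbeats 1000000 in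
theorem osc_decay {d : ℕ} (hd : 2 ≤ d) {lam Lam : ℝ} (hlam : 0 < lam) (hLam : 0 < Lam) :
    ∃ δ : ℝ, 0 < δ ∧ δ ≤ 1 / 6 ∧ ∀ (v : (Fin d → ℝ) → ℝ) (B : Fin d → (Fin d → ℝ) → ℝ) (F : ℝ), 0 < F →
      WF d lam Lam F v B → ∀ (x0 : Fin d → ℝ) (r o : ℝ), 0 < r →
      (∀ x ∈ EB d 3, ∀ y ∈ EB d 3, v (x0 + r • x) - v (x0 + r • y) ≤ o) →
      ∀ x ∈ EB d 1, ∀ y ∈ EB d 1, v (x0 + r • x) - v (x0 + r • y) ≤ (1 - δ) * o + r * F := by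
  obtain ⟨K, hK, hmain⟩ := dg_lower hd hlam hLam
  refine ⟨Real.exp (-K) / 6, by positivity, ?_, ?_⟩
  · have : Real.exp (-K) ≤ 1 := Real.exp_le_one_iff.2 (by linarith)
    linarith
  intro v B F hF W x0 r o hr ho x hx y hy
  have hrF : 0 < r * F := by positivity
  have h13 : EB d 1 ⊆ EB d 3 := EB_mono (by norm_num) (by norm_num)
  set p : (Fin d → ℝ) → ℝ := fun x => v (x0 + r • x) with hp
  have hpc : Continuous p := by have := W.sC.continuous; simp only [hp]; fun_prop
  have ho0 : 0 ≤ o := by have := ho x (h13 hx) x (h13 hx); linarith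
  set lo := sInf (p '' EB d 3) with hlo
  have hbd : BddBelow (p '' EB d 3) := ⟨p x - o, by
    rintro _ ⟨t, ht, rfl⟩
    have := ho x (h13 hx) t ht
    linarith⟩
  have hne : (p '' EB d 3).Nonempty := ⟨p x, x, h13 hx, rfl⟩
  have hge : ∀ t ∈ EB d 3, lo ≤ p t := fun t ht => csInf_le hbd ⟨t, ht, rfl⟩
  have hle : ∀ t ∈ EB d 3, p t ≤ lo + o := fun t ht => by
    have : p t - o ≤ lo := le_csInf hne (by
      rintro _ ⟨t', ht', rfl⟩
      have := ho t ht t' ht'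
      linarith)
    linarith
  -- the measure alternative
  set E1 := EB d 2 ∩ {t | lo + o / 2 ≤ p t} with hE1
  set E2 := EB d 2 ∩ {t | p t ≤ lo + o / 2} with hE2
  have hcov : volume (EB d 2) ≤ volume E1 + volume E2 := by
    refine (measure_mono ?_).trans (measure_union_le E1 E2)
    intro t ht
    rcases le_total (lo + o / 2) (p t) with h | h
    · exact Or.inl ⟨ht, h⟩
    · exact Or.inr ⟨ht, h⟩
  have key : ∀ (σ c : ℝ), σ ^ 2 = 1 → (∀ t ∈ EB d 3, 1 ≤ σ / (r * F) * p t + c) →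
      volume (EB d 2) ≤ 2 * volume (EB d 2 ∩ {t | o / (2 * (r * F)) + 1 ≤ σ / (r * F) * p t + c}) →
      ∀ t ∈ EB d 1, Real.exp (-K) / 6 * o ≤ σ * p t + c * (r * F) := by
    intro σ c hσ h1 h2 t ht
    have h3 := hmain _ _ (WF_scale hF W x0 hr hσ c) h1 (o / (2 * (r * F)) + 1) h2 t ht
    have hM : 1 ≤ o / (2 * (r * F)) + 1 := by
      have : 0 ≤ o / (2 * (r * F)) := by positivity
      linarith
    have h4 := arsinh_lower hM (h1 t (h13 ht)) h3
    have h5 := mul_le_mul_of_nonneg_right h4 hrF.le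
    have e1 : (σ / (r * F) * v (x0 + r • t) + c) * (r * F) = σ * p t + c * (r * F) := by
      simp only [hp]; field_simp
    have e2 : Real.exp (-K) / 3 * (o / (2 * (r * F)) + 1) * (r * F) =
        Real.exp (-K) / 6 * o + Real.exp (-K) / 3 * (r * F) := by field_simp; ring
    rw [e1, e2] at h5
    have : 0 ≤ Real.exp (-K) / 3 * (r * F) := by positivity
    linarith
  have hfin : (∀ t ∈ EB d 1, Real.exp (-K) / 6 * o ≤ p t - lo + r * F) ∨
      (∀ t ∈ EB d 1, Real.exp (-K) / 6 * o ≤ lo + o - p t + r * F) := by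
    have halt : volume (EB d 2) ≤ 2 * volume E1 ∨ volume (EB d 2) ≤ 2 * volume E2 := by
      rcases le_total (volume E1) (volume E2) with h | h
      · right; rw [two_mul]; exact hcov.trans (add_le_add h le_rfl)
      · left; rw [two_mul]; exact hcov.trans (add_le_add le_rfl h)
    rcases halt with h | h
    · left
      intro t ht
      have := key 1 (1 - lo / (r * F)) (by norm_num) (fun t ht => by
        have h1 := hge t ht
        have e : 1 / (r * F) * p t + (1 - lo / (r * F)) = 1 + (p t - lo) / (r * F) := by ring
        rw [e]
        have : 0 ≤ (p t - lo) / (r * F) := div_nonneg (by linarith) hrF.le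
        linarith) (h.trans (by
          gcongr
          rintro t ⟨ht2, ht⟩
          refine ⟨ht2, ?_⟩
          have ht : lo + o / 2 ≤ p t := ht
          show o / (2 * (r * F)) + 1 ≤ 1 / (r * F) * p t + (1 - lo / (r * F))
          have e : 1 / (r * F) * p t + (1 - lo / (r * F)) - (o / (2 * (r * F)) + 1) =
            (p t - lo - o / 2) / (r * F) := by field_simp; ring
          have : 0 ≤ (p t - lo - o / 2) / (r * F) := div_nonneg (by linarith) hrF.le
          linarith)) t ht
      have e : (1 - lo / (r * F)) * (r * F) = r * F - lo := by field_simp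
      rw [e] at this
      linarith
    · right
      intro t ht
      have := key (-1) (1 + (lo + o) / (r * F)) (by norm_num) (fun t ht => by
        have h1 := hle t ht
        have e : -1 / (r * F) * p t + (1 + (lo + o) / (r * F)) = 1 + (lo + o - p t) / (r * F) := by ring
        rw [e]
        have : 0 ≤ (lo + o - p t) / (r * F) := div_nonneg (by linarith) hrF.le
        linarith) (h.trans (by
          gcongr
          rintro t ⟨ht2, ht⟩
          refine ⟨ht2, ?_⟩
          have ht : p t ≤ lo + o / 2 := ht
          show o / (2 * (r * F)) + 1 ≤ -1 / (r * F) * p t + (1 + (lo + o) / (r * F))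
          have e : -1 / (r * F) * p t + (1 + (lo + o) / (r * F)) - (o / (2 * (r * F)) + 1) =
            (lo + o / 2 - p t) / (r * F) := by field_simp; ring
          have : 0 ≤ (lo + o / 2 - p t) / (r * F) := div_nonneg (by linarith) hrF.le
          linarith)) t ht
      have e : (1 + (lo + o) / (r * F)) * (r * F) = r * F + (lo + o) := by field_simp
      rw [e] at this
      linarith
  show p x - p y ≤ _
  rcases hfin with h | h
  · have h1 := h y hy
    have h2 := hle x (h13 hx)
    linarith
  · have h1 := h x hx
    have h2 := hge y (h13 hy)
    linarith

set_option maxHeartbeats 1000000 in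
/-- interior Hölder estimate (De Giorgi) -/
theorem dg_holder {d : ℕ} (hd : 2 ≤ d) {lam Lam : ℝ} (hlam : 0 < lam) (hLam : 0 < Lam) :
    ∃ γ C : ℝ, 0 < γ ∧ γ < 1 ∧ 0 < C ∧ ∀ (v : (Fin d → ℝ) → ℝ) (B : Fin d → (Fin d → ℝ) → ℝ) (F M : ℝ),
      0 < F → WF d lam Lam F v B → (∀ x, |v x| ≤ M) →
      ∀ x y, |v x - v y| ≤ C * (2 * M + F) * dist x y ^ γ := by
  obtain ⟨δ, hδ0, hδ6, hosc⟩ := osc_decay hd hlam hLam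
  set θ := 1 - δ with hθ
  have hθ1 : θ < 1 := by linarith
  have hθ5 : 5 / 6 ≤ θ := by linarith
  have hθ0 : 0 < θ := by linarith
  set γ := - Real.log θ / Real.log 3 with hγ
  have hl3 : 0 < Real.log 3 := Real.log_pos (by norm_num)
  have hlθ : Real.log θ < 0 := Real.log_neg hθ0 hθ1
  have hγ0 : 0 < γ := div_pos (by linarith) hl3
  have hγ1 : γ < 1 := by
    rw [hγ, div_lt_one hl3]
    have h1 : Real.log (1 / 3) < Real.log θ := Real.log_lt_log (by norm_num) (by linarith)
    rw [one_div, Real.log_inv] at h1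
    linarith
  have hθγ : θ = (1 / 3 : ℝ) ^ γ := by
    rw [Real.rpow_def_of_pos (by norm_num), one_div, Real.log_inv, hγ]
    rw [show -Real.log 3 * (-Real.log θ / Real.log 3) = Real.log θ by field_simp, Real.exp_log hθ0]
  have hd0 : (0:ℝ) < d := by exact_mod_cast (by omega : 0 < d)
  have hsd : 0 < √(d:ℝ) := Real.sqrt_pos.2 hd0
  refine ⟨γ, 3 * (2 * √d) ^ γ, hγ0, hγ1, by positivity, ?_⟩
  intro v B F M hF W hM x y
  have hM0 : 0 ≤ M := (abs_nonneg _).trans (hM x)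
  have hA : 0 < 2 * M + F := by linarith
  have hit : ∀ n : ℕ, ∀ x0 : Fin d → ℝ, ∀ x ∈ EB d 1, ∀ y ∈ EB d 1,
      v (x0 + ((1 / 3 : ℝ) ^ n) • x) - v (x0 + ((1 / 3 : ℝ) ^ n) • y) ≤
        (2 * M + F) * θ ^ n - F * (1 / 3) ^ n := by
    intro n
    induction n with
    | zero =>
      intro x0 x _ y _
      have h1 := abs_le.1 (hM (x0 + ((1 / 3 : ℝ) ^ 0) • x))
      have h2 := abs_le.1 (hM (x0 + ((1 / 3 : ℝ) ^ 0) • y))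
      simp only [pow_zero] at *
      linarith
    | succ n ih =>
      intro x0 x hx y hy
      have h1 := hosc v B F hF W x0 ((1 / 3 : ℝ) ^ (n + 1)) ((2 * M + F) * θ ^ n - F * (1 / 3) ^ n)
        (by positivity) (fun a ha b hb => by
          have h3 : ∀ a ∈ EB d 3, (1 / 3 : ℝ) • a ∈ EB d 1 := by
            intro a ha
            have ha : nsq a < 3 ^ 2 := ha
            show nsq ((1 / 3 : ℝ) • a) < 1 ^ 2
            have : nsq ((1 / 3 : ℝ) • a) = 1 / 9 * nsq a := by
              unfold nsq
              simp only [Pi.smul_apply, smul_eq_mul, mul_pow]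
              rw [← Finset.mul_sum]; norm_num
            rw [this]; linarith
          have := ih x0 _ (h3 a ha) _ (h3 b hb)
          rw [smul_smul, smul_smul, ← pow_succ] at this
          exact this) x hx y hy
      refine h1.trans ?_
      rw [pow_succ θ, pow_succ (1 / 3 : ℝ)]
      have h4 : 0 < F * (1 / 3) ^ n := by positivity
      nlinarith
  have hit' : ∀ n : ℕ, ∀ x y : Fin d → ℝ, nE (x - y) < (1 / 3 : ℝ) ^ n → |v x - v y| ≤ (2 * M + F) * θ ^ n := by
    intro n x y hxy
    have hr : (0:ℝ) < (1 / 3) ^ n := by positivity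
    have m0 : (0 : Fin d → ℝ) ∈ EB d 1 := by
      show nsq (0 : Fin d → ℝ) < 1 ^ 2
      unfold nsq; simp
    have m1 : ((1 / 3 : ℝ) ^ n)⁻¹ • (x - y) ∈ EB d 1 := by
      show nsq (((1 / 3 : ℝ) ^ n)⁻¹ • (x - y)) < 1 ^ 2
      have e : nsq (((1 / 3 : ℝ) ^ n)⁻¹ • (x - y)) = (((1 / 3 : ℝ) ^ n)⁻¹ * nE (x - y)) ^ 2 := by
        rw [mul_pow, nE_sq]
        unfold nsq
        simp only [Pi.smul_apply, smul_eq_mul, mul_pow]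
        rw [← Finset.mul_sum]
      rw [e]
      have : ((1 / 3 : ℝ) ^ n)⁻¹ * nE (x - y) < 1 := by
        rw [inv_mul_lt_iff₀ hr]; linarith
      exact pow_lt_pow_left₀ this (mul_nonneg (by positivity) (nE_nonneg _)) (by norm_num)
    have e1 : y + ((1 / 3 : ℝ) ^ n) • (((1 / 3 : ℝ) ^ n)⁻¹ • (x - y)) = x := by
      rw [smul_smul, mul_inv_cancel₀ hr.ne', one_smul]; abel
    have h1 := hit n y _ m1 0 m0
    have h2 := hit n y 0 m0 _ m1
    rw [e1, smul_zero, add_zero] at h1 h2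
    have h4 : 0 < F * (1 / 3) ^ n := by positivity
    rw [abs_le]
    constructor <;> linarith
  have hdist : nE (x - y) ≤ √d * dist x y := by rw [dist_eq_norm]; exact nE_le_norm _
  set t := 2 * nE (x - y) with ht
  have ht0 : 0 ≤ t := by have := nE_nonneg (x - y); positivity
  have hmain : |v x - v y| ≤ 3 * (2 * M + F) * t ^ γ := by
    rcases ht0.eq_or_lt with h0 | h0
    · have : nE (x - y) = 0 := by linarith
      have := sub_eq_zero.1 (nE_eq_zero this)
      rw [this, sub_self, abs_zero]
      positivity
    rcases le_or_gt t 1 with h1 | h1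
    · obtain ⟨n, hn1, hn2⟩ := exists_nat_pow_near_of_lt_one h0 h1 (by norm_num : (0:ℝ) < 1 / 3) (by norm_num)
      refine (hit' n x y (by
        have : 0 < (1 / 3 : ℝ) ^ n := by positivity
        linarith)).trans ?_
      have h2 : θ ^ n * θ ≤ t ^ γ := by
        calc θ ^ n * θ = ((1 / 3 : ℝ) ^ (n + 1)) ^ γ := by
              rw [← pow_succ, hθγ, ← Real.rpow_natCast, ← Real.rpow_natCast, ← Real.rpow_mul (by norm_num),
                ← Real.rpow_mul (by norm_num), mul_comm]
          _ ≤ t ^ γ := Real.rpow_le_rpow (by positivity) hn1.le hγ0.le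
      have h3 : θ ^ n ≤ 3 * t ^ γ := by
        have : 0 < θ ^ n := by positivity
        nlinarith
      nlinarith
    · have h2 : 1 ≤ t ^ γ := Real.one_le_rpow h1.le hγ0.le
      have h3 := abs_sub (v x) (v y)
      have h4 := hM x
      have h5 := hM y
      nlinarith
  refine hmain.trans ?_
  have h6 : t ^ γ ≤ (2 * √d) ^ γ * dist x y ^ γ := by
    rw [← Real.mul_rpow (by positivity) dist_nonneg]
    exact Real.rpow_le_rpow ht0 (by linarith) hγ0.le
  calc 3 * (2 * M + F) * t ^ γ ≤ 3 * (2 * M + F) * ((2 * √d) ^ γ * dist x y ^ γ) := by gcongr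
    _ = _ := by ring

open MeasureTheory Set Filter Topology
open scoped ENNReal

lemma ibp {d : ℕ} {f φ : (Fin d → ℝ) → ℝ} (hf : ContDiff ℝ 1 f) (hφ : ContDiff ℝ 1 φ)
    (hφc : HasCompactSupport φ) (i : Fin d) :
    ∫ x, f x * pd d i φ x = - ∫ x, pd d i f x * φ x := by
  have hc1 := hf.continuous
  have hc2 := hφ.continuous
  have hc3 := continuous_pd hf i
  have hc4 := continuous_pd hφ i
  have hc : HasCompactSupport (pd d i φ) := hφc.fderiv_apply (𝕜 := ℝ) (Pi.single i 1)
  exact integral_mul_fderiv_eq_neg_fderiv_mul_of_integrable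
    (Continuous.integrable_of_hasCompactSupport (hc3.mul hc2) hφc.mul_left)
    (Continuous.integrable_of_hasCompactSupport (hc1.mul hc4) hc.mul_left)
    (Continuous.integrable_of_hasCompactSupport (hc1.mul hc2) hφc.mul_left)
    (fun x _ => hf.differentiable (by norm_num) x) (fun x _ => hφ.differentiable (by norm_num) x)

lemma deriv_transl {d : ℕ} {G ψ : (Fin d → ℝ) → ℝ} (hG : ContDiff ℝ 1 G) (hψ : Continuous ψ)
    (hψc : HasCompactSupport ψ) (k : Fin d) {C : ℝ} (hC : ∀ x, |pd d k G x| ≤ C) :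
    HasDerivAt (fun h : ℝ => ∫ x, G (x + h • (Pi.single k 1 : Fin d → ℝ)) * ψ x)
      (∫ x, pd d k G x * ψ x) 0 := by
  have hc1 := hG.continuous
  have hc3 := continuous_pd hG k
  have := (hasDerivAt_integral_of_dominated_loc_of_deriv_le (μ := volume) (x₀ := (0:ℝ)) (s := univ)
    (F := fun (h : ℝ) (x : Fin d → ℝ) => G (x + h • (Pi.single k 1 : Fin d → ℝ)) * ψ x)
    (F' := fun (h : ℝ) (x : Fin d → ℝ) => pd d k G (x + h • (Pi.single k 1 : Fin d → ℝ)) * ψ x)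
    (bound := fun x => C * |ψ x|) univ_mem
    (Eventually.of_forall fun h => (Continuous.aestronglyMeasurable (by fun_prop)))
    (Continuous.integrable_of_hasCompactSupport (by fun_prop) hψc.mul_left)
    (Continuous.aestronglyMeasurable (by fun_prop))
    (Eventually.of_forall fun x h _ => by
      rw [Real.norm_eq_abs, abs_mul]
      exact mul_le_mul_of_nonneg_right (hC _) (abs_nonneg _))
    ((hψ.integrable_of_hasCompactSupport hψc).abs.const_mul C)
    (Eventually.of_forall fun x h _ => by
      have h1 := hasDerivAt_line x (Pi.single k 1 : Fin d → ℝ) h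
        (hG.differentiable (by norm_num) _)
      have h2 := h1.mul_const (ψ x)
      refine h2.congr_deriv ?_
      simp [Pi.single_apply])).2
  simpa using this

/-- weak form of the differentiated equation -/
lemma weak_diff {d : ℕ} {W : Fin d → (Fin d → ℝ) → ℝ} {n : (Fin d → ℝ) → ℝ}
    (hW : ∀ i, ContDiff ℝ 1 (W i)) (hn : ContDiff ℝ 1 n)
    (heq : ∀ x, ∑ i, pd d i (W i) x = n x) (k : Fin d) {C : ℝ}
    (hC : ∀ i x, |pd d k (W i) x| ≤ C) (hC' : ∀ x, |pd d k n x| ≤ C)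
    {φ : (Fin d → ℝ) → ℝ} (hφ : ContDiff ℝ 1 φ) (hφc : HasCompactSupport φ) :
    ∫ x, ∑ i, (pd d k (W i) x - if i = k then n x else 0) * pd d i φ x = 0 := by
  set e : Fin d → ℝ := Pi.single k 1 with he
  have hpc : ∀ i, Continuous (pd d i φ) := fun i => continuous_pd hφ i
  have hcs : ∀ i, HasCompactSupport (pd d i φ) := fun i => hφc.fderiv_apply (𝕜 := ℝ) (Pi.single i 1)
  have hT : ∀ (f : (Fin d → ℝ) → ℝ) (h : ℝ), ContDiff ℝ 1 f → ContDiff ℝ 1 (fun x => f (x + h • e)) := by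
    intro f h hf
    have h1 : ContDiff ℝ 1 (fun x : Fin d → ℝ => x + h • e) := by fun_prop
    exact hf.comp h1
  have hTp : ∀ (f : (Fin d → ℝ) → ℝ) (h : ℝ) i x, pd d i (fun x => f (x + h • e)) x = pd d i f (x + h • e) := by
    intro f h i x
    unfold pd
    rw [fderiv_comp_add_right]
  have h1 : ∀ h : ℝ, ∑ i, ∫ x, W i (x + h • e) * pd d i φ x = - ∫ x, n (x + h • e) * φ x := by
    intro h
    have : ∀ i, ∫ x, W i (x + h • e) * pd d i φ x = - ∫ x, pd d i (W i) (x + h • e) * φ x := by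
      intro i
      rw [ibp (hT _ h (hW i)) hφ hφc i]
      simp only [hTp]
    simp only [this]
    rw [Finset.sum_neg_distrib, ← integral_finsetSum]
    · congr 2
      funext x
      rw [← heq, Finset.sum_mul]
    · intro i _
      have := continuous_pd (hW i) i
      have := hφ.continuous
      exact Continuous.integrable_of_hasCompactSupport (by fun_prop) hφc.mul_left
  have d1 : HasDerivAt (fun h : ℝ => ∑ i, ∫ x, W i (x + h • e) * pd d i φ x)
      (∑ i, ∫ x, pd d k (W i) x * pd d i φ x) 0 :=
    HasDerivAt.fun_sum fun i _ => deriv_transl (hW i) (hpc i) (hcs i) k (hC i)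
  have d2 : HasDerivAt (fun h : ℝ => - ∫ x, n (x + h • e) * φ x) (- ∫ x, pd d k n x * φ x) 0 :=
    (deriv_transl hn hφ.continuous hφc k hC').neg
  have h2 : ∑ i, ∫ x, pd d k (W i) x * pd d i φ x = - ∫ x, pd d k n x * φ x := by
    have : (fun h : ℝ => ∑ i, ∫ x, W i (x + h • e) * pd d i φ x) = fun h : ℝ => - ∫ x, n (x + h • e) * φ x :=
      funext h1
    rw [this] at d1
    exact d1.unique d2
  rw [← ibp hn hφ hφc k] at h2
  have ig1 : ∀ i, Integrable (fun x => pd d k (W i) x * pd d i φ x) := fun i =>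
    Continuous.integrable_of_hasCompactSupport ((continuous_pd (hW i) k).mul (hpc i)) (hcs i).mul_left
  have ig2 : Integrable (fun x => n x * pd d k φ x) :=
    Continuous.integrable_of_hasCompactSupport (hn.continuous.mul (hpc k)) (hcs k).mul_left
  have e1 : ∀ x, ∑ i, (pd d k (W i) x - if i = k then n x else 0) * pd d i φ x =
      (∑ i, pd d k (W i) x * pd d i φ x) - n x * pd d k φ x := by
    intro x
    simp only [sub_mul, Finset.sum_sub_distrib, ite_mul, zero_mul, Finset.sum_ite_eq', Finset.mem_univ, if_true]
  simp only [e1]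
  rw [integral_sub (integrable_finsetSum _ fun i _ => ig1 i) ig2, integral_finsetSum _ fun i _ => ig1 i, h2]
  ring

lemma wf_lo_arith {Q m κ t e c X vk E : ℝ} (hQ : 1 ≤ Q) (hm : 1 / Q ≤ m) (hκ0 : 0 ≤ κ) (hκ : κ ≤ Q)
    (he : |e| ≤ 2 * Q) (hc : |c| ≤ E * Q) (hX : vk ^ 2 ≤ X) (hE : 0 ≤ E) :
    1 / (2 * Q) * X - 27 * Q ^ 6 * (1 + E ^ 2) * 1 ^ 2 ≤ m * X + κ * (t + e) * t - c * vk := by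
  have hQ0 : 0 < Q := by linarith
  have hX0 : 0 ≤ X := (sq_nonneg vk).trans hX
  have h1 : 1 / Q * X ≤ m * X := mul_le_mul_of_nonneg_right hm hX0
  have he2 : e ^ 2 ≤ 4 * Q ^ 2 := by
    rw [← sq_abs]; nlinarith [abs_nonneg e]
  have hc2 : c ^ 2 ≤ E ^ 2 * Q ^ 2 := by
    rw [← sq_abs]; nlinarith [abs_nonneg c]
  have h2 : - (Q * Q ^ 2) ≤ κ * (t + e) * t := by
    have a1 : 0 ≤ κ * (2 * t + e) ^ 2 := by positivity
    have a2 : κ * e ^ 2 ≤ Q * (4 * Q ^ 2) := by gcongr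
    nlinarith
  have h3 : c * vk ≤ 1 / (2 * Q) * vk ^ 2 + Q / 2 * c ^ 2 := by
    have : 1 / (2 * Q) * vk ^ 2 + Q / 2 * c ^ 2 - c * vk = 1 / (2 * Q) * (vk - Q * c) ^ 2 := by
      field_simp; ring
    have h0 : 0 ≤ 1 / (2 * Q) * (vk - Q * c) ^ 2 := by positivity
    linarith
  have h4 : 1 / (2 * Q) * vk ^ 2 ≤ 1 / (2 * Q) * X := by gcongr
  have h5 : Q / 2 * c ^ 2 ≤ Q / 2 * (E ^ 2 * Q ^ 2) := by gcongr
  have h6 : 1 / Q * X = 1 / (2 * Q) * X + 1 / (2 * Q) * X := by field_simp; ring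
  have h7 : Q ^ 3 ≤ Q ^ 6 := pow_le_pow_right₀ hQ (by norm_num)
  have h8 : E ^ 2 * Q ^ 3 ≤ E ^ 2 * Q ^ 6 := by gcongr
  have h9 : 0 < Q ^ 6 := by positivity
  have h10 : 0 ≤ E ^ 2 * Q ^ 6 := by positivity
  nlinarith

lemma wf_hi_arith {Q m κ t e c X P E : ℝ} (hQ : 1 ≤ Q) (hm0 : 0 ≤ m) (hm : m ≤ Q) (hκ0 : 0 ≤ κ) (hκ : κ ≤ Q)
    (he : |e| ≤ 2 * Q) (hc : |c| ≤ E * Q) (hX0 : 0 ≤ X) (hP : P ≤ Q ^ 2) (hP0 : 0 ≤ P)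
    (ht : t ^ 2 ≤ P * X) :
    3 * (m ^ 2 * X + (κ * (t + e)) ^ 2 * P + c ^ 2) ≤ 27 * Q ^ 6 * (1 + E ^ 2) * (X + 1 ^ 2) := by
  have hQ0 : 0 < Q := by linarith
  have he2 : e ^ 2 ≤ 4 * Q ^ 2 := by
    rw [← sq_abs]; nlinarith [abs_nonneg e]
  have hc2 : c ^ 2 ≤ E ^ 2 * Q ^ 2 := by
    rw [← sq_abs]; nlinarith [abs_nonneg c]
  have h1 : m ^ 2 * X ≤ Q ^ 2 * X := by gcongr
  have ht2 : t ^ 2 ≤ Q ^ 2 * X := ht.trans (by gcongr)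
  have h2 : (t + e) ^ 2 ≤ 2 * (Q ^ 2 * X) + 8 * Q ^ 2 := by nlinarith [sq_nonneg (t - e)]
  have h3 : (κ * (t + e)) ^ 2 * P ≤ Q ^ 2 * (2 * (Q ^ 2 * X) + 8 * Q ^ 2) * Q ^ 2 := by
    rw [mul_pow]; gcongr
  have h4 : Q ^ 2 ≤ Q ^ 6 := pow_le_pow_right₀ hQ (by norm_num)
  have h5 : Q ^ 2 * X ≤ Q ^ 6 * X := by gcongr
  have h6 : E ^ 2 * Q ^ 2 ≤ E ^ 2 * Q ^ 6 := by gcongr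
  have h7 : 0 ≤ Q ^ 6 * X := by positivity
  have h8 : 0 ≤ E ^ 2 * Q ^ 6 := by positivity
  have h9 : 0 ≤ E ^ 2 * Q ^ 6 * X := by positivity
  have h10 : 0 < Q ^ 6 := by positivity
  nlinarith

open MeasureTheory Set Filter Topology
open scoped ENNReal

lemma exists_bd_of_per {d : ℕ} {f : (Fin d → ℝ) → ℝ} (hf : Continuous f) (hp : ZPer d f) :
    ∃ C : ℝ, ∀ x, |f x| ≤ C := by
  obtain ⟨x, -, hx⟩ := exists_max_of_per (f := fun x => |f x|) hf.abs (fun x k => by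
    show |f _| = |f _|
    rw [hp])
  exact ⟨_, hx⟩

set_option maxHeartbeats 1000000 in
lemma good_wf {d : ℕ} {α : ℝ} {g : ℝ → ℝ} {V : (Fin d → ℝ) → ℝ} {Q ε E : ℝ}
    {u m : (Fin d → ℝ) → ℝ} (G : Good d α g V Q ε u m) (hE : ε ≤ E) (k : Fin d) :
    ∃ B, WF d (1 / (2 * Q)) (27 * Q ^ 6 * (1 + E ^ 2)) 1 (pd d k u) B := by
  have hQ := G.q1
  have hQ0 := G.qpos
  have hE0 : 0 ≤ E := G.epos.le.trans hE
  have hu2 : ContDiff ℝ 2 u := G.sol.reg_u.1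
  have hm1 : ContDiff ℝ 1 m := G.sol.reg_m.1
  have hv : ContDiff ℝ 1 (pd d k u) := contDiff_pd hu2 k
  set W : Fin d → (Fin d → ℝ) → ℝ := fun i x => m x * pd d i u x with hW
  have hWC : ∀ i, ContDiff ℝ 1 (W i) := fun i => hm1.mul (contDiff_pd hu2 i)
  have hWp : ∀ i, ZPer d (W i) := fun i x l => by
    simp only [hW]
    rw [G.sol.per_m, pd_per G.sol.per_u]
  set n : (Fin d → ℝ) → ℝ := fun x => ε * (m x - 1) with hn
  have hnC : ContDiff ℝ 1 n := contDiff_const.mul (hm1.sub contDiff_const)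
  have hnp : ZPer d n := fun x l => by
    simp only [hn]; rw [G.sol.per_m]
  have heq : ∀ x, ∑ i, pd d i (W i) x = n x := by
    intro x
    have := G.sol.fp x
    unfold divUp at this
    simp only [hW, hn]
    linarith
  have hbd : ∃ C, (∀ i x, |pd d k (W i) x| ≤ C) ∧ ∀ x, |pd d k n x| ≤ C := by
    have h1 : ∀ i, ∃ C, ∀ x, |pd d k (W i) x| ≤ C := fun i =>
      exists_bd_of_per (continuous_pd (hWC i) k) (pd_per (hWp i) k)
    choose C hC using h1
    obtain ⟨C', hC'⟩ := exists_bd_of_per (continuous_pd hnC k) (pd_per hnp k)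
    have hC0 : ∀ i, 0 ≤ C i := fun i => (abs_nonneg _).trans (hC i 0)
    have hC0' : 0 ≤ C' := (abs_nonneg _).trans (hC' 0)
    refine ⟨(∑ i, C i) + C', fun i x => ?_, fun x => ?_⟩
    · have := Finset.single_le_sum (f := C) (fun i _ => hC0 i) (Finset.mem_univ i)
      linarith [hC i x]
    · have := Finset.sum_nonneg (s := Finset.univ) (f := C) (fun i _ => hC0 i)
      linarith [hC' x]
  obtain ⟨C, hC, hC'⟩ := hbd
  set B : Fin d → (Fin d → ℝ) → ℝ := fun i x => pd d k (W i) x - if i = k then n x else 0 with hB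
  -- pointwise structure
  have hstr : ∀ x, ∃ κ t e : ℝ, 0 ≤ κ ∧ κ ≤ Q ∧ |e| ≤ 2 * Q ∧
      t = ∑ j, pd d j u x * pd d j (pd d k u) x ∧
      ∀ i, B i x = m x * pd d i (pd d k u) x + κ * (t + e) * pd d i u x - if i = k then n x else 0 := by
    intro x
    have hg := G.gp_pos x
    refine ⟨1 / deriv g (m x), ∑ j, pd d j u x * pd d j (pd d k u) x, ε * pd d k u x + pd d k V x,
      by positivity, ?_, ?_, rfl, fun i => ?_⟩
    · rw [div_le_iff₀ hg]
      have := mul_le_mul_of_nonneg_left (G.gp_lo x) hQ0.le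
      rwa [mul_one_div_cancel hQ0.ne'] at this
    · refine (abs_add_le _ _).trans ?_
      rw [abs_mul, abs_of_pos G.epos]
      linarith [G.epdu k x, G.pdv k x]
    · have h1 := pd_hj G.sol G.ghyp G.vhyp k x (G.m_pos x)
      have h2 : pd d k m x = 1 / deriv g (m x) *
          (∑ j, pd d j u x * pd d j (pd d k u) x + (ε * pd d k u x + pd d k V x)) := by
        have e1 : ∀ j, pd d j (pd d k u) x = pd d k (pd d j u) x := fun j => pd_comm hu2 j k x
        simp only [e1]
        rw [one_div, eq_inv_mul_iff_mul_eq₀ hg.ne', h1]; ring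
      have d1 : DifferentiableAt ℝ m x := hm1.differentiable (by norm_num) x
      have d2 : DifferentiableAt ℝ (pd d i u) x := (contDiff_pd hu2 i).differentiable (by norm_num) x
      simp only [hB, hW]
      rw [pd_mul d1 d2, h2, pd_comm hu2 k i x]
  have hmn : ∀ x, |n x| ≤ E * Q := by
    intro x
    simp only [hn]
    rw [abs_mul, abs_of_pos G.epos]
    have h1 : |m x - 1| ≤ Q := abs_le.2 ⟨by linarith [G.m_pos x], by linarith [G.m_hi x]⟩
    have := G.epos
    gcongr
  refine ⟨B, hv, fun i => ?_, fun φ hφ hφc => weak_diff hWC hnC heq k hC hC' hφ hφc, fun x => ?_, fun x => ?_⟩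
  · have h1 := continuous_pd (hWC i) k
    have h2 := hnC.continuous
    simp only [hB]
    split_ifs
    · exact h1.sub h2
    · exact h1.sub continuous_const
  · obtain ⟨κ, t, e, hκ0, hκ, he, ht, hBx⟩ := hstr x
    have e1 : ∑ i, B i x * pd d i (pd d k u) x =
        m x * gradSq d (pd d k u) x + κ * (t + e) * t - n x * pd d k (pd d k u) x := by
      simp only [hBx, sub_mul, add_mul, Finset.sum_sub_distrib, Finset.sum_add_distrib, ite_mul, zero_mul,
        Finset.sum_ite_eq', Finset.mem_univ, if_true]
      unfold gradSq
      rw [Finset.mul_sum]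
      congr 1
      congr 1
      · exact Finset.sum_congr rfl fun i _ => by ring
      · have e3 : κ * (t + e) * t = κ * (t + e) * ∑ j, pd d j u x * pd d j (pd d k u) x := by rw [← ht]
        rw [e3, Finset.mul_sum]
        exact Finset.sum_congr rfl fun i _ => by ring
    rw [e1]
    exact wf_lo_arith hQ (G.m_lo x) hκ0 hκ he (hmn x)
      (Finset.single_le_sum (f := fun i => pd d i (pd d k u) x ^ 2) (fun _ _ => sq_nonneg _)
        (Finset.mem_univ k)) hE0
  · obtain ⟨κ, t, e, hκ0, hκ, he, ht, hBx⟩ := hstr x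
    have ht2 : t ^ 2 ≤ gradSq d u x * gradSq d (pd d k u) x := by
      rw [ht]; exact Finset.sum_mul_sq_le_sq_mul_sq _ _ _
    have h1 : ∑ i, B i x ^ 2 ≤ 3 * (m x ^ 2 * gradSq d (pd d k u) x + (κ * (t + e)) ^ 2 * gradSq d u x + n x ^ 2) := by
      have e2 : ∀ i, B i x ^ 2 ≤ 3 * (m x ^ 2 * pd d i (pd d k u) x ^ 2 + (κ * (t + e)) ^ 2 * pd d i u x ^ 2 +
          if i = k then n x ^ 2 else 0) := by
        intro i
        rw [hBx]
        have : (if i = k then n x ^ 2 else 0) = (if i = k then n x else 0) ^ 2 := by split_ifs <;> ring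
        rw [this]
        generalize (if i = k then n x else 0) = c
        rw [← mul_pow, ← mul_pow]
        nlinarith [sq_nonneg (m x * pd d i (pd d k u) x - κ * (t + e) * pd d i u x),
          sq_nonneg (m x * pd d i (pd d k u) x + c), sq_nonneg (κ * (t + e) * pd d i u x + c)]
      refine (Finset.sum_le_sum fun i _ => e2 i).trans (le_of_eq ?_)
      rw [← Finset.mul_sum, Finset.sum_add_distrib, Finset.sum_add_distrib, ← Finset.mul_sum, ← Finset.mul_sum]
      simp only [Finset.sum_ite_eq', Finset.mem_univ, if_true]
      rfl
    refine h1.trans ?_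
    exact wf_hi_arith hQ (G.m_pos x).le (G.m_hi x) hκ0 hκ he (hmn x) (gradSq_nonneg x) (G.du x)
      (gradSq_nonneg x) ht2

/-- Hölder bound for the gradient when ε is bounded -/
theorem du_holder {d : ℕ} (hd : 2 ≤ d) {α : ℝ} {g : ℝ → ℝ} {V : (Fin d → ℝ) → ℝ} {Q E : ℝ} (hQ : 1 ≤ Q) :
    ∃ γ C : ℝ, 0 < γ ∧ γ < 1 ∧ 0 < C ∧ ∀ ε ≤ E, ∀ u m : (Fin d → ℝ) → ℝ, Good d α g V Q ε u m →
      ∀ k x y, |pd d k u x - pd d k u y| ≤ C * dist x y ^ γ := by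
  have hQ0 : 0 < Q := by linarith
  obtain ⟨γ, C, h1, h2, h3, h4⟩ := dg_holder hd (lam := 1 / (2 * Q)) (Lam := 27 * Q ^ 6 * (1 + E ^ 2))
    (by positivity) (by positivity)
  refine ⟨γ, C * (2 * Q + 1), h1, h2, by positivity, fun ε hε u m G k x y => ?_⟩
  obtain ⟨B, hB⟩ := good_wf G hε k
  exact h4 _ B 1 Q one_pos hB (fun x => G.pdu k x) x y

open MeasureTheory Set Filter Topology
open scoped ENNReal

lemma lip_of_pd {d : ℕ} {f : (Fin d → ℝ) → ℝ} (hf : Differentiable ℝ f) {L : ℝ}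
    (hL : ∀ i x, |pd d i f x| ≤ L) (hL0 : 0 ≤ L) (x y : Fin d → ℝ) :
    |f x - f y| ≤ d * L * dist x y := by
  have hb : ∀ z ∈ (univ : Set (Fin d → ℝ)), ‖fderiv ℝ f z‖ ≤ d * L := by
    intro z _
    refine ContinuousLinearMap.opNorm_le_bound _ (by positivity) fun v => ?_
    rw [fderiv_eq_sum_pd, Real.norm_eq_abs]
    refine (Finset.abs_sum_le_sum_abs _ _).trans ?_
    have : ∀ i ∈ (Finset.univ : Finset (Fin d)), |v i * pd d i f z| ≤ L * ‖v‖ := by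
      intro i _
      rw [abs_mul, mul_comm]
      exact mul_le_mul (hL i z) (norm_le_pi_norm v i) (abs_nonneg _) hL0
    refine (Finset.sum_le_sum this).trans (le_of_eq ?_)
    simp; ring
  have := convex_univ.norm_image_sub_le_of_norm_fderiv_le (𝕜 := ℝ) (fun z _ => hf z) hb (mem_univ y) (mem_univ x)
  rwa [Real.norm_eq_abs, ← dist_eq_norm] at this

lemma sup_hess {d : ℕ} (hd : 1 ≤ d) {u : (Fin d → ℝ) → ℝ} (hu : ContDiff ℝ 2 u) (hp : ZPer d u) :
    ∃ P : ℝ, 0 ≤ P ∧ (∀ i j x, |pd d i (pd d j u) x| ≤ P) ∧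
      ∀ R, (∀ i j x, |pd d i (pd d j u) x| ≤ R) → P ≤ R := by
  have h1 : ∀ q : Fin d × Fin d, ∃ x, ∀ y, |pd d q.1 (pd d q.2 u) y| ≤ |pd d q.1 (pd d q.2 u) x| := by
    intro q
    obtain ⟨x, -, hx⟩ := exists_max_of_per (f := fun x => |pd d q.1 (pd d q.2 u) x|)
      (continuous_pd (contDiff_pd hu q.2) q.1).abs (fun x k => by
        show |pd d q.1 (pd d q.2 u) _| = |pd d q.1 (pd d q.2 u) _|
        rw [pd_per (pd_per hp q.2) q.1])
    exact ⟨x, hx⟩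
  choose X hX using h1
  haveI : Nonempty (Fin d) := ⟨⟨0, hd⟩⟩
  obtain ⟨q, -, hq⟩ := Finset.exists_max_image (Finset.univ : Finset (Fin d × Fin d))
    (fun q => |pd d q.1 (pd d q.2 u) (X q)|) Finset.univ_nonempty
  exact ⟨_, abs_nonneg _, fun i j x => (hX (i, j) x).trans (hq (i, j) (Finset.mem_univ _)),
    fun R hR => hR _ _ _⟩

lemma interp_hess {d : ℕ} {u : (Fin d → ℝ) → ℝ} (hu : ContDiff ℝ 2 u) {K H γ : ℝ} (hγ : 0 < γ) (hH0 : 0 ≤ H)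
    (hK : ∀ i x, |pd d i u x| ≤ K)
    (hH : ∀ i j x y, |pd d i (pd d j u) x - pd d i (pd d j u) y| ≤ H * dist x y ^ γ)
    {t : ℝ} (ht : 0 < t) (i j : Fin d) (x : Fin d → ℝ) :
    |pd d i (pd d j u) x| ≤ 2 * K / t + H * t ^ γ := by
  have hder : ∀ s, HasDerivAt (fun s : ℝ => pd d j u (x + s • Pi.single i (1:ℝ)))
      (pd d i (pd d j u) (x + s • Pi.single i (1:ℝ))) s := by
    intro s
    refine (hasDerivAt_line x (Pi.single i (1:ℝ)) s
      ((contDiff_pd hu j).differentiable (by norm_num) _)).congr_deriv ?_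
    simp [Pi.single_apply]
  obtain ⟨s, hs, hse⟩ := exists_hasDerivAt_eq_slope _ _ ht
    (fun s _ => (hder s).continuousAt.continuousWithinAt) (fun s _ => hder s)
  have hds : dist x (x + s • Pi.single i (1:ℝ)) ≤ t := by
    rw [dist_self_add_right, norm_smul, Real.norm_eq_abs, abs_of_pos hs.1]
    rw [Pi.norm_single, norm_one, mul_one]
    exact hs.2.le
  have h1 := hH i j x (x + s • Pi.single i (1:ℝ))
  have h2 : H * dist x (x + s • Pi.single i (1:ℝ)) ^ γ ≤ H * t ^ γ := by gcongr
  have h3 : |pd d i (pd d j u) (x + s • Pi.single i (1:ℝ))| ≤ 2 * K / t := by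
    rw [hse, abs_div, sub_zero, abs_of_pos ht]
    gcongr
    refine (abs_sub _ _).trans ?_
    linarith [hK j (x + t • Pi.single i (1:ℝ)), hK j (x + (0:ℝ) • Pi.single i (1:ℝ))]
  have := abs_sub_abs_le_abs_sub (pd d i (pd d j u) x) (pd d i (pd d j u) (x + s • Pi.single i (1:ℝ)))
  linarith

lemma lap_bd {d : ℕ} {u : (Fin d → ℝ) → ℝ} {P : ℝ} {x : Fin d → ℝ}
    (h : ∀ i j, |pd d i (pd d j u) x| ≤ P) : |lap u x| ≤ d * P := by
  unfold lap
  refine (Finset.abs_sum_le_sum_abs _ _).trans ((Finset.sum_le_sum fun i _ => h i i).trans ?_)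
  simp

lemma qf_bd {d : ℕ} {u : (Fin d → ℝ) → ℝ} {P S : ℝ} {x p : Fin d → ℝ} (hP : 0 ≤ P) (hS : 0 ≤ S)
    (h : ∀ i j, |pd d i (pd d j u) x| ≤ P) (hp : ∀ i, |p i| ≤ S) : |qf u x p| ≤ d ^ 2 * S ^ 2 * P := by
  unfold qf
  have : ∀ i j, |p i * p j * pd d i (pd d j u) x| ≤ S * S * P := by
    intro i j
    rw [abs_mul, abs_mul]
    exact mul_le_mul (mul_le_mul (hp i) (hp j) (abs_nonneg _) hS) (h i j) (abs_nonneg _) (by positivity)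
  refine (Finset.abs_sum_le_sum_abs _ _).trans ((Finset.sum_le_sum fun i _ =>
    (Finset.abs_sum_le_sum_abs _ _).trans (Finset.sum_le_sum fun j _ => this i j)).trans (le_of_eq ?_))
  simp; ring

lemma qf_diff_bd {d : ℕ} {u : (Fin d → ℝ) → ℝ} {P S δ : ℝ} {x p q : Fin d → ℝ} (hS : 0 ≤ S) (hδ : 0 ≤ δ)
    (h : ∀ i j, |pd d i (pd d j u) x| ≤ P) (hp : ∀ i, |p i| ≤ S) (hq : ∀ i, |q i| ≤ S)
    (hpq : ∀ i, |p i - q i| ≤ δ) :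
    |qf u x p - qf u x q| ≤ d ^ 2 * (2 * S * δ) * P := by
  unfold qf
  rw [← Finset.sum_sub_distrib]
  have : ∀ i j, |p i * p j * pd d i (pd d j u) x - q i * q j * pd d i (pd d j u) x| ≤ (2 * S * δ) * P := by
    intro i j
    rw [← sub_mul, abs_mul]
    refine mul_le_mul ?_ (h i j) (abs_nonneg _) (by positivity)
    have e : p i * p j - q i * q j = p i * (p j - q j) + (p i - q i) * q j := by ring
    rw [e]
    refine (abs_add_le _ _).trans ?_
    rw [abs_mul, abs_mul]
    have h1 := mul_le_mul (hp i) (hpq j) (abs_nonneg _) hS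
    have h2 := mul_le_mul (hpq i) (hq j) (abs_nonneg _) hδ
    linarith
  refine (Finset.abs_sum_le_sum_abs _ _).trans ((Finset.sum_le_sum fun i _ => ?_).trans (le_of_eq ?_) (b := ∑ i : Fin d, ∑ j : Fin d, (2 * S * δ) * P))
  · rw [← Finset.sum_sub_distrib]
    exact (Finset.abs_sum_le_sum_abs _ _).trans (Finset.sum_le_sum fun j _ => this i j)
  · simp; ring

/-- lower order part -/
noncomputable def Rlo {d : ℕ} (V : (Fin d → ℝ) → ℝ) (ε : ℝ) (u : (Fin d → ℝ) → ℝ) (x : Fin d → ℝ) : ℝ :=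
  ∑ i, (ε * pd d i u x ^ 2 + pd d i V x * pd d i u x)

lemma Rlo_bd {d : ℕ} {α : ℝ} {g : ℝ → ℝ} {V : (Fin d → ℝ) → ℝ} {Q ε : ℝ}
    {u m : (Fin d → ℝ) → ℝ} (G : Good d α g V Q ε u m) (x : Fin d → ℝ) : |Rlo V ε u x| ≤ d * (2 * Q ^ 2) := by
  have hQ0 := G.qpos
  unfold Rlo
  have : ∀ i, |ε * pd d i u x ^ 2 + pd d i V x * pd d i u x| ≤ 2 * Q ^ 2 := by
    intro i
    have h1 := mul_le_mul (G.epdu i x) (G.pdu i x) (abs_nonneg _) hQ0.le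
    have h2 := mul_le_mul (G.pdv i x) (G.pdu i x) (abs_nonneg _) hQ0.le
    refine (abs_add_le _ _).trans ?_
    rw [abs_mul, abs_mul, abs_of_pos G.epos, abs_pow]
    nlinarith
  refine (Finset.abs_sum_le_sum_abs _ _).trans ((Finset.sum_le_sum fun i _ => this i).trans (le_of_eq ?_))
  simp

lemma Rlo_diff {d : ℕ} {α : ℝ} {g : ℝ → ℝ} {V : (Fin d → ℝ) → ℝ} {Q ε : ℝ}
    {u m : (Fin d → ℝ) → ℝ} (G : Good d α g V Q ε u m) {x y : Fin d → ℝ} {W : ℝ} (hW : 0 ≤ W)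
    (hu : ∀ i, |pd d i u x - pd d i u y| ≤ W) (hr : dist x y ^ α ≤ W) :
    |Rlo V ε u x - Rlo V ε u y| ≤ d * (4 * Q ^ 2 * W) := by
  have hQ0 := G.qpos
  have hQ := G.q1
  unfold Rlo
  rw [← Finset.sum_sub_distrib]
  have : ∀ i, |(ε * pd d i u x ^ 2 + pd d i V x * pd d i u x) - (ε * pd d i u y ^ 2 + pd d i V y * pd d i u y)|
      ≤ 4 * Q ^ 2 * W := by
    intro i
    have e : (ε * pd d i u x ^ 2 + pd d i V x * pd d i u x) - (ε * pd d i u y ^ 2 + pd d i V y * pd d i u y)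
      = (ε * pd d i u x) * (pd d i u x - pd d i u y) + (ε * pd d i u y) * (pd d i u x - pd d i u y)
        + pd d i V x * (pd d i u x - pd d i u y) + pd d i u y * (pd d i V x - pd d i V y) := by ring
    rw [e]
    have a1 : |ε * pd d i u x| ≤ Q := by rw [abs_mul, abs_of_pos G.epos]; exact G.epdu i x
    have a2 : |ε * pd d i u y| ≤ Q := by rw [abs_mul, abs_of_pos G.epos]; exact G.epdu i y
    have a3 : |pd d i V x - pd d i V y| ≤ Q * W :=
      (G.v_hold i x y).trans (mul_le_mul_of_nonneg_left hr hQ0.le)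
    have b1 := mul_le_mul a1 (hu i) (abs_nonneg _) hQ0.le
    have b2 := mul_le_mul a2 (hu i) (abs_nonneg _) hQ0.le
    have b3 := mul_le_mul (G.pdv i x) (hu i) (abs_nonneg _) hQ0.le
    have b4 := mul_le_mul (G.pdu i y) a3 (abs_nonneg _) hQ0.le
    have c1 : Q * W ≤ Q ^ 2 * W := by
      apply mul_le_mul_of_nonneg_right _ hW
      nlinarith
    refine (abs_add_le _ _).trans ?_
    refine (add_le_add (abs_add_le _ _) le_rfl).trans ?_
    refine (add_le_add (add_le_add (abs_add_le _ _) le_rfl) le_rfl).trans ?_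
    rw [← abs_mul] at b1 b2 b3 b4
    linarith
  refine (Finset.abs_sum_le_sum_abs _ _).trans ((Finset.sum_le_sum fun i _ => this i).trans (le_of_eq ?_))
  simp

lemma kap_bd {d : ℕ} {α : ℝ} {g : ℝ → ℝ} {V : (Fin d → ℝ) → ℝ} {Q ε : ℝ}
    {u m : (Fin d → ℝ) → ℝ} (G : Good d α g V Q ε u m) (x : Fin d → ℝ) :
    0 < 1 / deriv g (m x) ∧ 1 / deriv g (m x) ≤ Q := by
  have hg := G.gp_pos x
  have hQ0 := G.qpos
  refine ⟨by positivity, ?_⟩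
  rw [one_div_le hg hQ0]
  exact G.gp_lo x

lemma kap_diff {d : ℕ} {α : ℝ} {g : ℝ → ℝ} {V : (Fin d → ℝ) → ℝ} {Q ε : ℝ}
    {u m : (Fin d → ℝ) → ℝ} (G : Good d α g V Q ε u m) {x y : Fin d → ℝ} {W : ℝ} (hr : |m x - m y| ^ α ≤ W) :
    |1 / deriv g (m x) - 1 / deriv g (m y)| ≤ Q ^ 3 * W := by
  have hx := G.gp_pos x
  have hy := G.gp_pos y
  have hQ0 := G.qpos
  have e : 1 / deriv g (m x) - 1 / deriv g (m y) =
      (1 / deriv g (m x)) * (1 / deriv g (m y)) * (deriv g (m y) - deriv g (m x)) := by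
    field_simp
  rw [e, abs_mul, abs_mul, abs_sub_comm, abs_of_pos (kap_bd G x).1, abs_of_pos (kap_bd G y).1]
  have h1 := (G.gp_hold x y).trans (mul_le_mul_of_nonneg_left hr hQ0.le)
  have h2 := mul_le_mul (kap_bd G x).2 (kap_bd G y).2 (kap_bd G y).1.le hQ0.le
  have h3 := mul_le_mul h2 h1 (abs_nonneg _) (by positivity)
  linarith

lemma eqn {d : ℕ} {α : ℝ} {g : ℝ → ℝ} {V : (Fin d → ℝ) → ℝ} {Q ε : ℝ}
    {u m : (Fin d → ℝ) → ℝ} (G : Good d α g V Q ε u m) (x : Fin d → ℝ) :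
    Aop (m x) (1 / deriv g (m x)) (fun i => pd d i u x) u x =
      ε * (m x - 1) - 1 / deriv g (m x) * Rlo V ε u x := by
  have h := sol_nondiv' G.sol G.ghyp G.vhyp x (G.m_pos x) (G.gp_pos x)
  unfold Aop Rlo
  rw [Finset.sum_add_distrib, ← Finset.mul_sum]
  unfold gradSq at h
  rw [← h]; ring

open MeasureTheory Set Filter Topology
open scoped ENNReal

set_option maxHeartbeats 1000000 in
lemma core_near {d : ℕ} (hd : 1 ≤ d) {α : ℝ} {g : ℝ → ℝ} {V : (Fin d → ℝ) → ℝ} {Q ε : ℝ}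
    {u m : (Fin d → ℝ) → ℝ} (G : Good d α g V Q ε u m) {P σ W : ℝ} (hP : 0 ≤ P)
    (hPb : ∀ i j x, |pd d i (pd d j u) x| ≤ P) (hσ0 : 0 ≤ σ) (hσ1 : σ ≤ 1)
    (hS : ∀ i x, |pd d i u x| ≤ Q * σ) (hW : 0 ≤ W) {x x0 : Fin d → ℝ}
    (h1 : ε * |m x - m x0| ≤ W) (h2 : |m x - m x0| ≤ σ * W) (h3 : |m x - m x0| ^ α ≤ W)
    (h4 : ∀ i, |pd d i u x - pd d i u x0| ≤ W) (h5 : dist x x0 ^ α ≤ W) :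
    |Aop (m x0) (1 / deriv g (m x0)) (fun i => pd d i u x0) u x -
      Aop (m x0) (1 / deriv g (m x0)) (fun i => pd d i u x0) u x0| ≤
      8 * d ^ 2 * Q ^ 5 * (1 + σ * P) * W := by
  have hQ := G.q1
  have hQ0 := G.qpos
  have ex := eqn G x
  have e0 := eqn G x0
  have k1 := kap_bd G x
  have k2 := kap_diff G h3
  have r0 := Rlo_bd G x0
  have r1 := Rlo_diff G hW h4 h5
  have l1 := lap_bd (hPb · · x)
  have q1 := qf_bd (p := fun i => pd d i u x0) hP (by positivity) (hPb · · x) (hS · x0)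
  have q2 := qf_diff_bd (p := fun i => pd d i u x0) (q := fun i => pd d i u x) (by positivity) hW
    (hPb · · x) (hS · x0) (hS · x) (fun i => by rw [abs_sub_comm]; exact h4 i)
  rw [e0]
  have ex' : Aop (m x0) (1 / deriv g (m x0)) (fun i => pd d i u x0) u x =
    (m x0 - m x) * lap u x + (1 / deriv g (m x0) - 1 / deriv g (m x)) * qf u x (fun i => pd d i u x0)
    + 1 / deriv g (m x) * (qf u x (fun i => pd d i u x0) - qf u x (fun i => pd d i u x))
    + (ε * (m x - 1) - 1 / deriv g (m x) * Rlo V ε u x) := by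
    rw [← ex]; unfold Aop; ring
  rw [ex']
  clear ex ex' e0
  have hd1 : (1:ℝ) ≤ d := by exact_mod_cast hd
  have hε := G.epos
  rw [abs_sub_comm] at k2 h2
  generalize 1 / deriv g (m x) = κ at *
  generalize 1 / deriv g (m x0) = κ' at *
  generalize qf u x (fun i => pd d i u x0) = q at *
  generalize qf u x (fun i => pd d i u x) = q' at *
  generalize lap u x = l at *
  generalize Rlo V ε u x = R at *
  generalize Rlo V ε u x0 = R' at *
  generalize m x = M at *
  generalize m x0 = M' at *
  have e : (M' - M) * l + (κ' - κ) * q + κ * (q - q') + (ε * (M - 1) - κ * R) - (ε * (M' - 1) - κ' * R')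
    = (M' - M) * l + (κ' - κ) * q + κ * (q - q') + ε * (M - M') + (-κ) * (R - R') + (κ' - κ) * R' := by ring
  rw [e]
  have t1 : |(M' - M) * l| ≤ (σ * W) * (d * P) := by
    rw [abs_mul]; exact mul_le_mul h2 l1 (abs_nonneg _) (by positivity)
  have t2 : |(κ' - κ) * q| ≤ (Q ^ 3 * W) * (d ^ 2 * (Q * σ) ^ 2 * P) := by
    rw [abs_mul]; exact mul_le_mul k2 q1 (abs_nonneg _) (by positivity)
  have t3 : |κ * (q - q')| ≤ Q * (d ^ 2 * (2 * (Q * σ) * W) * P) := by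
    rw [abs_mul, abs_of_pos k1.1]; exact mul_le_mul k1.2 q2 (abs_nonneg _) (by positivity)
  have t4 : |ε * (M - M')| ≤ W := by rw [abs_mul, abs_of_pos hε]; exact h1
  have t5 : |(-κ) * (R - R')| ≤ Q * (d * (4 * Q ^ 2 * W)) := by
    rw [abs_mul, abs_neg, abs_of_pos k1.1]; exact mul_le_mul k1.2 r1 (abs_nonneg _) (by positivity)
  have t6 : |(κ' - κ) * R'| ≤ (Q ^ 3 * W) * (d * (2 * Q ^ 2)) := by
    rw [abs_mul]; exact mul_le_mul k2 r0 (abs_nonneg _) (by positivity)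
  have s1 : |(M' - M) * l + (κ' - κ) * q + κ * (q - q') + ε * (M - M') + (-κ) * (R - R') + (κ' - κ) * R'| ≤
      |(M' - M) * l| + |(κ' - κ) * q| + |κ * (q - q')| + |ε * (M - M')| + |(-κ) * (R - R')| + |(κ' - κ) * R'| := by
    refine (abs_add_le _ _).trans (add_le_add ?_ le_rfl)
    refine (abs_add_le _ _).trans (add_le_add ?_ le_rfl)
    refine (abs_add_le _ _).trans (add_le_add ?_ le_rfl)
    refine (abs_add_le _ _).trans (add_le_add ?_ le_rfl)
    exact abs_add_le _ _
  refine s1.trans ?_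
  have dd : (d:ℝ) ≤ d ^ 2 := by nlinarith
  have Q1 : 1 ≤ Q ^ 5 := one_le_pow₀ hQ
  have Q2 : Q ^ 2 ≤ Q ^ 5 := pow_le_pow_right₀ hQ (by norm_num)
  have Q3 : Q ^ 3 ≤ Q ^ 5 := pow_le_pow_right₀ hQ (by norm_num)
  have D1 : (1:ℝ) ≤ d ^ 2 * Q ^ 5 := one_le_mul_of_one_le_of_one_le (one_le_pow₀ hd1) Q1
  have a1 : (σ * W) * (d * P) ≤ (d ^ 2 * Q ^ 5) * (σ * P * W) := by
    have : (d:ℝ) ≤ d ^ 2 * Q ^ 5 := dd.trans (le_mul_of_one_le_right (by positivity) Q1)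
    calc (σ * W) * (d * P) = d * (σ * P * W) := by ring
      _ ≤ _ := mul_le_mul_of_nonneg_right this (by positivity)
  have a2 : (Q ^ 3 * W) * (d ^ 2 * (Q * σ) ^ 2 * P) ≤ (d ^ 2 * Q ^ 5) * (σ * P * W) := by
    calc (Q ^ 3 * W) * (d ^ 2 * (Q * σ) ^ 2 * P) = (d ^ 2 * Q ^ 5 * (σ * P * W)) * σ := by ring
      _ ≤ _ := mul_le_of_le_one_right (by positivity) hσ1
  have a3 : Q * (d ^ 2 * (2 * (Q * σ) * W) * P) ≤ 2 * (d ^ 2 * Q ^ 5) * (σ * P * W) := by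
    calc Q * (d ^ 2 * (2 * (Q * σ) * W) * P) = (2 * (d ^ 2 * Q ^ 2)) * (σ * P * W) := by ring
      _ ≤ _ := by gcongr
  have a4 : W ≤ d ^ 2 * Q ^ 5 * W := le_mul_of_one_le_left hW D1
  have a5 : Q * (d * (4 * Q ^ 2 * W)) ≤ 4 * (d ^ 2 * Q ^ 5) * W := by
    calc Q * (d * (4 * Q ^ 2 * W)) = 4 * (d * Q ^ 3) * W := by ring
      _ ≤ _ := by gcongr
  have a6 : (Q ^ 3 * W) * (d * (2 * Q ^ 2)) ≤ 2 * (d ^ 2 * Q ^ 5) * W := by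
    calc (Q ^ 3 * W) * (d * (2 * Q ^ 2)) = 2 * (d * Q ^ 5) * W := by ring
      _ ≤ _ := by gcongr
  have a7 : 0 ≤ (d ^ 2 * Q ^ 5) * (σ * P * W) := by positivity
  have a8 : 0 ≤ (d ^ 2 * Q ^ 5) * W := by positivity
  have e9 : 8 * d ^ 2 * Q ^ 5 * (1 + σ * P) * W = 8 * ((d ^ 2 * Q ^ 5) * W) + 8 * ((d ^ 2 * Q ^ 5) * (σ * P * W)) := by ring
  rw [e9]
  linarith

lemma core_far {d : ℕ} (hd : 1 ≤ d) {α : ℝ} {g : ℝ → ℝ} {V : (Fin d → ℝ) → ℝ} {Q ε : ℝ}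
    {u m : (Fin d → ℝ) → ℝ} (G : Good d α g V Q ε u m) {P : ℝ} (hP : 0 ≤ P)
    (hPb : ∀ i j x, |pd d i (pd d j u) x| ≤ P) (x x0 : Fin d → ℝ) :
    |Aop (m x0) (1 / deriv g (m x0)) (fun i => pd d i u x0) u x -
      Aop (m x0) (1 / deriv g (m x0)) (fun i => pd d i u x0) u x0| ≤
      8 * d ^ 2 * Q ^ 5 * P := by
  have hQ := G.q1
  have hQ0 := G.qpos
  have hd1 : (1:ℝ) ≤ d := by exact_mod_cast hd
  have dd : (d:ℝ) ≤ d ^ 2 := by nlinarith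
  have Q1 : Q ≤ Q ^ 5 := le_self_pow₀ hQ (by norm_num)
  have Q3 : Q ^ 3 ≤ Q ^ 5 := pow_le_pow_right₀ hQ (by norm_num)
  have key : ∀ y, |Aop (m x0) (1 / deriv g (m x0)) (fun i => pd d i u x0) u y| ≤ 2 * (d ^ 2 * Q ^ 5 * P) := by
    intro y
    have l1 := lap_bd (hPb · · y)
    have q1 := qf_bd (p := fun i => pd d i u x0) hP hQ0.le (hPb · · y) (G.pdu · x0)
    unfold Aop
    refine (abs_add_le _ _).trans ?_
    rw [abs_mul, abs_mul, abs_of_pos (G.m_pos x0), abs_of_pos (kap_bd G x0).1]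
    have t1 := mul_le_mul (G.m_hi x0) l1 (abs_nonneg _) hQ0.le
    have t2 := mul_le_mul (kap_bd G x0).2 q1 (abs_nonneg _) hQ0.le
    have t3 : Q * (d * P) ≤ d ^ 2 * Q ^ 5 * P := by
      calc Q * (d * P) = d * Q * P := by ring
        _ ≤ _ := by gcongr
    have t4 : Q * (d ^ 2 * Q ^ 2 * P) ≤ d ^ 2 * Q ^ 5 * P := by
      calc Q * (d ^ 2 * Q ^ 2 * P) = d ^ 2 * Q ^ 3 * P := by ring
        _ ≤ _ := by gcongr
    linarith
  refine (abs_sub _ _).trans ?_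
  have : 0 ≤ d ^ 2 * Q ^ 5 * P := by positivity
  linarith [key x, key x0]

/-- `u_ij` is `γ`-Hölder for `γ ≤ α` -/
lemma apriori_hold {d : ℕ} {α γ : ℝ} {u : (Fin d → ℝ) → ℝ} (hu : C2Hold d α u) (hγ0 : 0 < γ) (hγα : γ ≤ α) {P : ℝ}
    (hPb : ∀ i j x, |pd d i (pd d j u) x| ≤ P) :
    ∃ H0, ∀ i j x y, |pd d i (pd d j u) x - pd d i (pd d j u) y| ≤ H0 * dist x y ^ γ := by
  choose C hC0 hC using hu.2
  refine ⟨(∑ i, ∑ j, C i j) + 2 * |P|, fun i j x y => ?_⟩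
  have h1 : C i j ≤ ∑ i, ∑ j, C i j :=
    (Finset.single_le_sum (f := fun j => C i j) (fun j _ => hC0 i j) (Finset.mem_univ j)).trans
      (Finset.single_le_sum (f := fun i => ∑ j, C i j) (fun i _ => Finset.sum_nonneg fun j _ => hC0 i j)
        (Finset.mem_univ i))
  have h0 := hC0 i j
  rcases le_total (dist x y) 1 with h | h
  · refine (hC i j x y).trans ?_
    refine mul_le_mul (by linarith [abs_nonneg P]) ?_ (by positivity) (by linarith [abs_nonneg P])
    rcases eq_or_lt_of_le (dist_nonneg (x := x) (y := y)) with h' | h'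
    · rw [← h', Real.zero_rpow hγ0.ne', Real.zero_rpow (by linarith)]
    · exact Real.rpow_le_rpow_of_exponent_ge h' h hγα
  · have := Real.one_le_rpow h hγ0.le
    have h2 : |pd d i (pd d j u) x - pd d i (pd d j u) y| ≤ 2 * |P| := by
      refine (abs_sub _ _).trans ?_
      linarith [hPb i j x, hPb i j y, le_abs_self P]
    have h3 : 0 ≤ (∑ i, ∑ j, C i j) + 2 * |P| := by linarith [abs_nonneg P]
    nlinarith

theorem core {d : ℕ} (hd : 1 ≤ d) {α γ : ℝ} {g : ℝ → ℝ} {V : (Fin d → ℝ) → ℝ} {Q : ℝ} (hQ : 1 ≤ Q)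
    (hγ0 : 0 < γ) (hγ1 : γ < 1) (hγα : γ ≤ α) :
    ∃ C : ℝ, 0 < C ∧ ∀ (ε : ℝ) (u m : (Fin d → ℝ) → ℝ), Good d α g V Q ε u m →
      ∀ P A X σ : ℝ, 0 ≤ P → (∀ i j x, |pd d i (pd d j u) x| ≤ P) → 1 ≤ A → 1 ≤ X → 0 ≤ σ → σ ≤ 1 →
      (∀ i x, |pd d i u x| ≤ Q * σ) →
      (∀ x y, dist x y ≤ 1 → ε * |m x - m y| ≤ A * X * dist x y ^ γ ∧
        |m x - m y| ≤ σ * (A * X * dist x y ^ γ) ∧ |m x - m y| ^ α ≤ A * X * dist x y ^ γ ∧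
        ∀ i, |pd d i u x - pd d i u y| ≤ A * X * dist x y ^ γ) →
      ∀ i j x y, |pd d i (pd d j u) x - pd d i (pd d j u) y| ≤
        C * A * (X * (1 + σ * P) + P) * dist x y ^ γ := by
  have hQ0 : 0 < Q := by linarith
  have hd1 : (1:ℝ) ≤ d := by exact_mod_cast hd
  obtain ⟨C, hC, hCs⟩ := schauder hd hγ0 hγ1 (lam := 1 / Q) (Lam := Q ^ 3) (by positivity) (by positivity)
  refine ⟨C * (8 * d ^ 2 * Q ^ 5), by positivity, ?_⟩
  intro ε u m G P A X σ hP hPb hA hX hσ0 hσ1 hS hyp i j x y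
  obtain ⟨H0, hH0⟩ := apriori_hold G.sol.reg_u hγ0 hγα hPb
  have h := hCs u G.sol.reg_u.1 (8 * d ^ 2 * Q ^ 5 * (A * (X * (1 + σ * P) + P))) H0 (by positivity) hH0 ?_ i j x y
  · refine h.trans (le_of_eq (by ring))
  · intro x0
    refine ⟨m x0, 1 / deriv g (m x0), fun i => pd d i u x0, G.m_lo x0,
      (G.m_hi x0).trans (le_self_pow₀ hQ (by norm_num)), (kap_bd G x0).1.le, ?_, fun x => ?_⟩
    · have := mul_le_mul (kap_bd G x0).2 (G.du x0) (gradSq_nonneg x0) hQ0.le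
      unfold gradSq at this
      refine this.trans (le_of_eq (by ring))
    · rcases le_total (dist x x0) 1 with hr | hr
      · obtain ⟨h1, h2, h3, h4⟩ := hyp x x0 hr
        have hr0 : 0 ≤ dist x x0 ^ γ := by positivity
        have h5 : dist x x0 ^ α ≤ A * X * dist x x0 ^ γ := by
          have hax : 1 ≤ A * X := one_le_mul_of_one_le_of_one_le hA hX
          refine le_trans ?_ (le_mul_of_one_le_left hr0 hax)
          rcases eq_or_lt_of_le (dist_nonneg (x := x) (y := x0)) with h' | h'
          · rw [← h', Real.zero_rpow hγ0.ne', Real.zero_rpow (by linarith)]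
          · exact Real.rpow_le_rpow_of_exponent_ge h' hr hγα
        refine (core_near hd G hP hPb hσ0 hσ1 hS (by positivity) h1 h2 h3 h4 h5).trans ?_
        calc 8 * d ^ 2 * Q ^ 5 * (1 + σ * P) * (A * X * dist x x0 ^ γ)
            = 8 * d ^ 2 * Q ^ 5 * (A * (X * (1 + σ * P))) * dist x x0 ^ γ := by ring
          _ ≤ _ := by gcongr; linarith
      · have hr1 := Real.one_le_rpow hr hγ0.le
        refine (core_far hd G hP hPb x x0).trans ?_
        have h1 : P ≤ A * (X * (1 + σ * P) + P) := by
          have : 0 ≤ X * (1 + σ * P) := by positivity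
          calc P ≤ X * (1 + σ * P) + P := by linarith
            _ ≤ _ := le_mul_of_one_le_left (by positivity) hA
        calc 8 * d ^ 2 * Q ^ 5 * P ≤ 8 * d ^ 2 * Q ^ 5 * (A * (X * (1 + σ * P) + P)) := by gcongr
          _ ≤ _ := le_mul_of_one_le_right (by positivity) hr1

open MeasureTheory Set Filter Topology
open scoped ENNReal

lemma rpow_mono_exp {r a b : ℝ} (h0 : 0 ≤ r) (h1 : r ≤ 1) (ha : 0 < a) (hab : a ≤ b) : r ^ b ≤ r ^ a := by
  rcases eq_or_lt_of_le h0 with h' | h'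
  · rw [← h', Real.zero_rpow ha.ne', Real.zero_rpow (by linarith)]
  · exact Real.rpow_le_rpow_of_exponent_ge h' h1 hab

set_option maxHeartbeats 1000000 in
theorem small_case {d : ℕ} (hd : 2 ≤ d) {α : ℝ} (hα0 : 0 < α) (hα1 : α < 1) {g : ℝ → ℝ} {V : (Fin d → ℝ) → ℝ}
    {Q E : ℝ} (hQ : 1 ≤ Q) (hE : 0 < E) :
    ∃ γ C : ℝ, 0 < γ ∧ γ < 1 ∧ 0 < C ∧ ∀ ε ≤ E, ∀ u m : (Fin d → ℝ) → ℝ, Good d α g V Q ε u m →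
      (∀ i j x, |pd d i (pd d j u) x| ≤ C) ∧
      ∀ i j x y, |pd d i (pd d j u) x - pd d i (pd d j u) y| ≤ C * dist x y ^ γ := by
  have hQ0 : 0 < Q := by linarith
  obtain ⟨γ0, C0, hγ0, hγ1, hC0, hdu⟩ := du_holder hd (α := α) (g := g) (V := V) (E := E) hQ
  have hγ : 0 < α * γ0 := by positivity
  have hγ' : α * γ0 < 1 := by nlinarith
  obtain ⟨C1, hC1, hcore⟩ := core (d := d) (by omega) (α := α) (g := g) (V := V) hQ hγ hγ' (by nlinarith)
  set γ := α * γ0 with hγdef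
  set B : ℝ := Q * (2 * d * Q + d * Q * C0) + 1 with hB
  have hB1 : 1 ≤ B := by rw [hB]; have : 0 ≤ Q * (2 * d * Q + d * Q * C0) := by positivity
                         linarith
  set A : ℝ := (1 + E) * B + C0 with hA
  have hAB : B ≤ A := by rw [hA]; nlinarith
  have hA1 : 1 ≤ A := hB1.trans hAB
  have hAE : E * B ≤ A := by rw [hA]; nlinarith
  have hAC : C0 ≤ A := by rw [hA]; nlinarith
  set K := C1 * A with hK
  have hK0 : 0 < K := by positivity
  obtain ⟨t, ht0, ht⟩ : ∃ t : ℝ, 0 < t ∧ K * t ^ γ = 1 / 4 := by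
    refine ⟨(1 / (4 * K)) ^ γ⁻¹, by positivity, ?_⟩
    rw [Real.rpow_inv_rpow (by positivity) hγ.ne']
    field_simp
  set R := 4 * Q / t + 1 with hR
  have hR0 : 0 < R := by positivity
  refine ⟨γ, R + K * (1 + 2 * R), hγ, hγ', by positivity, fun ε hε u m G => ?_⟩
  have hu2 := G.sol.reg_u.1
  obtain ⟨P, hP, hPb, hPmin⟩ := sup_hess (by omega : 1 ≤ d) hu2 G.sol.per_u
  have hm : ∀ x y, dist x y ≤ 1 → |m x - m y| ≤ B * dist x y ^ γ0 := by
    intro x y hr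
    have hrr : dist x y ≤ dist x y ^ γ0 := by
      have := rpow_mono_exp dist_nonneg hr hγ0 hγ1.le
      rwa [Real.rpow_one] at this
    have a1 : ε * |u x - u y| ≤ d * Q * dist x y ^ γ0 := by
      have := lip_of_pd (hu2.differentiable (by norm_num)) (L := Q / ε)
        (fun i x => by rw [le_div_iff₀ G.epos, mul_comm]; exact G.epdu i x)
        (div_nonneg hQ0.le G.epos.le) x y
      calc ε * |u x - u y| ≤ ε * (d * (Q / ε) * dist x y) := mul_le_mul_of_nonneg_left this G.epos.le
        _ = d * Q * dist x y := by have := G.epos.ne'; field_simp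
        _ ≤ _ := by gcongr
    have a2 : |V x - V y| ≤ d * Q * dist x y ^ γ0 := by
      refine (lip_of_pd (G.vhyp.2.1.differentiable (by norm_num)) G.pdv hQ0.le x y).trans ?_
      gcongr
    have a3 : |gradSq d u x - gradSq d u y| ≤ d * (2 * Q * (C0 * dist x y ^ γ0)) := by
      unfold gradSq
      rw [← Finset.sum_sub_distrib]
      have : ∀ i, |pd d i u x ^ 2 - pd d i u y ^ 2| ≤ 2 * Q * (C0 * dist x y ^ γ0) := by
        intro i
        rw [sq_sub_sq, abs_mul]
        refine mul_le_mul ?_ (hdu ε hε u m G i x y) (abs_nonneg _) (by positivity)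
        exact (abs_add_le _ _).trans (by linarith [G.pdu i x, G.pdu i y])
      refine (Finset.abs_sum_le_sum_abs _ _).trans ((Finset.sum_le_sum fun i _ => this i).trans (le_of_eq ?_))
      simp
    have a4 := G.m_le_g x y
    have e : g (m x) - g (m y) = ε * (u x - u y) + (V x - V y) + (1 / 2) * (gradSq d u x - gradSq d u y) := by
      rw [← G.sol.hj x, ← G.sol.hj y]; ring
    have a5 : |g (m x) - g (m y)| ≤ (2 * d * Q + d * Q * C0) * dist x y ^ γ0 := by
      rw [e]
      refine (abs_add_le _ _).trans ((add_le_add (abs_add_le _ _) le_rfl).trans ?_)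
      rw [abs_mul, abs_mul, abs_of_pos G.epos, abs_of_pos (by norm_num : (0:ℝ) < 1 / 2)]
      linarith
    have a6 := mul_le_mul_of_nonneg_left a5 hQ0.le
    have a7 : 0 ≤ dist x y ^ γ0 := by positivity
    rw [hB]
    linarith
  have hH := hcore ε u m G P A 1 1 hP hPb hA1 le_rfl zero_le_one le_rfl (fun i x => by
    rw [mul_one]; exact G.pdu i x) (fun x y hr => by
    have h1 := hm x y hr
    have h2 : dist x y ^ γ0 ≤ dist x y ^ γ := rpow_mono_exp dist_nonneg hr hγ (by rw [hγdef]; nlinarith)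
    have h0 : 0 ≤ dist x y ^ γ := by positivity
    have h3 : |m x - m y| ≤ B * dist x y ^ γ := h1.trans (by gcongr)
    have h4 : B * dist x y ^ γ ≤ A * 1 * dist x y ^ γ := by rw [mul_one]; gcongr
    refine ⟨?_, by rw [one_mul]; exact h3.trans h4, ?_, fun i => ?_⟩
    · calc ε * |m x - m y| ≤ E * (B * dist x y ^ γ) := by gcongr
        _ = (E * B) * dist x y ^ γ := by ring
        _ ≤ _ := by rw [mul_one]; gcongr
    · refine le_trans ?_ h4
      calc |m x - m y| ^ α ≤ (B * dist x y ^ γ0) ^ α := by gcongr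
        _ = B ^ α * dist x y ^ γ := by
          rw [Real.mul_rpow (by positivity) (by positivity), ← Real.rpow_mul dist_nonneg, hγdef, mul_comm γ0]
        _ ≤ B * dist x y ^ γ := by
          gcongr
          calc B ^ α ≤ B ^ (1:ℝ) := Real.rpow_le_rpow_of_exponent_le hB1 hα1.le
            _ = B := Real.rpow_one B
    · refine (hdu ε hε u m G i x y).trans ?_
      rw [mul_one]
      gcongr)
  have hPR : P ≤ R := by
    have h1 := hPmin _ (fun i j x => interp_hess hu2 hγ (by positivity) G.pdu hH ht0 i j x)
    have h2 : C1 * A * (1 * (1 + 1 * P) + P) * t ^ γ = (K * t ^ γ) * (1 + 2 * P) := by rw [hK]; ring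
    rw [h2, ht] at h1
    rw [hR]
    have : 4 * Q / t = 2 * (2 * Q / t) := by ring
    rw [this]
    linarith
  refine ⟨fun i j x => ?_, fun i j x y => ?_⟩
  · have : 0 ≤ K * (1 + 2 * R) := by positivity
    linarith [hPb i j x]
  · refine (hH i j x y).trans ?_
    have h3 : C1 * A * (1 * (1 + 1 * P) + P) ≤ R + K * (1 + 2 * R) := by
      have : C1 * A * (1 * (1 + 1 * P) + P) = K * (1 + 2 * P) := by rw [hK]; ring
      rw [this]
      have : K * (1 + 2 * P) ≤ K * (1 + 2 * R) := by gcongr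
      linarith
    gcongr

lemma le_rpow_of_le {t ρ γ : ℝ} (h0 : 0 ≤ t) (h1 : t ≤ 1) (h2 : t ≤ ρ) (hγ0 : 0 < γ) (hγ1 : γ ≤ 1) : t ≤ ρ ^ γ := by
  have := rpow_mono_exp h0 h1 hγ0 hγ1
  rw [Real.rpow_one] at this
  exact this.trans (Real.rpow_le_rpow h0 h2 hγ0.le)

set_option maxHeartbeats 1000000 in
theorem large_case {d : ℕ} (hd : 2 ≤ d) {α : ℝ} (hα0 : 0 < α) (hα1 : α < 1) {g : ℝ → ℝ} {V : (Fin d → ℝ) → ℝ}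
    {Q : ℝ} (hQ : 1 ≤ Q) :
    ∃ E γ C : ℝ, 0 < E ∧ 0 < γ ∧ γ < 1 ∧ 0 < C ∧ ∀ ε, E ≤ ε → ∀ u m : (Fin d → ℝ) → ℝ, Good d α g V Q ε u m →
      (∀ i j x, |pd d i (pd d j u) x| ≤ C) ∧
      ∀ i j x y, |pd d i (pd d j u) x - pd d i (pd d j u) y| ≤ C * dist x y ^ γ := by
  have hQ0 : 0 < Q := by linarith
  have hγ : 0 < α / (1 + α) := by positivity
  have hγα : α / (1 + α) ≤ α := div_le_self hα0.le (by linarith)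
  have hγ' : α / (1 + α) < 1 := by linarith
  obtain ⟨C1, hC1, hcore⟩ := core (d := d) (by omega) (α := α) (g := g) (V := V) hQ hγ hγ' hγα
  set γ := α / (1 + α) with hγdef
  have hγe : (1 + α) * (1 - γ) = 1 := by rw [hγdef]; field_simp; ring
  set A : ℝ := 60 * (d + 1) ^ 2 * Q ^ 6 + d * (d + 2) * Q ^ 2 + 2 * Q + d with hA
  have a0 : 0 ≤ 60 * ((d:ℝ) + 1) ^ 2 * Q ^ 6 := by positivity
  have a1 : 0 ≤ (d:ℝ) * (d + 2) * Q ^ 2 := by positivity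
  have a2 : (0:ℝ) ≤ d := by positivity
  have hA1 : 1 ≤ A := by linarith
  have hA0 : 0 < A := by linarith
  set K := C1 * A with hK
  have hK0 : 0 < K := by positivity
  obtain ⟨s, hs0, hs⟩ : ∃ t : ℝ, 0 < t ∧ K * t ^ γ = 1 / 12 := by
    refine ⟨(1 / (12 * K)) ^ γ⁻¹, by positivity, ?_⟩
    rw [Real.rpow_inv_rpow (by positivity) hγ.ne']
    field_simp
  refine ⟨1 + 8 * Q / s, γ, 1 + 5 * K, by positivity, hγ, hγ', by positivity, fun ε hε u m G => ?_⟩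
  have hs8 : 0 < 8 * Q / s := by positivity
  have hε1 : 1 ≤ ε := by linarith
  have hε0 := G.epos
  have hεs : 8 * Q / s ≤ ε := by linarith
  have hu2 := G.sol.reg_u.1
  obtain ⟨P, hP, hPb, hPmin⟩ := sup_hess (by omega : 1 ≤ d) hu2 G.sol.per_u
  set T := 1 + P with hT
  have hT1 : 1 ≤ T := by linarith
  have hT0 : 0 < T := by linarith
  have hXT : T ^ γ ≤ T := by
    have := Real.rpow_le_rpow_of_exponent_le hT1 hγ'.le
    rwa [Real.rpow_one] at this
  have hX1 : 1 ≤ T ^ γ := Real.one_le_rpow hT1 hγ.le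
  have hDu : ∀ i x, |pd d i u x| ≤ Q * (1 / ε) := by
    intro i x
    rw [mul_one_div, le_div_iff₀ hε0, mul_comm]
    exact G.epdu i x
  -- gradient of m
  have hDm : ∀ k x, |pd d k m x| ≤ (d + 2) * Q ^ 2 * T := by
    intro k x
    have h1 := pd_hj G.sol G.ghyp G.vhyp k x (G.m_pos x)
    have h2 : pd d k m x = 1 / deriv g (m x) *
        (∑ j, pd d j u x * pd d k (pd d j u) x + ε * pd d k u x + pd d k V x) := by
      rw [one_div, eq_inv_mul_iff_mul_eq₀ (G.gp_pos x).ne', h1]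
    have h3 : |∑ j, pd d j u x * pd d k (pd d j u) x| ≤ d * (Q * P) := by
      have : ∀ j, |pd d j u x * pd d k (pd d j u) x| ≤ Q * P := fun j => by
        rw [abs_mul]; exact mul_le_mul (G.pdu j x) (hPb k j x) (abs_nonneg _) hQ0.le
      refine (Finset.abs_sum_le_sum_abs _ _).trans ((Finset.sum_le_sum fun i _ => this i).trans (le_of_eq ?_))
      simp
    have h4 : |ε * pd d k u x| ≤ Q := by rw [abs_mul, abs_of_pos hε0]; exact G.epdu k x
    have h5 : |∑ j, pd d j u x * pd d k (pd d j u) x + ε * pd d k u x + pd d k V x| ≤ (d + 2) * Q * T := by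
      refine (abs_add_le _ _).trans ((add_le_add (abs_add_le _ _) le_rfl).trans ?_)
      have h6 := G.pdv k x
      have h7 : Q ≤ Q * T := le_mul_of_one_le_right hQ0.le hT1
      have h8 : d * (Q * P) ≤ d * (Q * T) := by gcongr; linarith
      nlinarith
    rw [h2, abs_mul, abs_of_pos (kap_bd G x).1]
    refine (mul_le_mul (kap_bd G x).2 h5 (abs_nonneg _) hQ0.le).trans (le_of_eq (by ring))
  have hH := hcore ε u m G P A (T ^ γ) (1 / ε) hP hPb hA1 hX1 (by positivity)
    (by rw [div_le_one hε0]; exact hε1) hDu (fun x y hr => by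
    have hρ : T ^ γ * dist x y ^ γ = (T * dist x y) ^ γ := (Real.mul_rpow hT0.le dist_nonneg).symm
    rw [mul_assoc, hρ]
    have hρ0 : 0 ≤ T * dist x y := by positivity
    set ρ := T * dist x y with hρdef
    -- normalized difference of m
    have b1 : |m x - m y| ≤ A * ε ^ (-1 - α) := by
      have h1 := m3_main hα0 hα1 G hε1 x
      have h2 := m3_main hα0 hα1 G hε1 y
      have h3 : |m x - m y| ≤ |m x - 1| + |m y - 1| := by
        have := abs_sub (m x - 1) (m y - 1)
        simpa using this
      have h4 : 0 < ε ^ (-1 - α) := by positivity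
      have h5 : 60 * (d + 1) ^ 2 * Q ^ 6 * ε ^ (-1 - α) ≤ A * ε ^ (-1 - α) := by
        apply mul_le_mul_of_nonneg_right _ h4.le
        linarith
      linarith
    have b2 : |m x - m y| ≤ A * ρ := by
      have h1 := lip_of_pd (G.sol.reg_m.1.differentiable (by norm_num)) hDm (by positivity) x y
      have h2 : (d:ℝ) * ((d + 2) * Q ^ 2 * T) * dist x y = (d * (d + 2) * Q ^ 2) * ρ := by rw [hρdef]; ring
      rw [h2] at h1
      refine h1.trans (mul_le_mul_of_nonneg_right (by linarith) hρ0)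
    obtain ⟨μ, hμ⟩ : ∃ μ, |m x - m y| = A * μ := ⟨|m x - m y| / A, by field_simp⟩
    have hμ0 : 0 ≤ μ := by
      have := abs_nonneg (m x - m y)
      rw [hμ] at this
      exact nonneg_of_mul_nonneg_right this hA0
    rw [hμ] at b1 b2
    have b1 := le_of_mul_le_mul_left b1 hA0
    have b2 := le_of_mul_le_mul_left b2 hA0
    have b3 : ε ^ (-1 - α) ≤ 1 := Real.rpow_le_one_of_one_le_of_nonpos hε1 (by linarith)
    have b4 : μ ≤ (1 / ε) * ρ ^ γ := by
      rcases eq_or_lt_of_le hμ0 with h' | h'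
      · rw [← h']; positivity
      · calc μ = μ ^ (1 - γ) * μ ^ γ := by
              rw [← Real.rpow_add h']; norm_num
          _ ≤ (ε ^ (-1 - α)) ^ (1 - γ) * ρ ^ γ := by
              have : 0 ≤ 1 - γ := by linarith
              gcongr
          _ = (1 / ε) * ρ ^ γ := by
              rw [← Real.rpow_mul hε0.le]
              have : (-1 - α) * (1 - γ) = -1 := by linarith
              rw [this, Real.rpow_neg_one, one_div]
    have b5 : μ ^ α ≤ ρ ^ γ := by
      calc μ ^ α ≤ μ ^ γ := rpow_mono_exp hμ0 (b1.trans b3) hγ hγα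
        _ ≤ _ := by gcongr
    refine ⟨?_, ?_, ?_, fun i => ?_⟩
    · rw [hμ]
      calc ε * (A * μ) ≤ ε * (A * ((1 / ε) * ρ ^ γ)) := by gcongr
        _ = _ := by field_simp
    · rw [hμ]
      calc A * μ ≤ A * ((1 / ε) * ρ ^ γ) := by gcongr
        _ = _ := by ring
    · rw [hμ, Real.mul_rpow hA0.le hμ0]
      refine mul_le_mul ?_ b5 (by positivity) hA0.le
      calc A ^ α ≤ A ^ (1:ℝ) := Real.rpow_le_rpow_of_exponent_le hA1 hα1.le
        _ = A := Real.rpow_one A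
    · have c1 : |pd d i u x - pd d i u y| ≤ A * 1 := by
        refine (abs_sub _ _).trans ?_
        linarith [G.pdu i x, G.pdu i y]
      have c2 : |pd d i u x - pd d i u y| ≤ A * ρ := by
        refine (lip_of_pd ((contDiff_pd hu2 i).differentiable (by norm_num)) (fun k x => hPb k i x) hP x y).trans ?_
        calc (d:ℝ) * P * dist x y ≤ d * T * dist x y := by gcongr; linarith
          _ = d * ρ := by rw [hρdef]; ring
          _ ≤ _ := mul_le_mul_of_nonneg_right (by linarith) hρ0
      have c3 : |pd d i u x - pd d i u y| / A ≤ ρ ^ γ :=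
        le_rpow_of_le (by positivity) (by rw [div_le_iff₀ hA0]; linarith)
          (by rw [div_le_iff₀ hA0]; linarith) hγ hγ'.le
      rw [div_le_iff₀ hA0] at c3
      linarith)
  have hε1' : 1 / ε ≤ 1 := by rw [div_le_one hε0]; exact hε1
  have hP1 : P ≤ 1 := by
    have h1 := hPmin _ (fun i j x => interp_hess hu2 hγ (by positivity) hDu hH (t := s / T) (by positivity) i j x)
    have h2 : 2 * (Q * (1 / ε)) / (s / T) ≤ T / 4 := by
      have e : 2 * (Q * (1 / ε)) / (s / T) = (8 * Q / s) / ε * (T / 4) := by field_simp; ring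
      rw [e]
      have : (8 * Q / s) / ε ≤ 1 := by rw [div_le_one hε0]; exact hεs
      calc (8 * Q / s) / ε * (T / 4) ≤ 1 * (T / 4) := by gcongr
        _ = _ := one_mul _
    have h3 : T ^ γ * (1 + 1 / ε * P) + P ≤ T ^ γ * (3 * T) := by
      have f1 : 1 / ε * P ≤ P := mul_le_of_le_one_left hP hε1'
      have f2 : P ≤ T ^ γ * T := by nlinarith
      have f3 : T ^ γ * (1 + 1 / ε * P) ≤ T ^ γ * T := by gcongr; linarith
      have f4 : 0 ≤ T ^ γ * T := by positivity
      linarith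
    have h4 : C1 * A * (T ^ γ * (1 + 1 / ε * P) + P) * (s / T) ^ γ ≤ T / 4 := by
      calc C1 * A * (T ^ γ * (1 + 1 / ε * P) + P) * (s / T) ^ γ
          ≤ K * (T ^ γ * (3 * T)) * (s / T) ^ γ := by gcongr
        _ = (K * s ^ γ) * (3 * T) := by
          rw [Real.div_rpow hs0.le hT0.le]
          have : T ^ γ ≠ 0 := by positivity
          field_simp
        _ = T / 4 := by rw [hs]; ring
    linarith
  refine ⟨fun i j x => by linarith [hPb i j x], fun i j x y => (hH i j x y).trans ?_⟩
  have h3 : C1 * A * (T ^ γ * (1 + 1 / ε * P) + P) ≤ 1 + 5 * K := by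
    have f1 : 1 / ε * P ≤ 1 := mul_le_one₀ hε1' hP hP1
    have f2 : T ^ γ * (1 + 1 / ε * P) ≤ 2 * 2 := by
      have : 0 ≤ 1 / ε * P := by positivity
      exact mul_le_mul (by linarith) (by linarith) (by linarith) (by norm_num)
    have f3 : K * (T ^ γ * (1 + 1 / ε * P) + P) ≤ K * 5 := by gcongr; linarith
    linarith
  gcongr

theorem main_est {d : ℕ} (hd : 2 ≤ d) {α : ℝ} (hα0 : 0 < α) (hα1 : α < 1) {g : ℝ → ℝ} {V : (Fin d → ℝ) → ℝ}
    {Q : ℝ} (hQ : 1 ≤ Q) :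
    ∃ C γ : ℝ, 0 < C ∧ 0 < γ ∧ γ < 1 ∧ ∀ ε, ∀ u m : (Fin d → ℝ) → ℝ, Good d α g V Q ε u m →
      (∀ i j x, |pd d i (pd d j u) x| ≤ C) ∧
      ∀ i j x y, |pd d i (pd d j u) x - pd d i (pd d j u) y| ≤ C * dist x y ^ γ := by
  obtain ⟨E, γ1, C1, hE, h1, h1', hC1, H1⟩ := large_case hd hα0 hα1 (g := g) (V := V) hQ
  obtain ⟨γ2, C2, h2, h2', hC2, H2⟩ := small_case hd hα0 hα1 (g := g) (V := V) hQ hE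
  have hmin : 0 < min γ1 γ2 := lt_min h1 h2
  have key : ∀ (C γ : ℝ) (u : (Fin d → ℝ) → ℝ), 0 < C → C ≤ C1 + C2 → min γ1 γ2 ≤ γ →
      ((∀ i j x, |pd d i (pd d j u) x| ≤ C) ∧
      ∀ i j x y, |pd d i (pd d j u) x - pd d i (pd d j u) y| ≤ C * dist x y ^ γ) →
      (∀ i j x, |pd d i (pd d j u) x| ≤ 2 * (C1 + C2)) ∧
      ∀ i j x y, |pd d i (pd d j u) x - pd d i (pd d j u) y| ≤ 2 * (C1 + C2) * dist x y ^ (min γ1 γ2) := by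
    intro C γ u hC0 hC hγ H
    refine ⟨fun i j x => by linarith [H.1 i j x], fun i j x y => ?_⟩
    rcases le_total (dist x y) 1 with hr | hr
    · refine (H.2 i j x y).trans ?_
      have := rpow_mono_exp dist_nonneg hr hmin hγ
      exact mul_le_mul (by linarith) this (by positivity) (by linarith)
    · have h3 := Real.one_le_rpow hr hmin.le
      have h4 : |pd d i (pd d j u) x - pd d i (pd d j u) y| ≤ 2 * (C1 + C2) := by
        refine (abs_sub _ _).trans ?_
        linarith [H.1 i j x, H.1 i j y]
      exact h4.trans (le_mul_of_one_le_right (by linarith) h3)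
  refine ⟨2 * (C1 + C2), min γ1 γ2, by positivity, hmin, (min_le_left _ _).trans_lt h1', fun ε u m G => ?_⟩
  rcases le_total ε E with h | h
  · exact key C2 γ2 u hC2 (by linarith) (min_le_right _ _) (H2 ε h u m G)
  · exact key C1 γ1 u hC1 (by linarith) (min_le_left _ _) (H1 ε h u m G)

theorem stmt6 (d : ℕ) (α : ℝ) (hα0 : 0 < α) (hα1 : α < 1)
    (g : ℝ → ℝ) (V : (Fin d → ℝ) → ℝ) (hg : Ghyp α g) (hV : Vhyp d α V)
    (hd : 2 ≤ d) (hA1 : A1 d g V) (hA2 : A2 g) :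
    ∃ C α' : ℝ, 0 < C ∧ 0 < α' ∧ α' < 1 ∧
      ∀ ε : ℝ, 0 < ε → ∀ u m : (Fin d → ℝ) → ℝ,
        DiscSol d α g V ε u m →
          (∀ i x, |pd d i u x| ≤ C) ∧
          (∀ i j x, |pd d i (pd d j u) x| ≤ C) ∧
          (∀ i j x y, |pd d i (pd d j u) x - pd d i (pd d j u) y| ≤ C * dist x y ^ α') := by
  obtain ⟨Q, hQ, hgood⟩ := exists_good (by omega : 1 ≤ d) hα0 hg hV hA1 hA2
  obtain ⟨C, γ, hC, hγ0, hγ1, H⟩ := main_est hd hα0 hα1 (g := g) (V := V) hQ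
  refine ⟨C + Q, γ, by linarith, hγ0, hγ1, fun ε hε u m hs => ?_⟩
  have G := hgood ε hε u m hs
  obtain ⟨H1, H2⟩ := H ε u m G
  refine ⟨fun i x => by linarith [G.pdu i x], fun i j x => by linarith [H1 i j x], fun i j x y => ?_⟩
  refine (H2 i j x y).trans ?_
  have : 0 ≤ dist x y ^ γ := Real.rpow_nonneg dist_nonneg γ
  exact mul_le_mul_of_nonneg_right (by linarith) this
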